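/- arXiv:1605.09145 — 14 statements merged into one kernel-verified Lean document; each statement's English description precedes it below -/
import Mathlib

section
/- Let k be an algebraically closed field of characteristic different from 2, let S = k[x₁,…,xₙ] with its standard grading, and let I ⊆ S be an ideal generated by homogeneous polynomials of degree 2 such that dim_k (S/I)₂ = 3. Write h(m) = dim_k (S/I)_m for the Hilbert function of S/I. Then h(0) = 1, h(1) = n, h(2) = 3, and exactly one of the following holds: (a) h(m) = 0 for all m ≥ 3; (b) h(3) = 1 and h(m) = 0 for all m ≥ 4; (c) h(m) = 1 for all m ≥ 3; (d) h(m) = 2 for all m ≥ 3; (e) h(m) = 3 for all m ≥ 3; (f) h(m) = m + 1 for all m ≥ 3. -/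
open MvPolynomial

/-- The Hilbert function of `S/I`: the `k`-dimension of the degree-`m`
homogeneous component of `S/I`, realized as the image in `S/I` of the space of
homogeneous polynomials of degree `m`. -/
noncomputable def hilbFn (k : Type*) [Field k] (n : ℕ)
    (I : Ideal (MvPolynomial (Fin n) k)) (m : ℕ) : ℕ :=
  Module.finrank k
    ((MvPolynomial.homogeneousSubmodule (Fin n) k m).map
      (Ideal.Quotient.mkₐ k I).toLinearMap)

section Powers

variable {k Q : Type*} [Field k] [CommRing Q] [Algebra k Q] {V : Submodule k Q}

lemma mul_mem_pow_add {x y : Q} {a b : ℕ} (hx : x ∈ V ^ a) (hy : y ∈ V ^ b) :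
    x * y ∈ V ^ (a + b) := by
  rw [pow_add]; exact Submodule.mul_mem_mul hx hy

lemma mul_mem_pow_succ {u w : Q} {m : ℕ} (hu : u ∈ V) (hw : w ∈ V ^ m) :
    u * w ∈ V ^ (m + 1) := by
  rw [pow_succ']; exact Submodule.mul_mem_mul hu hw

lemma mul_mem_sq {u v : Q} (hu : u ∈ V) (hv : v ∈ V) : u * v ∈ V ^ 2 := by
  rw [pow_two]; exact Submodule.mul_mem_mul hu hv

end Powers

section Volume

variable {k Q : Type*} [Field k] [CommRing Q] [Algebra k Q]

/-- The determinant of three vectors in the coordinates given by a linear map to `k³`. -/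
def vol (c : Q →ₗ[k] Fin 3 → k) (x y z : Q) : k :=
  c x 0 * (c y 1 * c z 2 - c y 2 * c z 1) - c x 1 * (c y 0 * c z 2 - c y 2 * c z 0)
    + c x 2 * (c y 0 * c z 1 - c y 1 * c z 0)

lemma vol_rotate (c : Q →ₗ[k] Fin 3 → k) (x y z : Q) : vol c x y z = vol c y z x := by
  simp only [vol]; ring

/-- The functional `vol c · y z`. -/
def volLeft (c : Q →ₗ[k] Fin 3 → k) (y z : Q) : Q →ₗ[k] k :=
  (c y 1 * c z 2 - c y 2 * c z 1) • (LinearMap.proj 0 ∘ₗ c)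
    - (c y 0 * c z 2 - c y 2 * c z 0) • (LinearMap.proj 1 ∘ₗ c)
    + (c y 0 * c z 1 - c y 1 * c z 0) • (LinearMap.proj 2 ∘ₗ c)

lemma volLeft_apply (c : Q →ₗ[k] Fin 3 → k) (x y z : Q) : volLeft c y z x = vol c x y z := by
  simp [volLeft, vol]
  ring

lemma cubic_coeff_eq_zero [Infinite k] {a b c d : k}
    (h : ∀ t : k, a + b * t + c * t ^ 2 + d * t ^ 3 = 0) : a = 0 ∧ b = 0 ∧ c = 0 ∧ d = 0 := by
  have hp : (Polynomial.C a + Polynomial.C b * Polynomial.X + Polynomial.C c * Polynomial.X ^ 2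
      + Polynomial.C d * Polynomial.X ^ 3 : Polynomial k) = 0 :=
    Polynomial.funext fun t => by simpa using h t
  refine ⟨?_, ?_, ?_, ?_⟩
  · simpa [Polynomial.coeff_X, Polynomial.coeff_C] using congrArg (fun p => p.coeff 0) hp
  · simpa [Polynomial.coeff_X, Polynomial.coeff_C] using congrArg (fun p => p.coeff 1) hp
  · simpa [Polynomial.coeff_X, Polynomial.coeff_C] using congrArg (fun p => p.coeff 2) hp
  · simpa [Polynomial.coeff_X, Polynomial.coeff_C] using congrArg (fun p => p.coeff 3) hp

lemma exists_coordinates {W : Submodule k Q} (hW : Module.finrank k W = 3) :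
    ∃ c : Q →ₗ[k] Fin 3 → k, (∀ w ∈ W, c w = 0 → w = 0) ∧ ∀ v, ∃ w ∈ W, c w = v := by
  have : Module.Finite k W := Module.finite_of_finrank_pos (by omega)
  let e : W ≃ₗ[k] (Fin 3 → k) := LinearEquiv.ofFinrankEq _ _ (by simp [hW])
  obtain ⟨c, hc⟩ := LinearMap.exists_extend e.toLinearMap
  have hc' : ∀ w : W, c w = e w := fun w => LinearMap.congr_fun hc w
  refine ⟨c, fun w hw h => ?_, fun v => ⟨e.symm v, (e.symm v).2, by simp [hc']⟩⟩
  have := hc' ⟨w, hw⟩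
  simp only [h] at this
  simpa using (e.map_eq_zero_iff.1 this.symm)

variable {W : Submodule k Q} {c : Q →ₗ[k] Fin 3 → k}

lemma exists_combination_of_vol_ne_zero (hc : ∀ w ∈ W, c w = 0 → w = 0) {x y z : Q}
    (hx : x ∈ W) (hy : y ∈ W) (hz : z ∈ W) (h : vol c x y z ≠ 0) {w : Q} (hw : w ∈ W) :
    ∃ a b d : k, w = a • x + b • y + d • z := by
  refine ⟨vol c w y z / vol c x y z, vol c x w z / vol c x y z, vol c x y w / vol c x y z, ?_⟩
  rw [← sub_eq_zero]
  refine hc _ (by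
    refine W.sub_mem hw (W.add_mem (W.add_mem ?_ ?_) ?_) <;> exact W.smul_mem _ ‹_›) ?_
  ext i
  fin_cases i <;> simp <;> field_simp <;> simp only [vol] <;> ring

lemma eq_zero_of_combination {x y z : Q} (h : vol c x y z ≠ 0) {a b d : k}
    (h0 : a • x + b • y + d • z = 0) : a = 0 ∧ b = 0 ∧ d = 0 := by
  have e : ∀ i, a * c x i + b * c y i + d * c z i = 0 := fun i => by
    simpa using congrFun (congrArg c h0) i
  have e0 := e 0
  have e1 := e 1
  have e2 := e 2
  refine ⟨?_, ?_, ?_⟩ <;> refine (mul_eq_zero.1 ?_).resolve_right h <;> simp only [vol]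
  · linear_combination (c y 1 * c z 2 - c y 2 * c z 1) * e0
      - (c y 0 * c z 2 - c y 2 * c z 0) * e1 + (c y 0 * c z 1 - c y 1 * c z 0) * e2
  · linear_combination -(c x 1 * c z 2 - c x 2 * c z 1) * e0
      + (c x 0 * c z 2 - c x 2 * c z 0) * e1 - (c x 0 * c z 1 - c x 1 * c z 0) * e2
  · linear_combination (c x 1 * c y 2 - c x 2 * c y 1) * e0
      - (c x 0 * c y 2 - c x 2 * c y 0) * e1 + (c x 0 * c y 1 - c x 1 * c y 0) * e2

lemma exists_vol_ne_zero (hsurj : ∀ v, ∃ w ∈ W, c w = v) :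
    ∃ x ∈ W, ∃ y ∈ W, ∃ z ∈ W, vol c x y z ≠ 0 := by
  obtain ⟨x, hx, ex⟩ := hsurj ![1, 0, 0]
  obtain ⟨y, hy, ey⟩ := hsurj ![0, 1, 0]
  obtain ⟨z, hz, ez⟩ := hsurj ![0, 0, 1]
  exact ⟨x, hx, y, hy, z, hz, by simp [vol, ex, ey, ez]⟩

end Volume

section Rank

variable {k Q : Type*} [Field k] [CommRing Q] [Algebra k Q] {V : Submodule k Q}

/-- A linear functional on `V ^ 2` that vanishes on squares vanishes (characteristic not two). -/
lemma functional_eq_zero_of_squares (h2 : (2 : k) ≠ 0) (φ : Q →ₗ[k] k)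
    (h : ∀ v ∈ V, φ (v * v) = 0) {w : Q} (hw : w ∈ V ^ 2) : φ w = 0 := by
  rw [pow_two] at hw
  refine Submodule.mul_induction_on hw (fun u hu v hv => ?_) fun x y hx hy => by
    rw [map_add, hx, hy, add_zero]
  have := h (u + v) (V.add_mem hu hv)
  rw [show (u + v) * (u + v) = u * u + (u * v + u * v) + v * v by ring, map_add, map_add, map_add,
    h u hu, h v hv] at this
  exact (mul_eq_zero.1 (by linear_combination this : (2 : k) * φ (u * v) = 0)).resolve_left h2

end Rank

section RankTwo

variable {k Q : Type*} [Field k] [CommRing Q] [Algebra k Q] {V : Submodule k Q}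
  {c : Q →ₗ[k] Fin 3 → k}

lemma vol_eq_zero_of_squares (h2 : (2 : k) ≠ 0) {x y : Q}
    (h : ∀ v ∈ V, vol c x y (v * v) = 0) {w : Q} (hw : w ∈ V ^ 2) : vol c x y w = 0 := by
  rw [vol_rotate, vol_rotate, ← volLeft_apply]
  refine functional_eq_zero_of_squares h2 _ (fun v hv => ?_) hw
  rw [volLeft_apply, vol_rotate, h v hv]

/-- If multiplication by every linear form has rank at most two from degree one to degree two,
then some `e`, `f` in degree one have `e²`, `ef`, `f²` independent. -/
lemma exists_vol_binary_ne_zero [Infinite k] (h2 : (2 : k) ≠ 0)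
    (hc : ∀ w ∈ V ^ 2, c w = 0 → w = 0) (hsurj : ∀ v, ∃ w ∈ V ^ 2, c w = v)
    (H : ∀ l ∈ V, ∀ x ∈ V, ∀ y ∈ V, ∀ z ∈ V, vol c (l * x) (l * y) (l * z) = 0) :
    ∃ e ∈ V, ∃ f ∈ V, vol c (e * e) (e * f) (f * f) ≠ 0 := by
  by_contra! G
  have sq : ∀ l ∈ V, ∀ m ∈ V, ∀ v ∈ V, vol c (l * l) (l * m) (v * v) = 0 := by
    intro l hl m hm v hv
    by_contra hne
    obtain ⟨a, b, d, hlv⟩ :=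
      exists_combination_of_vol_ne_zero hc (mul_mem_sq hl hl) (mul_mem_sq hl hm)
      (mul_mem_sq hv hv) hne (mul_mem_sq hl hv)
    have hd : d = 0 := by
      have := H l hl l hl m hm v hv
      rw [hlv] at this
      refine (mul_eq_zero.1 ?_).resolve_right hne
      simp only [vol, map_add, map_smul, Pi.add_apply, Pi.smul_apply, smul_eq_mul] at this ⊢
      linear_combination this
    obtain ⟨r, hr⟩ : ∃ r, r = v - a • l - b • m := ⟨_, rfl⟩
    have hrV : r ∈ V := hr ▸ V.sub_mem (V.sub_mem hv (V.smul_mem _ hl)) (V.smul_mem _ hm)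
    have hlr : l * r = 0 := by
      rw [hr, mul_sub, mul_sub, hlv, hd]
      simp
    have hmr : vol c (l * l) (l * m) (m * r) = 0 := by
      refine (cubic_coeff_eq_zero (a := 0) (b := vol c (l * l) (l * m) (m * r))
        (c := vol c (l * l) (m * m) (m * r)) (d := vol c (l * m) (m * m) (m * r)) fun t => ?_).2.1
      have := H (l + t • m) (V.add_mem hl (V.smul_mem _ hm)) l hl m hm r hrV
      simp only [add_mul, smul_mul_assoc, hlr, mul_comm m l] at this
      simp only [vol, map_add, map_smul, Pi.add_apply, Pi.smul_apply, smul_eq_mul, map_zero,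
        Pi.zero_apply] at this ⊢
      linear_combination this
    have hrr : vol c (l * l) (l * m) (r * r) = 0 := by
      refine (cubic_coeff_eq_zero (a := 0) (b := vol c (l * l) (l * m) (r * r))
        (c := vol c (l * l) (m * r) (r * r)) (d := 0) fun t => ?_).2.1
      have := H (l + t • r) (V.add_mem hl (V.smul_mem _ hrV)) l hl m hm r hrV
      simp only [add_mul, smul_mul_assoc, hlr, mul_comm r l, mul_comm r m] at this
      simp only [vol, map_add, map_smul, Pi.add_apply, Pi.smul_apply, smul_eq_mul, map_zero,
        Pi.zero_apply] at this ⊢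
      linear_combination this
    apply hne
    have hvv : v * v = (a * a) • (l * l) + (2 * a * b) • (l * m) + (b * b) • (m * m)
        + (2 * b) • (m * r) + r * r := by
      have : v = a • l + b • m + r := by rw [hr]; abel
      have e : v * v = (a * a) • (l * l) + (2 * a * b) • (l * m) + (b * b) • (m * m)
        + (2 * b) • (m * r) + r * r + (2 * a) • (l * r) := by
        rw [this]
        simp only [Algebra.smul_def, map_mul, map_ofNat]
        ring
      rw [e, hlr, smul_zero, add_zero]
    have hmm := G l hl m hm
    rw [hvv]
    simp only [vol, map_add, map_smul, Pi.add_apply, Pi.smul_apply, smul_eq_mul] at hmm hmr hrr ⊢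
    linear_combination (b * b) * hmm + (2 * b) * hmr + hrr
  have sq2 : ∀ l ∈ V, ∀ m ∈ V, ∀ w ∈ V ^ 2, vol c (l * l) (m * m) w = 0 := by
    intro l hl m hm w hw
    refine (cubic_coeff_eq_zero (a := vol c (l * l) (l * m) w) (b := vol c (l * l) (m * m) w)
      (c := vol c (l * m) (m * m) w) (d := 0) fun t => ?_).2.1
    have := vol_eq_zero_of_squares h2 (sq (l + t • m) (V.add_mem hl (V.smul_mem _ hm)) m hm) hw
    simp only [add_mul, mul_add, smul_mul_assoc, mul_smul_comm, mul_comm m l] at this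
    simp only [vol, map_add, map_smul, Pi.add_apply, Pi.smul_apply, smul_eq_mul] at this ⊢
    linear_combination this
  obtain ⟨x, hx, y, hy, z, hz, hne⟩ := exists_vol_ne_zero (W := V ^ 2) hsurj
  refine hne (vol_eq_zero_of_squares h2 (fun u hu => ?_) hz)
  rw [← vol_rotate]
  refine vol_eq_zero_of_squares h2 (fun v hv => ?_) hy
  rw [← vol_rotate]
  refine vol_eq_zero_of_squares h2 (fun w hw => ?_) hx
  rw [← vol_rotate, vol_rotate]
  exact sq2 v hv u hu _ (mul_mem_sq hw hw)

/-- In the rank two situation every linear form is, up to the annihilator of degree one,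
a combination of `e` and `f`. -/
lemma exists_binary_decomposition [Infinite k] (hc : ∀ w ∈ V ^ 2, c w = 0 → w = 0)
    (H : ∀ l ∈ V, ∀ x ∈ V, ∀ y ∈ V, ∀ z ∈ V, vol c (l * x) (l * y) (l * z) = 0)
    {e f : Q} (he : e ∈ V) (hf : f ∈ V) (hef : vol c (e * e) (e * f) (f * f) ≠ 0)
    {v : Q} (hv : v ∈ V) : ∃ a b : k, ∀ u ∈ V, v * u = (a • e + b • f) * u := by
  have comb : ∀ w ∈ V ^ 2, ∃ a b d : k, w = a • (e * e) + b • (e * f) + d • (f * f) := fun w hw =>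
    exists_combination_of_vol_ne_zero hc (mul_mem_sq he he) (mul_mem_sq he hf) (mul_mem_sq hf hf)
      hef hw
  have eq_zero : ∀ w ∈ V ^ 2, vol c (e * e) (e * f) w = 0 → vol c (e * e) (f * f) w = 0 →
      vol c (e * f) (f * f) w = 0 → w = 0 := by
    intro w hw h1 h2 h3
    obtain ⟨a, b, d, hw'⟩ := comb w hw
    have ha : a = 0 := (mul_eq_zero.1 (by
      rw [hw'] at h3
      simp only [vol, map_add, map_smul, Pi.add_apply, Pi.smul_apply, smul_eq_mul] at h3 ⊢
      linear_combination h3)).resolve_right hef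
    have hb : b = 0 := (mul_eq_zero.1 (by
      rw [hw'] at h2
      simp only [vol, map_add, map_smul, Pi.add_apply, Pi.smul_apply, smul_eq_mul] at h2 ⊢
      linear_combination -h2)).resolve_right hef
    have hd : d = 0 := (mul_eq_zero.1 (by
      rw [hw'] at h1
      simp only [vol, map_add, map_smul, Pi.add_apply, Pi.smul_apply, smul_eq_mul] at h1 ⊢
      linear_combination h1)).resolve_right hef
    simp [hw', ha, hb, hd]
  have red : ∀ v ∈ V, ∃ a b : k, e * (v - a • e - b • f) = 0 ∧ f * (v - a • e - b • f) = 0 := by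
    intro v hv
    obtain ⟨a, b, d, hev⟩ := comb _ (mul_mem_sq he hv)
    have hd : d = 0 := by
      have := H e he e he f hf v hv
      rw [hev] at this
      refine (mul_eq_zero.1 ?_).resolve_right hef
      simp only [vol, map_add, map_smul, Pi.add_apply, Pi.smul_apply, smul_eq_mul] at this ⊢
      linear_combination this
    obtain ⟨r, hr⟩ : ∃ r, r = v - a • e - b • f := ⟨_, rfl⟩
    have hrV : r ∈ V := hr ▸ V.sub_mem (V.sub_mem hv (V.smul_mem _ he)) (V.smul_mem _ hf)
    have her : e * r = 0 := by
      rw [hr, mul_sub, mul_sub, hev, hd]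
      simp
    refine ⟨a, b, hr ▸ her, hr ▸ ?_⟩
    obtain ⟨-, h1, h2, h3⟩ := cubic_coeff_eq_zero (a := 0) (b := vol c (e * e) (e * f) (f * r))
      (c := vol c (e * e) (f * f) (f * r)) (d := vol c (e * f) (f * f) (f * r)) fun t => by
        have := H (e + t • f) (V.add_mem he (V.smul_mem _ hf)) e he f hf r hrV
        simp only [add_mul, smul_mul_assoc, her, mul_comm f e] at this
        simp only [vol, map_add, map_smul, Pi.add_apply, Pi.smul_apply, smul_eq_mul, map_zero,
          Pi.zero_apply] at this ⊢
        linear_combination this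
    exact eq_zero _ (mul_mem_sq hf hrV) h1 h2 h3
  have ann : ∀ r ∈ V, e * r = 0 → f * r = 0 → ∀ s ∈ V, e * s = 0 → f * s = 0 → r * s = 0 := by
    intro r hr her hfr s hs hes hfs
    have key : ∀ x y : k, vol c (x • (e * e) + y • (e * f)) (x • (e * f) + y • (f * f))
        (r * s) = 0 := by
      intro x y
      have := H (x • e + y • f + r) (V.add_mem (V.add_mem (V.smul_mem _ he) (V.smul_mem _ hf)) hr)
        e he f hf s hs
      simp only [add_mul, smul_mul_assoc, hes, hfs, mul_comm f e, mul_comm r e, mul_comm r f, her,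
        hfr, add_zero, smul_zero, zero_add] at this
      exact this
    have k1 := key 1 0
    have k2 := key 0 1
    have k3 := key 1 1
    simp only [one_smul, zero_smul, add_zero, zero_add] at k1 k2 k3
    refine eq_zero _ (mul_mem_sq hr hs) k1 ?_ k2
    simp only [vol, map_add, Pi.add_apply] at k1 k2 k3 ⊢
    linear_combination k3 - k1 - k2
  obtain ⟨a, b, h1, h2⟩ := red v hv
  refine ⟨a, b, fun u hu => ?_⟩
  obtain ⟨a', b', h3, h4⟩ := red u hu
  have := ann _ (V.sub_mem (V.sub_mem hv (V.smul_mem _ he)) (V.smul_mem _ hf)) h1 h2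
    _ (V.sub_mem (V.sub_mem hu (V.smul_mem _ he)) (V.smul_mem _ hf)) h3 h4
  simp only [Algebra.smul_def] at *
  linear_combination this + algebraMap k Q a' * h1 + algebraMap k Q b' * h2

end RankTwo

section Lift

variable {k : Type*} [Field k] {n : ℕ}

/-- The space of linear forms in `S/I`. -/
noncomputable def linForms (I : Ideal (MvPolynomial (Fin n) k)) :
    Submodule k (MvPolynomial (Fin n) k ⧸ I) :=
  (homogeneousSubmodule (Fin n) k 1).map (Ideal.Quotient.mkₐ k I).toLinearMap

lemma linForms_pow (I : Ideal (MvPolynomial (Fin n) k)) (m : ℕ) :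
    linForms I ^ m
      = (homogeneousSubmodule (Fin n) k m).map (Ideal.Quotient.mkₐ k I).toLinearMap := by
  rw [linForms, ← Submodule.map_pow, homogeneousSubmodule_one_pow]

lemma hilbFn_eq (I : Ideal (MvPolynomial (Fin n) k)) (m : ℕ) :
    hilbFn k n I m = Module.finrank k ↥(linForms I ^ m) := by
  rw [hilbFn, linForms_pow]

lemma linForms_fg (I : Ideal (MvPolynomial (Fin n) k)) : (linForms I).FG :=
  (homogeneousSubmodule_fg _ _ 1).map _

open scoped IsMulCommutative in
/-- Commuting operators that satisfy the quadratic relations on a vector `m₀` induce a map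
from the quotient sending `1` to `m₀`. -/
lemma exists_lift {I : Ideal (MvPolynomial (Fin n) k)} {s : Set (MvPolynomial (Fin n) k)}
    (hs : ∀ q ∈ s, q.IsHomogeneous 2) (hI : I = Ideal.span s)
    {M : Type*} [AddCommGroup M] [Module k M] (B : linForms I →ₗ[k] Module.End k M)
    (hB : ∀ u v, B u * B v = B v * B u) (m₀ : M) (τ : ↥(linForms I ^ 2) →ₗ[k] M)
    (hτ : ∀ (u v : linForms I) (h : (u * v : MvPolynomial (Fin n) k ⧸ I) ∈ linForms I ^ 2),
      τ ⟨u * v, h⟩ = B u (B v m₀)) :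
    ∃ Φ : (MvPolynomial (Fin n) k ⧸ I) →ₗ[k] M,
      Φ 1 = m₀ ∧ ∀ (u : linForms I) y, Φ (u * y) = B u (Φ y) := by
  have hc : IsMulCommutative (Algebra.adjoin k (Set.range B)) :=
    Algebra.isMulCommutative_adjoin k (by rintro _ ⟨u, rfl⟩ _ ⟨v, rfl⟩; exact hB u v)
  have hX : ∀ p ∈ homogeneousSubmodule (Fin n) k 1, Ideal.Quotient.mkₐ k I p ∈ linForms I :=
    fun p hp => Submodule.mem_map_of_mem hp
  let θ : MvPolynomial (Fin n) k →ₐ[k] Algebra.adjoin k (Set.range B) :=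
    aeval fun i => ⟨B ⟨Ideal.Quotient.mkₐ k I (X i), hX _ (isHomogeneous_X k i)⟩,
      Algebra.subset_adjoin ⟨_, rfl⟩⟩
  let θ' : MvPolynomial (Fin n) k →ₐ[k] Module.End k M := (Subalgebra.val _).comp θ
  have hθ : ∀ p (hp : p ∈ homogeneousSubmodule (Fin n) k 1),
      θ' p = B ⟨Ideal.Quotient.mkₐ k I p, hX p hp⟩ := by
    intro p hp
    have hp' := hp
    rw [homogeneousSubmodule_one_eq_span_X] at hp'
    induction hp' using Submodule.span_induction with
    | mem x h => obtain ⟨i, rfl⟩ := h; simp [θ', θ]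
    | zero => rw [map_zero]; exact (map_zero B).symm
    | add x y hx hy h1 h2 =>
      rw [← homogeneousSubmodule_one_eq_span_X] at hx hy
      rw [map_add, h1 hx, h2 hy, ← map_add]
      rfl
    | smul a x hx h1 =>
      rw [← homogeneousSubmodule_one_eq_span_X] at hx
      rw [map_smul, h1 hx, ← map_smul]
      rfl
  have mem2 : ∀ p ∈ homogeneousSubmodule (Fin n) k 2,
      Ideal.Quotient.mkₐ k I p ∈ linForms I ^ 2 := fun p hp => by
    rw [linForms_pow]; exact Submodule.mem_map_of_mem hp
  have hq : ∀ p (hp : p ∈ homogeneousSubmodule (Fin n) k 2),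
      θ' p m₀ = τ ⟨Ideal.Quotient.mkₐ k I p, mem2 p hp⟩ := by
    intro p hp
    have hp' := hp
    rw [← homogeneousSubmodule_one_pow, pow_two] at hp'
    have key : ∃ h, θ' p m₀ = τ ⟨Ideal.Quotient.mkₐ k I p, h⟩ := by
      refine Submodule.mul_induction_on hp' (fun x hx y hy => ?_) fun x y hx hy => ?_
      · have h : Ideal.Quotient.mkₐ k I (x * y) ∈ linForms I ^ 2 := by
          rw [map_mul, pow_two]; exact Submodule.mul_mem_mul (hX x hx) (hX y hy)
        refine ⟨h, ?_⟩
        rw [map_mul, Module.End.mul_apply, hθ x hx, hθ y hy]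
        have := hτ ⟨_, hX x hx⟩ ⟨_, hX y hy⟩ (by simpa using h)
        rw [← this]
        simp
      · obtain ⟨h1, e1⟩ := hx
        obtain ⟨h2, e2⟩ := hy
        refine ⟨by rw [map_add]; exact Submodule.add_mem _ h1 h2, ?_⟩
        rw [map_add, LinearMap.add_apply, e1, e2, ← map_add]
        simp
    exact key.2
  have hker : ∀ p ∈ I, θ' p m₀ = 0 := by
    intro p hp
    rw [hI] at hp
    induction hp using Submodule.span_induction with
    | mem x h =>
      rw [hq x (hs x h)]
      have : Ideal.Quotient.mkₐ k I x = 0 := by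
        rw [Ideal.Quotient.mkₐ_eq_mk, Ideal.Quotient.eq_zero_iff_mem, hI]
        exact Ideal.subset_span h
      simp only [this]
      exact map_zero τ
    | zero => simp
    | add x y _ _ h1 h2 => rw [map_add, LinearMap.add_apply, h1, h2, add_zero]
    | smul a x _ h1 => rw [smul_eq_mul, map_mul, Module.End.mul_apply, h1, map_zero]
  obtain ⟨σ, hσ⟩ := LinearMap.exists_rightInverse_of_surjective
    (Ideal.Quotient.mkₐ k I).toLinearMap
    (LinearMap.range_eq_top.2 (Ideal.Quotient.mkₐ_surjective k I))
  have hσ' : ∀ y, Ideal.Quotient.mkₐ k I (σ y) = y := fun y => LinearMap.congr_fun hσ y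
  let Φ : (MvPolynomial (Fin n) k ⧸ I) →ₗ[k] M :=
    (LinearMap.applyₗ m₀ ∘ₗ θ'.toLinearMap) ∘ₗ σ
  have hΦ : ∀ p, Φ (Ideal.Quotient.mkₐ k I p) = θ' p m₀ := by
    intro p
    have := hker (σ (Ideal.Quotient.mkₐ k I p) - p) (by
      rw [← Ideal.Quotient.eq_zero_iff_mem, ← Ideal.Quotient.mkₐ_eq_mk k, map_sub, hσ', sub_self])
    rw [map_sub, LinearMap.sub_apply, sub_eq_zero] at this
    exact this
  refine ⟨Φ, ?_, ?_⟩
  · rw [← map_one (Ideal.Quotient.mkₐ k I), hΦ, map_one, Module.End.one_apply]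
  · rintro ⟨u, p, hp, rfl⟩ y
    obtain ⟨q, rfl⟩ := Ideal.Quotient.mkₐ_surjective k I y
    rw [hΦ q]
    change Φ (Ideal.Quotient.mkₐ k I p * _) = _
    rw [← map_mul, hΦ, map_mul, Module.End.mul_apply, hθ p hp]
    rfl

end Lift

section Persistence

variable {k : Type*} [Field k] {n : ℕ} {I : Ideal (MvPolynomial (Fin n) k)}

instance linForms_pow_finite (m : ℕ) : Module.Finite k ↥(linForms I ^ m) :=
  Module.Finite.iff_fg.2 ((linForms_fg I).pow m)

/-- If multiplication by `l` maps degree `e + 1` onto degree `e + 2`, its kernel is annihilated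
by all linear forms, and the operators `v / l` commute, then the Hilbert function does not drop
below its value in degree `e + 2`. -/
lemma finrank_le_of_commuting {s : Set (MvPolynomial (Fin n) k)}
    (hs : ∀ q ∈ s, q.IsHomogeneous 2) (hI : I = Ideal.span s) {e : ℕ}
    {l : MvPolynomial (Fin n) k ⧸ I} (hl : l ∈ linForms I)
    (hsurj : ∀ x ∈ linForms I ^ (e + 2), ∃ w ∈ linForms I ^ (e + 1), l * w = x)
    (hker : ∀ w ∈ linForms I ^ (e + 1), l * w = 0 → ∀ v ∈ linForms I, v * w = 0)
    (hcomm : ∀ u ∈ linForms I, ∀ v ∈ linForms I, ∀ a ∈ linForms I ^ (e + 1),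
      ∀ b ∈ linForms I ^ (e + 1), ∀ c ∈ linForms I ^ (e + 1),
      u * a = l * b → v * a = l * c → v * b = u * c) (j : ℕ) :
    Module.finrank k ↥(linForms I ^ (e + 2)) ≤ Module.finrank k ↥(linForms I ^ (e + 2 + j)) := by
  have hlpow : ∀ m, l ^ m ∈ linForms I ^ m := fun m => Submodule.pow_mem_pow _ hl m
  let μ : ↥(linForms I ^ (e + 1)) →ₗ[k] ↥(linForms I ^ (e + 2)) :=
    (LinearMap.mulLeft k l).restrict fun w hw => mul_mem_pow_succ hl hw
  obtain ⟨ρ, hρ⟩ := LinearMap.exists_rightInverse_of_surjective μ (LinearMap.range_eq_top.2 (by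
    rintro ⟨x, hx⟩
    obtain ⟨w, hw, rfl⟩ := hsurj x hx
    exact ⟨⟨w, hw⟩, rfl⟩))
  have hρ' : ∀ x, l * (ρ x : MvPolynomial (Fin n) k ⧸ I) = x := fun x =>
    congrArg Subtype.val (LinearMap.congr_fun hρ x)
  let B : linForms I →ₗ[k] Module.End k ↥(linForms I ^ (e + 2)) :=
    LinearMap.mk₂ k (fun v x => ⟨v * ρ x, mul_mem_pow_succ v.2 (ρ x).2⟩)
      (fun u v x => Subtype.ext (by simp [add_mul]))
      (fun a v x => Subtype.ext (smul_mul_assoc a (v : MvPolynomial (Fin n) k ⧸ I) (ρ x)))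
      (fun v x y => Subtype.ext (by simp [mul_add]))
      (fun a v x => Subtype.ext (by
        rw [map_smul]
        exact mul_smul_comm a (v : MvPolynomial (Fin n) k ⧸ I) (ρ x)))
  have hBval : ∀ (v : linForms I) (x : ↥(linForms I ^ (e + 2))),
      (B v x : MvPolynomial (Fin n) k ⧸ I) = v * ρ x := fun v x => rfl
  have hBl : ∀ (v : linForms I) (x : ↥(linForms I ^ (e + 2))) (w : MvPolynomial (Fin n) k ⧸ I),
      w ∈ linForms I ^ (e + 1) → (x : MvPolynomial (Fin n) k ⧸ I) = l * w →
      (B v x : MvPolynomial (Fin n) k ⧸ I) = v * w := by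
    intro v x w hw hx
    have := hker (ρ x - w) (Submodule.sub_mem _ (ρ x).2 hw)
      (by rw [mul_sub, hρ', hx, sub_self]) v v.2
    rw [mul_sub, sub_eq_zero] at this
    exact this
  have hB : ∀ u v, B u * B v = B v * B u := by
    intro u v
    ext x
    rw [Module.End.mul_apply, Module.End.mul_apply, hBval, hBval]
    exact hcomm v v.2 u u.2 (ρ x) (ρ x).2 _ (ρ _).2 _ (ρ _).2
      (by rw [hρ', hBval]) (by rw [hρ', hBval])
  let m₀ : ↥(linForms I ^ (e + 2)) := ⟨l ^ (e + 2), hlpow _⟩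
  let τ : ↥(linForms I ^ 2) →ₗ[k] ↥(linForms I ^ (e + 2)) :=
    (LinearMap.mulLeft k (l ^ e)).restrict fun w hw => mul_mem_pow_add (hlpow e) hw
  obtain ⟨Φ, hΦ1, hΦ⟩ := exists_lift hs hI B hB m₀ τ (by
    intro u v h
    apply Subtype.ext
    rw [hBl u (B v m₀) (v * l ^ e) (mul_mem_pow_succ v.2 (hlpow e))]
    · change l ^ e * (u * v) = _
      ring
    · rw [hBl v m₀ (l ^ (e + 1)) (hlpow _) (by change l ^ (e + 2) = _; ring)]
      ring)
  have hpow : ∀ m y, y ∈ linForms I ^ m → ∀ i, i + m = e + 2 →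
      (Φ y : MvPolynomial (Fin n) k ⧸ I) = y * l ^ i := by
    intro m y hy
    induction hy using Submodule.pow_induction_on_left' with
    | algebraMap r =>
      intro i hi
      obtain rfl : i = e + 2 := hi
      rw [Algebra.algebraMap_eq_smul_one, map_smul, hΦ1, smul_one_mul]
      rfl
    | add x y i hx hy h1 h2 =>
      intro j hj
      rw [map_add, Submodule.coe_add, h1 j hj, h2 j hj, add_mul]
    | mem_mul u hu i x hx h =>
      intro j hj
      rw [hΦ ⟨u, hu⟩ x, hBl ⟨u, hu⟩ (Φ x) (x * l ^ j)]
      · ring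
      · have : x * l ^ j ∈ linForms I ^ (i + j) := mul_mem_pow_add hx (hlpow j)
        rwa [show i + j = e + 1 by omega] at this
      · rw [h (j + 1) (by omega)]
        ring
  have hinv : ∀ j y, Φ (l ^ j * y) = Φ y := by
    intro j
    induction j with
    | zero => simp
    | succ j ih =>
      intro y
      rw [pow_succ', mul_assoc, hΦ ⟨l, hl⟩]
      apply Subtype.ext
      rw [hBval, hρ', ih]
  let ν : ↥(linForms I ^ (e + 2)) →ₗ[k] ↥(linForms I ^ (e + 2 + j)) :=
    (LinearMap.mulLeft k (l ^ j)).restrict fun w hw => by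
      rw [add_comm]; exact mul_mem_pow_add (hlpow j) hw
  refine LinearMap.finrank_le_finrank_of_injective (f := ν) fun x y hxy => ?_
  have h1 : l ^ j * (x : MvPolynomial (Fin n) k ⧸ I) = l ^ j * y := congrArg Subtype.val hxy
  have h2 : Φ x = Φ y := by rw [← hinv j, h1, hinv]
  apply Subtype.ext
  have h3 := hpow _ _ x.2 0 (by omega)
  have h4 := hpow _ _ y.2 0 (by omega)
  rw [pow_zero, mul_one] at h3 h4
  rw [← h3, ← h4, h2]

/-- In degrees at least two the commutation hypothesis of `finrank_le_of_commuting` is automatic. -/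
lemma finrank_le_of_annihilated {s : Set (MvPolynomial (Fin n) k)}
    (hs : ∀ q ∈ s, q.IsHomogeneous 2) (hI : I = Ideal.span s) {e : ℕ}
    {l : MvPolynomial (Fin n) k ⧸ I} (hl : l ∈ linForms I)
    (hsurj : ∀ e, ∀ x ∈ linForms I ^ (e + 2), ∃ w ∈ linForms I ^ (e + 1), l * w = x)
    (hker : ∀ w ∈ linForms I ^ (e + 2), l * w = 0 → ∀ v ∈ linForms I, v * w = 0) (j : ℕ) :
    Module.finrank k ↥(linForms I ^ (e + 3)) ≤ Module.finrank k ↥(linForms I ^ (e + 3 + j)) := by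
  refine finrank_le_of_commuting (e := e + 1) hs hI hl (hsurj _) hker ?_ j
  intro u hu v hv a ha b hb c hc hab hac
  obtain ⟨w, hw, rfl⟩ := hsurj e a ha
  have h1 := hker (b - u * w) (Submodule.sub_mem _ hb (mul_mem_pow_succ hu hw))
    (by linear_combination -hab) v hv
  have h2 := hker (c - v * w) (Submodule.sub_mem _ hc (mul_mem_pow_succ hv hw))
    (by linear_combination -hac) u hu
  linear_combination h1 - h2

end Persistence

section Binary

variable {k Q : Type*} [Field k] [CommRing Q] [Algebra k Q] {V : Submodule k Q}
  {c : Q →ₗ[k] Fin 3 → k} {e f : Q}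

lemma pow_le_span_pair_pow
    (hD : ∀ v ∈ V, ∃ a b : k, ∀ u ∈ V, v * u = (a • e + b • f) * u) (he : e ∈ V) (hf : f ∈ V)
    (m : ℕ) : V ^ (m + 2) ≤ Submodule.span k {e, f} ^ (m + 2) := by
  set P : Submodule k Q := Submodule.span k {e, f} with hP
  have hPV : P ≤ V := Submodule.span_le.2 (by rintro _ (rfl | rfl) <;> assumption)
  have hVV : V * V ≤ P * P := Submodule.mul_le.2 fun v hv u hu => by
    obtain ⟨a, b, h⟩ := hD v hv
    obtain ⟨a', b', h'⟩ := hD u hu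
    have hp : a • e + b • f ∈ P := Submodule.mem_span_pair.2 ⟨a, b, rfl⟩
    rw [h u hu, mul_comm _ u, h' _ (hPV hp)]
    exact Submodule.mul_mem_mul (Submodule.mem_span_pair.2 ⟨a', b', rfl⟩) hp
  induction m with
  | zero => rwa [zero_add, pow_two, pow_two]
  | succ m ih =>
    calc V ^ (m + 1 + 2) = V * V ^ (m + 2) := pow_succ' _ _
      _ ≤ V * P ^ (m + 2) := mul_le_mul_right ih V
      _ = V * P * P ^ (m + 1) := by rw [pow_succ' P (m + 1), mul_assoc]
      _ ≤ P * P * P ^ (m + 1) := mul_le_mul_left ((mul_le_mul_right hPV V).trans hVV) _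
      _ = P ^ (m + 1 + 2) := by ring

lemma span_pair_pow_le (e f : Q) (m : ℕ) : Submodule.span k {e, f} ^ m
    ≤ Submodule.span k (Set.range fun j : Fin (m + 1) => e ^ (m - j : ℕ) * f ^ (j : ℕ)) := by
  induction m with
  | zero => simp [Submodule.one_eq_span]
  | succ m ih =>
    rw [pow_succ']
    refine (mul_le_mul_right ih _).trans ?_
    rw [Submodule.span_mul_span, Submodule.span_le]
    rintro _ ⟨x, hx, _, ⟨j, rfl⟩, rfl⟩
    have hj := j.2
    rcases hx with rfl | rfl
    · refine Submodule.subset_span ⟨j.castSucc, ?_⟩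
      simp only [Fin.val_castSucc]
      rw [show m + 1 - (j : ℕ) = m - j + 1 by omega]
      ring
    · refine Submodule.subset_span ⟨j.succ, ?_⟩
      simp only [Fin.val_succ]
      rw [show m + 1 - ((j : ℕ) + 1) = m - j by omega]
      ring

open scoped Polynomial in
/-- The substitution `e ↦ 1`, `f ↦ X`. -/
lemma exists_dehomogenization
    (hD : ∀ v ∈ V, ∃ a b : k, ∀ u ∈ V, v * u = (a • e + b • f) * u) (he : e ∈ V) (hf : f ∈ V)
    (hef : vol c (e * e) (e * f) (f * f) ≠ 0) :
    ∃ ξ B : Q →ₗ[k] k[X], (∀ u ∈ V, ∀ v ∈ V, ξ (u * v) = B u * B v) ∧ B e = 1 ∧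
      B f = Polynomial.X := by
  set D := vol c (e * e) (e * f) (f * f) with hDdef
  have h0 : ∀ a b d : k, D⁻¹ * volLeft c (e * f) (f * f) (a • (e * e) + b • (e * f) + d • (f * f))
      = a := fun a b d => by
    have : volLeft c (e * f) (f * f) (a • (e * e) + b • (e * f) + d • (f * f)) = a * D := by
      simp only [volLeft_apply, hDdef, map_add, map_smul, smul_eq_mul, vol]
      ring
    rw [this]; field_simp
  have h1 : ∀ a b d : k, D⁻¹ * volLeft c (f * f) (e * e) (a • (e * e) + b • (e * f) + d • (f * f))
      = b := fun a b d => by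
    have : volLeft c (f * f) (e * e) (a • (e * e) + b • (e * f) + d • (f * f)) = b * D := by
      simp only [volLeft_apply, hDdef, map_add, map_smul, smul_eq_mul, vol]
      ring
    rw [this]; field_simp
  have h2 : ∀ a b d : k, D⁻¹ * volLeft c (e * e) (e * f) (a • (e * e) + b • (e * f) + d • (f * f))
      = d := fun a b d => by
    have : volLeft c (e * e) (e * f) (a • (e * e) + b • (e * f) + d • (f * f)) = d * D := by
      simp only [volLeft_apply, hDdef, map_add, map_smul, smul_eq_mul, vol]
      ring
    rw [this]; field_simp
  let ξ : Q →ₗ[k] k[X] := (D⁻¹ • volLeft c (e * f) (f * f)).smulRight 1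
    + (D⁻¹ • volLeft c (f * f) (e * e)).smulRight Polynomial.X
    + (D⁻¹ • volLeft c (e * e) (e * f)).smulRight (Polynomial.X ^ 2)
  let B : Q →ₗ[k] k[X] := ((D⁻¹ • volLeft c (e * f) (f * f)).smulRight 1
    + (D⁻¹ • volLeft c (f * f) (e * e)).smulRight Polynomial.X) ∘ₗ LinearMap.mulLeft k e
  have hξ : ∀ a b d : k, ξ (a • (e * e) + b • (e * f) + d • (f * f))
      = Polynomial.C a + Polynomial.C b * Polynomial.X + Polynomial.C d * Polynomial.X ^ 2 :=
      fun a b d => by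
    simp only [ξ, LinearMap.add_apply, LinearMap.smulRight_apply, LinearMap.smul_apply, smul_eq_mul,
      h0, h1, h2, Polynomial.smul_eq_C_mul, mul_one]
  have hB : ∀ v ∈ V, ∀ a b : k, (∀ u ∈ V, v * u = (a • e + b • f) * u) →
      B v = Polynomial.C a + Polynomial.C b * Polynomial.X := by
    intro v hv a b h
    have : e * v = a • (e * e) + b • (e * f) + (0 : k) • (f * f) := by
      rw [mul_comm, h e he]
      simp only [Algebra.smul_def, map_zero]
      ring
    simp only [B, LinearMap.comp_apply, LinearMap.mulLeft_apply, this, LinearMap.add_apply,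
      LinearMap.smulRight_apply, LinearMap.smul_apply, smul_eq_mul, h0, h1,
      Polynomial.smul_eq_C_mul, mul_one]
  refine ⟨ξ, B, fun u hu v hv => ?_, ?_, ?_⟩
  · obtain ⟨a, b, h⟩ := hD u hu
    obtain ⟨a', b', h'⟩ := hD v hv
    have : u * v = (a * a') • (e * e) + (a * b' + b * a') • (e * f) + (b * b') • (f * f) := by
      have h3 := h' e he
      have h4 := h' f hf
      rw [h v hv]
      simp only [Algebra.smul_def, map_mul, map_add] at h3 h4 ⊢
      linear_combination algebraMap k Q a * h3 + algebraMap k Q b * h4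
    rw [this, hξ, hB u hu a b h, hB v hv a' b' h']
    simp only [map_mul, map_add]
    ring
  · rw [hB e he 1 0 (by simp)]; simp
  · rw [hB f hf 0 1 (by simp)]; simp

end Binary

section BinaryGrowth

variable {k : Type*} [Field k] {n : ℕ} {I : Ideal (MvPolynomial (Fin n) k)}

open scoped Polynomial in
lemma finrank_eq_of_binary {s : Set (MvPolynomial (Fin n) k)}
    (hs : ∀ q ∈ s, q.IsHomogeneous 2) (hI : I = Ideal.span s)
    {c : (MvPolynomial (Fin n) k ⧸ I) →ₗ[k] Fin 3 → k} {e f : MvPolynomial (Fin n) k ⧸ I}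
    (hD : ∀ v ∈ linForms I, ∃ a b : k, ∀ u ∈ linForms I, v * u = (a • e + b • f) * u)
    (he : e ∈ linForms I) (hf : f ∈ linForms I)
    (hef : vol c (e * e) (e * f) (f * f) ≠ 0) (m : ℕ) :
    Module.finrank k ↥(linForms I ^ (m + 2)) = m + 3 := by
  obtain ⟨ξ, B, hξ, hBe, hBf⟩ := exists_dehomogenization hD he hf hef
  obtain ⟨Φ, hΦ1, hΦ⟩ := exists_lift hs hI
    (LinearMap.mul k k[X] ∘ₗ B ∘ₗ (linForms I).subtype)
    (fun u v => LinearMap.ext fun x => mul_left_comm (B u) (B v) x) 1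
    (ξ ∘ₗ (linForms I ^ 2).subtype) (fun u v h => by
      simpa using hξ u u.2 v v.2)
  have hΦe : ∀ i y, Φ (e ^ i * y) = Φ y := by
    intro i
    induction i with
    | zero => simp
    | succ i ih =>
      intro y
      rw [pow_succ', mul_assoc, hΦ ⟨e, he⟩, ih]
      simp [hBe]
  have hΦf : ∀ j, Φ (f ^ j) = Polynomial.X ^ j := by
    intro j
    induction j with
    | zero => simpa using hΦ1
    | succ j ih =>
      rw [pow_succ', hΦ ⟨f, hf⟩, ih]
      simp [hBf, pow_succ']
  let b : Fin (m + 2 + 1) → MvPolynomial (Fin n) k ⧸ I :=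
    fun j => e ^ (m + 2 - j : ℕ) * f ^ (j : ℕ)
  have hb : LinearIndependent k b := by
    refine LinearIndependent.of_comp Φ ?_
    have : Φ ∘ b = Polynomial.basisMonomials k ∘ fun j : Fin (m + 2 + 1) => (j : ℕ) := by
      ext1 j
      simp [b, hΦe, hΦf, Polynomial.X_pow_eq_monomial]
    rw [this]
    exact (Polynomial.basisMonomials k).linearIndependent.comp _ Fin.val_injective
  have hspan : linForms I ^ (m + 2) = Submodule.span k (Set.range b) := by
    refine le_antisymm ((pow_le_span_pair_pow hD he hf m).trans (span_pair_pow_le e f _)) ?_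
    rw [Submodule.span_le]
    rintro _ ⟨j, rfl⟩
    have := mul_mem_pow_add (Submodule.pow_mem_pow _ he (m + 2 - j : ℕ))
      (Submodule.pow_mem_pow _ hf (j : ℕ))
    rwa [show m + 2 - (j : ℕ) + j = m + 2 by omega] at this
  rw [hspan, finrank_span_eq_card hb, Fintype.card_fin]

end BinaryGrowth

section Division

variable {k Q : Type*} [Field k] [CommRing Q] [Algebra k Q] {V : Submodule k Q}
  {c : Q →ₗ[k] Fin 3 → k} {l f g : Q}

lemma exists_mul_eq_of_mem_pow (h : ∀ x ∈ V ^ 2, ∃ w ∈ V, l * w = x) (e : ℕ) :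
    ∀ x ∈ V ^ (e + 2), ∃ w ∈ V ^ (e + 1), l * w = x := by
  induction e with
  | zero => simpa using h
  | succ e ih =>
    intro x hx
    rw [show e + 1 + 2 = (e + 2) + 1 by ring, pow_succ'] at hx
    refine Submodule.mul_induction_on hx (fun u hu y hy => ?_) ?_
    · obtain ⟨w, hw, rfl⟩ := ih y hy
      exact ⟨u * w, mul_mem_pow_succ hu hw, by ring⟩
    · rintro _ _ ⟨w, hw, rfl⟩ ⟨w', hw', rfl⟩
      exact ⟨w + w', Submodule.add_mem _ hw hw', mul_add _ _ _⟩

/-- Modulo the kernel of `l`, every linear form is a combination of `l`, `f`, `g`. -/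
lemma exists_combination_mul (hc : ∀ w ∈ V ^ 2, c w = 0 → w = 0)
    (hl : l ∈ V) (hf : f ∈ V) (hg : g ∈ V) (hvol : vol c (l * l) (l * f) (l * g) ≠ 0)
    (hK : ∀ κ ∈ V, l * κ = 0 → ∀ v ∈ V, v * κ = 0) {u : Q} (hu : u ∈ V) :
    ∃ p q r : k, ∀ x ∈ V, u * x = (p • l + q • f + r • g) * x := by
  obtain ⟨p, q, r, h⟩ := exists_combination_of_vol_ne_zero hc (mul_mem_sq hl hl)
      (mul_mem_sq hl hf)
    (mul_mem_sq hl hg) hvol (mul_mem_sq hl hu)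
  refine ⟨p, q, r, fun x hx => ?_⟩
  have := hK (u - (p • l + q • f + r • g))
    (V.sub_mem hu (V.add_mem (V.add_mem (V.smul_mem _ hl) (V.smul_mem _ hf)) (V.smul_mem _ hg)))
    (by
      rw [mul_sub, h]
      simp only [mul_add, mul_smul_comm, sub_self]) x hx
  linear_combination this

lemma commuting_of_basis (hc : ∀ w ∈ V ^ 2, c w = 0 → w = 0)
    (hl : l ∈ V) (hf : f ∈ V) (hg : g ∈ V) (hvol : vol c (l * l) (l * f) (l * g) ≠ 0)
    (hK : ∀ κ ∈ V, l * κ = 0 → ∀ v ∈ V, v * κ = 0) {a b d : Q}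
    (ha : a ∈ V) (hb : b ∈ V) (hd : d ∈ V)
    (hff : f * f = l * a) (hfg : f * g = l * b) (hgg : g * g = l * d)
    (h1 : g * a = f * b) (h2 : g * b = f * d) :
    ∀ u ∈ V, ∀ v ∈ V, ∀ x ∈ V, ∀ y ∈ V, ∀ z ∈ V,
      u * x = l * y → v * x = l * z → v * y = u * z := by
  intro u hu v hv x hx y hy z hz hxy hxz
  obtain ⟨u0, u1, u2, eu⟩ := exists_combination_mul hc hl hf hg hvol hK hu
  obtain ⟨v0, v1, v2, ev⟩ := exists_combination_mul hc hl hf hg hvol hK hv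
  obtain ⟨x0, x1, x2, ex⟩ := exists_combination_mul hc hl hf hg hvol hK hx
  have mem : ∀ p q r : k, ∀ t ∈ V, ∀ t' ∈ V, ∀ t'' ∈ V, p • t + q • t' + r • t'' ∈ V :=
    fun p q r t ht t' ht' t'' ht'' =>
      V.add_mem (V.add_mem (V.smul_mem _ ht) (V.smul_mem _ ht')) (V.smul_mem _ ht'')
  set X := x0 • l + x1 • f + x2 • g with hX
  set T := x0 • f + x1 • a + x2 • b with hT
  set T' := x0 • g + x1 • b + x2 • d with hT'
  have hXm : X ∈ V := mem _ _ _ _ hl _ hf _ hg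
  have hTm : T ∈ V := mem _ _ _ _ hf _ ha _ hb
  have hTm' : T' ∈ V := mem _ _ _ _ hg _ hb _ hd
  simp only [Algebra.smul_def] at eu ev hX hT hT'
  have hlT : l * T = f * X := by
    rw [hX, hT]
    linear_combination -algebraMap k Q x1 * hff - algebraMap k Q x2 * hfg
  have hlT' : l * T' = g * X := by
    rw [hX, hT']
    linear_combination -algebraMap k Q x1 * hfg - algebraMap k Q x2 * hgg
  have hTT' : f * T' = g * T := by
    rw [hT, hT']
    linear_combination -algebraMap k Q x1 * h1 - algebraMap k Q x2 * h2
  have hY := hK (y - (u0 • X + u1 • T + u2 • T')) (V.sub_mem hy (mem _ _ _ _ hXm _ hTm _ hTm'))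
    (by
      simp only [Algebra.smul_def]
      linear_combination -hxy + ex u hu + eu X hXm
        - algebraMap k Q u1 * hlT - algebraMap k Q u2 * hlT') v hv
  have hZ := hK (z - (v0 • X + v1 • T + v2 • T')) (V.sub_mem hz (mem _ _ _ _ hXm _ hTm _ hTm'))
    (by
      simp only [Algebra.smul_def]
      linear_combination -hxz + ex v hv + ev X hXm
        - algebraMap k Q v1 * hlT - algebraMap k Q v2 * hlT') u hu
  have eV := ev _ (mem u0 u1 u2 _ hXm _ hTm _ hTm')
  have eU := eu _ (mem v0 v1 v2 _ hXm _ hTm _ hTm')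
  simp only [Algebra.smul_def] at hY hZ eU eV
  linear_combination hY - hZ + eV - eU
    + (algebraMap k Q v0 * algebraMap k Q u1 - algebraMap k Q u0 * algebraMap k Q v1) * hlT
    + (algebraMap k Q v0 * algebraMap k Q u2 - algebraMap k Q u0 * algebraMap k Q v2) * hlT'
    + hTT' * (algebraMap k Q v1 * algebraMap k Q u2 - algebraMap k Q v2 * algebraMap k Q u1)

/-- If the relation `(g / l) (f g) = (g / l) (g f)` between the operators holds, then either they
all commute or some nonzero quadratic form is annihilated by all linear forms. -/
lemma exists_annihilated_or_commuting_of_relation (hc : ∀ w ∈ V ^ 2, c w = 0 → w = 0)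
    (hl : l ∈ V) (hf : f ∈ V) (hg : g ∈ V) (hvol : vol c (l * l) (l * f) (l * g) ≠ 0)
    (hK : ∀ κ ∈ V, l * κ = 0 → ∀ v ∈ V, v * κ = 0)
    (hrel : ∀ b ∈ V, ∀ d ∈ V, f * g = l * b → g * g = l * d → g * b = f * d) :
    (∃ w ∈ V ^ 2, w ≠ 0 ∧ ∀ v ∈ V, v * w = 0) ∨
      ∀ u ∈ V, ∀ v ∈ V, ∀ x ∈ V, ∀ y ∈ V, ∀ z ∈ V,
        u * x = l * y → v * x = l * z → v * y = u * z := by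
  have div : ∀ u ∈ V, ∀ v ∈ V, ∃ p q r : k, p • l + q • f + r • g ∈ V ∧
      u * v = l * (p • l + q • f + r • g) := by
    intro u hu v hv
    obtain ⟨p, q, r, h⟩ := exists_combination_of_vol_ne_zero hc (mul_mem_sq hl hl)
      (mul_mem_sq hl hf)
      (mul_mem_sq hl hg) hvol (mul_mem_sq hu hv)
    refine ⟨p, q, r,
      V.add_mem (V.add_mem (V.smul_mem _ hl) (V.smul_mem _ hf)) (V.smul_mem _ hg), ?_⟩
    rw [h]
    simp only [mul_add, mul_smul_comm]
  obtain ⟨a0, a1, a2, ha, hff⟩ := div f hf f hf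
  obtain ⟨b0, b1, b2, hb, hfg⟩ := div f hf g hg
  obtain ⟨d0, d1, d2, hd, hgg⟩ := div g hg g hg
  have h2 := hrel _ hb _ hd hfg hgg
  have comm := commuting_of_basis hc hl hf hg hvol hK ha hb hd hff hfg hgg
  set φ := algebraMap k Q with hφ
  by_cases h1 : g * (a0 • l + a1 • f + a2 • g) = f * (b0 • l + b1 • f + b2 • g)
  · exact Or.inr (comm h1 h2)
  clear comm
  have hd1 : d1 = 0 := by
    by_contra hne
    refine h1 ?_
    have h3 := hK (d1 • (a0 • l + a1 • f + a2 • g)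
      - (b0 • g + (b1 - d2) • (b0 • l + b1 • f + b2 • g)
      + b2 • (d0 • l + d1 • f + d2 • g) - d0 • f))
      (V.sub_mem (V.smul_mem _ ha) (V.sub_mem (V.add_mem (V.add_mem (V.smul_mem _ hg)
        (V.smul_mem _ hb)) (V.smul_mem _ hd)) (V.smul_mem _ hf)))
      (by
        simp only [Algebra.smul_def, ← hφ, map_sub] at hff hfg hgg h2 ⊢
        linear_combination -φ d1 * hff + (φ b1 - φ d2) * hfg + φ b2 * hgg - h2) g hg
    have h4 : d1 • (g * (a0 • l + a1 • f + a2 • g)) = d1 • (f * (b0 • l + b1 • f + b2 • g)) := by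
      simp only [Algebra.smul_def, ← hφ, map_sub] at hff hfg hgg h2 h3 ⊢
      linear_combination h3 + φ b0 * hgg + φ b1 * h2 - φ d0 * hfg
    exact smul_right_injective Q hne h4
  subst hd1
  obtain ⟨e0, e1, e2⟩ := eq_zero_of_combination hvol
    (a := b1 * b0 + b2 * d0 - d2 * b0) (b := b1 * b1 - d0 - d2 * b1) (d := b0 + b1 * b2) (by
      simp only [Algebra.smul_def, ← hφ, map_sub, map_add, map_mul, map_zero] at hfg hgg h2 ⊢
      linear_combination h2 - (φ b1 - φ d2) * hfg - φ b2 * hgg)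
  obtain rfl : d0 = b1 * b1 - d2 * b1 := by linear_combination -e1
  obtain rfl : b0 = -(b1 * b2) := by linear_combination e2
  clear e0 e1 e2
  have hfp : f * (g - b1 • l) = b2 • (l * (g - b1 • l)) := by
    simp only [Algebra.smul_def, ← hφ, map_neg, map_mul] at hfg ⊢
    linear_combination hfg
  have hgp : g * (g - b1 • l) = (d2 - b1) • (l * (g - b1 • l)) := by
    simp only [Algebra.smul_def, ← hφ, map_sub, map_mul, map_zero] at hgg ⊢
    linear_combination hgg
  have hp : g - b1 • l ∈ V := V.sub_mem hg (V.smul_mem _ hl)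
  have hs : g * (a0 • l + a1 • f + a2 • g) - f * (-(b1 * b2) • l + b1 • f + b2 • g)
      = (a0 + a1 * b2 + a2 * d2 - b1 * a2 - b2 * b2) • (l * (g - b1 • l)) := by
    simp only [Algebra.smul_def, ← hφ, map_sub, map_add, map_mul, map_neg, map_zero]
      at hff hfg hgg ⊢
    linear_combination φ a1 * hfg + φ a2 * hgg - φ b1 * hff - φ b2 * hfg
  set s := a0 + a1 * b2 + a2 * d2 - b1 * a2 - b2 * b2 with hs'
  have hs0 : s ≠ 0 := fun h => h1 (sub_eq_zero.1 (by rw [hs, h, zero_smul]))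
  have hll : l * (l * (g - b1 • l)) = 0 := by
    have : s • (l * (l * (g - b1 • l))) = 0 := by
      rw [← mul_smul_comm, ← hs]
      linear_combination f * hfg - g * hff
    exact (smul_eq_zero.1 this).resolve_left hs0
  refine Or.inl ⟨l * (g - b1 • l), mul_mem_sq hl hp, fun h => h1 (sub_eq_zero.1 (by
    rw [hs, h, smul_zero])), fun v hv => ?_⟩
  obtain ⟨p, q, r, e⟩ := exists_combination_mul hc hl hf hg hvol hK hv
  have e' := e _ hp
  generalize g - b1 • l = P at *
  simp only [Algebra.smul_def, ← hφ] at hfp hgp e'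
  linear_combination l * e' + φ q * l * hfp + φ r * l * hgp
    + (φ p + φ q * φ b2 + φ r * φ (d2 - b1)) * hll

lemma exists_annihilated_or_commuting (hc : ∀ w ∈ V ^ 2, c w = 0 → w = 0) {a b d : Q}
    (hl : l ∈ V) (ha : a ∈ V) (hb : b ∈ V) (hd : d ∈ V)
    (hvol : vol c (l * a) (l * b) (l * d) ≠ 0) {w₀ : Q}
    (hw₀ : ∀ w ∈ V ^ 2, l * w = 0 → ∃ t : k, w = t • w₀) :
    (∃ w ∈ V ^ 2, w ≠ 0 ∧ ∀ v ∈ V, v * w = 0) ∨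
      (∀ κ ∈ V, l * κ = 0 → ∀ v ∈ V, v * κ = 0) ∧
      ∀ u ∈ V, ∀ v ∈ V, ∀ x ∈ V, ∀ y ∈ V, ∀ z ∈ V,
        u * x = l * y → v * x = l * z → v * y = u * z := by
  have comb : ∀ w ∈ V ^ 2, ∃ x y z : k, w = x • (l * a) + y • (l * b) + z • (l * d) := fun w hw =>
    exists_combination_of_vol_ne_zero hc (mul_mem_sq hl ha) (mul_mem_sq hl hb) (mul_mem_sq hl hd)
      hvol hw
  have div : ∀ u ∈ V, ∀ v ∈ V, ∃ w ∈ V, u * v = l * w := fun u hu v hv => by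
    obtain ⟨x, y, z, h⟩ := comb _ (mul_mem_sq hu hv)
    refine ⟨x • a + y • b + z • d,
      V.add_mem (V.add_mem (V.smul_mem _ ha) (V.smul_mem _ hb)) (V.smul_mem _ hd), ?_⟩
    rw [h]
    simp only [mul_add, mul_smul_comm]
  by_cases hK : ∀ κ ∈ V, l * κ = 0 → ∀ v ∈ V, v * κ = 0
  swap
  · push Not at hK
    obtain ⟨κ, hκ, hlκ, v, hv, hne⟩ := hK
    refine Or.inl ⟨v * κ, mul_mem_sq hv hκ, hne, fun u hu => ?_⟩
    obtain ⟨w, -, h⟩ := div u hu v hv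
    linear_combination κ * h + w * hlκ
  have main : ∀ f ∈ V, ∀ g ∈ V, vol c (l * l) (l * f) (l * g) ≠ 0 →
      (∀ b ∈ V, ∀ d ∈ V, f * g = l * b → g * g = l * d → g * b = f * d) → _ :=
    fun f hf g hg hv hrel =>
      (exists_annihilated_or_commuting_of_relation hc hl hf hg hv hK hrel).imp_right (And.intro hK)
  obtain ⟨f, hf, g, hg, hv⟩ : ∃ f ∈ V, ∃ g ∈ V, vol c (l * l) (l * f) (l * g) ≠ 0 := by
    obtain ⟨x, y, z, h⟩ := comb _ (mul_mem_sq hl hl)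
    by_contra! H
    have hx := H b hb d hd
    have hy := H a ha d hd
    have hz := H a ha b hb
    rw [h] at hx hy hz
    have hx' : x * vol c (l * a) (l * b) (l * d) = 0 := by
      rw [← hx]
      simp only [vol, map_add, map_smul, Pi.add_apply, Pi.smul_apply, smul_eq_mul]
      ring
    have hy' : y * vol c (l * a) (l * b) (l * d) = 0 := by
      rw [← neg_eq_zero, ← hy]
      simp only [vol, map_add, map_smul, Pi.add_apply, Pi.smul_apply, smul_eq_mul]
      ring
    have hz' : z * vol c (l * a) (l * b) (l * d) = 0 := by
      rw [← hz]
      simp only [vol, map_add, map_smul, Pi.add_apply, Pi.smul_apply, smul_eq_mul]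
      ring
    rw [(mul_eq_zero.1 hx').resolve_right hvol, (mul_eq_zero.1 hy').resolve_right hvol,
      (mul_eq_zero.1 hz').resolve_right hvol] at h
    have hla := hK l hl (by simpa using h) a ha
    exact hvol (by rw [mul_comm l a, hla]; simp [vol])
  obtain ⟨A, hA, hff⟩ := div f hf f hf
  obtain ⟨B, hB, hfg⟩ := div f hf g hg
  obtain ⟨D, hD, hgg⟩ := div g hg g hg
  obtain ⟨t, ht⟩ := hw₀ (g * A - f * B) (Submodule.sub_mem _ (mul_mem_sq hg hA) (mul_mem_sq hf hB))
    (by linear_combination f * hfg - g * hff)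
  obtain ⟨t', ht'⟩ := hw₀ (g * B - f * D)
    (Submodule.sub_mem _ (mul_mem_sq hg hB) (mul_mem_sq hf hD))
    (by linear_combination f * hgg - g * hfg)
  by_cases h0 : t = 0
  · refine main g hg f hf ?_ fun b hb d hd hgf hff' => ?_
    · intro h
      apply hv
      rw [← neg_eq_zero, ← h]
      simp only [vol]
      ring
    · have h1 := hK (b - B) (V.sub_mem hb hB) (by linear_combination hfg - hgf) f hf
      have h2 := hK (d - A) (V.sub_mem hd hA) (by linear_combination hff - hff') g hg
      rw [h0, zero_smul] at ht
      linear_combination h1 - h2 - ht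
  · have hg' : t' • f - t • g ∈ V := V.sub_mem (V.smul_mem _ hf) (V.smul_mem _ hg)
    refine main f hf (t' • f - t • g) hg' ?_ fun b hb d hd hfg' hgg' => ?_
    · have : vol c (l * l) (l * f) (l * (t' • f - t • g)) = -t * vol c (l * l) (l * f) (l * g) := by
        simp only [vol, mul_sub, mul_smul_comm, map_sub, map_smul, Pi.sub_apply, Pi.smul_apply,
          smul_eq_mul]
        ring
      rw [this]
      exact mul_ne_zero (neg_ne_zero.2 h0) hv
    · have h1 := hK (b - (t' • A - t • B))
        (V.sub_mem hb (V.sub_mem (V.smul_mem _ hA) (V.smul_mem _ hB))) (by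
          simp only [Algebra.smul_def] at hfg' ⊢
          linear_combination -hfg' + algebraMap k Q t' * hff - algebraMap k Q t * hfg) _ hg'
      have h2 := hK (d - ((t' * t') • A - (2 * t * t') • B + (t * t) • D))
        (V.sub_mem hd (V.add_mem (V.sub_mem (V.smul_mem _ hA) (V.smul_mem _ hB))
          (V.smul_mem _ hD))) (by
          simp only [Algebra.smul_def, map_mul, map_ofNat] at hgg' ⊢
          linear_combination -hgg' + algebraMap k Q t' ^ 2 * hff
            - 2 * algebraMap k Q t * algebraMap k Q t' * hfg + algebraMap k Q t ^ 2 * hgg) f hf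
      simp only [Algebra.smul_def, map_mul, map_ofNat] at h1 h2 ht ht' ⊢
      linear_combination h1 - h2 - algebraMap k Q t * algebraMap k Q t' * ht
        + algebraMap k Q t ^ 2 * ht'

end Division

section Growth

lemma exists_generator_ker {k M N : Type*} [Field k] [AddCommGroup M] [Module k M]
    [AddCommGroup N] [Module k N] [Module.Finite k M] {f : M →ₗ[k] N}
    (hf : Function.Surjective f) (h : Module.finrank k M = Module.finrank k N + 1) :
    ∃ x₀, ∀ x, f x = 0 → ∃ t : k, x = t • x₀ := by
  have hker : Module.finrank k (LinearMap.ker f) = 1 := by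
    have := LinearMap.finrank_range_add_finrank_ker f
    rw [LinearMap.range_eq_top.2 hf, finrank_top] at this
    omega
  obtain ⟨x₀, -, hgen⟩ := finrank_eq_one_iff'.1 hker
  refine ⟨x₀, fun x hx => ?_⟩
  obtain ⟨t, ht⟩ := hgen ⟨x, hx⟩
  exact ⟨t, congrArg Subtype.val ht.symm⟩

variable {k : Type*} [Field k] {n : ℕ} {I : Ideal (MvPolynomial (Fin n) k)}

/-- Multiplication by a linear form, between the graded pieces of `S/I`. -/
noncomputable def mulLinForm {l : MvPolynomial (Fin n) k ⧸ I} (hl : l ∈ linForms I) (m : ℕ) :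
    ↥(linForms I ^ m) →ₗ[k] ↥(linForms I ^ (m + 1)) :=
  (LinearMap.mulLeft k l).restrict fun _ hw => mul_mem_pow_succ hl hw

lemma mulLinForm_eq_zero {l : MvPolynomial (Fin n) k ⧸ I} (hl : l ∈ linForms I) {m : ℕ}
    {w : MvPolynomial (Fin n) k ⧸ I} (hw : w ∈ linForms I ^ m) :
    mulLinForm hl m ⟨w, hw⟩ = 0 ↔ l * w = 0 :=
  Subtype.ext_iff

/-- The Hilbert functions that occur when some linear form maps degree one onto degree two. -/
lemma finrank_cases_of_vol_ne_zero {s : Set (MvPolynomial (Fin n) k)}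
    (hs : ∀ q ∈ s, q.IsHomogeneous 2) (hI : I = Ideal.span s)
    (h2 : Module.finrank k ↥(linForms I ^ 2) = 3)
    {c : (MvPolynomial (Fin n) k ⧸ I) →ₗ[k] Fin 3 → k}
    (hc : ∀ w ∈ linForms I ^ 2, c w = 0 → w = 0) {l a b d : MvPolynomial (Fin n) k ⧸ I}
    (hl : l ∈ linForms I) (ha : a ∈ linForms I) (hb : b ∈ linForms I) (hd : d ∈ linForms I)
    (hvol : vol c (l * a) (l * b) (l * d) ≠ 0) :
    (∀ m, 3 ≤ m → Module.finrank k ↥(linForms I ^ m) = 0) ∨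
    (Module.finrank k ↥(linForms I ^ 3) = 1 ∧
      ∀ m, 4 ≤ m → Module.finrank k ↥(linForms I ^ m) = 0) ∨
    (∀ m, 3 ≤ m → Module.finrank k ↥(linForms I ^ m) = 1) ∨
    (∀ m, 3 ≤ m → Module.finrank k ↥(linForms I ^ m) = 2) ∨
    (∀ m, 3 ≤ m → Module.finrank k ↥(linForms I ^ m) = 3) := by
  have mem2 : ∀ v ∈ linForms I, l * v ∈ linForms I ^ 2 := fun v hv =>
    mul_mem_pow_succ (m := 1) hl (by rwa [Submodule.pow_one])
  have hsurj := exists_mul_eq_of_mem_pow (V := linForms I) (l := l) fun x hx => by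
    obtain ⟨p, q, r, h⟩ := exists_combination_of_vol_ne_zero hc (mem2 a ha) (mem2 b hb)
      (mem2 d hd) hvol hx
    refine ⟨p • a + q • b + r • d, Submodule.add_mem _ (Submodule.add_mem _
      (Submodule.smul_mem _ _ ha) (Submodule.smul_mem _ _ hb)) (Submodule.smul_mem _ _ hd), ?_⟩
    rw [h]
    simp only [mul_add, mul_smul_comm]
  have hμ : ∀ e, Function.Surjective (mulLinForm hl (e + 1)) := fun e => by
    rintro ⟨x, hx⟩
    obtain ⟨w, hw, rfl⟩ := hsurj e x hx
    exact ⟨⟨w, hw⟩, rfl⟩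
  have hanti : ∀ e j, Module.finrank k ↥(linForms I ^ (e + 1 + j))
      ≤ Module.finrank k ↥(linForms I ^ (e + 1)) := by
    intro e j
    induction j with
    | zero => exact le_rfl
    | succ j ih =>
      refine le_trans ?_ ih
      have := LinearMap.finrank_le_finrank_of_surjective (hμ (e + j))
      rwa [show e + j + 1 = e + 1 + j by ring] at this
  have hinj : ∀ e, Module.finrank k ↥(linForms I ^ (e + 1))
      = Module.finrank k ↥(linForms I ^ (e + 2)) →
      ∀ w ∈ linForms I ^ (e + 1), l * w = 0 → ∀ v ∈ linForms I, v * w = 0 := by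
    intro e he w hw h v _
    have := (LinearMap.injective_iff_surjective_of_finrank_eq_finrank he).2 (hμ e)
    have h0 := (map_eq_zero_iff _ this).1 ((mulLinForm_eq_zero hl hw).2 h)
    rw [show w = 0 from congrArg Subtype.val h0, mul_zero]
  have hstable : ∀ e, (∀ w ∈ linForms I ^ (e + 2), l * w = 0 → ∀ v ∈ linForms I, v * w = 0) →
      ∀ m, e + 3 ≤ m →
        Module.finrank k ↥(linForms I ^ m) = Module.finrank k ↥(linForms I ^ (e + 3)) := by
    intro e he m hm
    obtain ⟨j, rfl⟩ := Nat.exists_eq_add_of_le hm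
    exact le_antisymm (hanti (e + 2) j) (finrank_le_of_annihilated hs hI hl hsurj he j)
  have hzero : ∀ e, Module.finrank k ↥(linForms I ^ (e + 1)) = 0 → ∀ m, e + 1 ≤ m →
      Module.finrank k ↥(linForms I ^ m) = 0 := by
    intro e he m hm
    obtain ⟨j, rfl⟩ := Nat.exists_eq_add_of_le hm
    exact Nat.le_zero.1 (he ▸ hanti e j)
  have h3 := hanti 1 1
  have h4 := hanti 2 1
  rw [h2] at h3
  obtain h | h | h | h : Module.finrank k ↥(linForms I ^ 3) = 0 ∨
      Module.finrank k ↥(linForms I ^ 3) = 1 ∨ Module.finrank k ↥(linForms I ^ 3) = 2 ∨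
      Module.finrank k ↥(linForms I ^ 3) = 3 := by
    change Module.finrank k ↥(linForms I ^ 3) ≤ 3 at h3
    omega
  · exact Or.inl (hzero 2 h)
  · change Module.finrank k ↥(linForms I ^ 4) ≤ Module.finrank k ↥(linForms I ^ 3) at h4
    by_cases h4' : Module.finrank k ↥(linForms I ^ 4) = 0
    · exact Or.inr (Or.inl ⟨h, hzero 3 h4'⟩)
    · have h4 : Module.finrank k ↥(linForms I ^ 4) = 1 := by omega
      refine Or.inr (Or.inr (Or.inl fun m hm => ?_))
      rcases hm.eq_or_lt with rfl | hm
      · exact h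
      · rw [hstable 1 (hinj 2 (h.trans h4.symm)) m hm]
        exact h4
  · refine Or.inr (Or.inr (Or.inr (Or.inl fun m hm => ?_)))
    refine (hstable 0 ?_ m hm).trans h
    obtain ⟨⟨w₀, hw₀⟩, hgen⟩ := exists_generator_ker (hμ 1) (h2.trans (congrArg (· + 1) h.symm))
    have hw₀' : ∀ w ∈ linForms I ^ 2, l * w = 0 → ∃ t : k, w = t • w₀ := fun w hw h0 => by
      obtain ⟨t, ht⟩ := hgen ⟨w, hw⟩ ((mulLinForm_eq_zero hl hw).2 h0)
      exact ⟨t, congrArg Subtype.val ht⟩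
    rcases exists_annihilated_or_commuting hc hl ha hb hd hvol hw₀' with
      ⟨w, hw, hne, hann⟩ | ⟨hK, hcomm⟩
    · intro x hx hx0 v hv
      obtain ⟨t, rfl⟩ := hw₀' w hw (hann l hl)
      obtain ⟨t', rfl⟩ := hw₀' x hx hx0
      have ht : t ≠ 0 := fun h => hne (by rw [h, zero_smul])
      have := hann v hv
      rw [mul_smul_comm] at this
      rw [mul_smul_comm, (smul_eq_zero.1 this).resolve_left ht, smul_zero]
    · have := finrank_le_of_commuting (e := 0) hs hI hl (hsurj 0)
        (by simpa only [zero_add, Submodule.pow_one] using hK)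
        (by simpa only [zero_add, Submodule.pow_one] using hcomm) 1
      change Module.finrank k ↥(linForms I ^ 2) ≤ Module.finrank k ↥(linForms I ^ 3) at this
      omega
  · exact Or.inr (Or.inr (Or.inr (Or.inr fun m hm =>
      (hstable 0 (hinj 1 (h2.trans h.symm)) m hm).trans h)))

end Growth

section LowDegree

variable {k : Type*} [Field k] {n : ℕ} {I : Ideal (MvPolynomial (Fin n) k)}

lemma hilbFn_eq_of_lt_two {s : Set (MvPolynomial (Fin n) k)}
    (hs : ∀ q ∈ s, q.IsHomogeneous 2) (hI : I = Ideal.span s) {m : ℕ} (hm : m < 2) :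
    hilbFn k n I m = Module.finrank k (homogeneousSubmodule (Fin n) k m) := by
  have hle : I ≤ idealOfVars (Fin n) k ^ 2 := by
    rw [hI, Ideal.span_le]
    intro q hq
    rw [SetLike.mem_coe, mem_pow_idealOfVars_iff']
    intro d hd
    exact (hs q hq).coeff_eq_zero hd.ne
  rw [hilbFn, ← LinearMap.range_domRestrict]
  refine LinearMap.finrank_range_of_inj ((injective_iff_map_eq_zero _).2 ?_)
  rintro ⟨p, hp⟩ h0
  have hpI : p ∈ I := Ideal.Quotient.eq_zero_iff_mem.1 h0
  ext d
  by_cases hd : d.degree = m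
  · exact (mem_pow_idealOfVars_iff' 2 p).1 (hle hpI) d (hd ▸ hm)
  · exact IsHomogeneous.coeff_eq_zero hp hd

lemma hilbFn_zero {s : Set (MvPolynomial (Fin n) k)}
    (hs : ∀ q ∈ s, q.IsHomogeneous 2) (hI : I = Ideal.span s) : hilbFn k n I 0 = 1 := by
  rw [hilbFn_eq_of_lt_two hs hI two_pos, ← homogeneousSubmodule_one_pow, pow_zero,
    Submodule.one_eq_span, finrank_span_singleton one_ne_zero]

lemma hilbFn_one {s : Set (MvPolynomial (Fin n) k)}
    (hs : ∀ q ∈ s, q.IsHomogeneous 2) (hI : I = Ideal.span s) : hilbFn k n I 1 = n := by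
  rw [hilbFn_eq_of_lt_two hs hI one_lt_two, homogeneousSubmodule_one_eq_span_X,
    finrank_span_eq_card (linearIndependent_X (Fin n) k), Fintype.card_fin]

end LowDegree

theorem stmt0 (k : Type*) [Field k] [IsAlgClosed k] (hchar : ringChar k ≠ 2)
    (n : ℕ) (I : Ideal (MvPolynomial (Fin n) k))
    (hquad : ∃ Q : Set (MvPolynomial (Fin n) k),
      (∀ q ∈ Q, q.IsHomogeneous 2) ∧ I = Ideal.span Q)
    (h2 : hilbFn k n I 2 = 3) :
    hilbFn k n I 0 = 1 ∧ hilbFn k n I 1 = n ∧ hilbFn k n I 2 = 3 ∧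
    (∃! j : Fin 6,
      ![(∀ m, 3 ≤ m → hilbFn k n I m = 0),
        (hilbFn k n I 3 = 1 ∧ ∀ m, 4 ≤ m → hilbFn k n I m = 0),
        (∀ m, 3 ≤ m → hilbFn k n I m = 1),
        (∀ m, 3 ≤ m → hilbFn k n I m = 2),
        (∀ m, 3 ≤ m → hilbFn k n I m = 3),
        (∀ m, 3 ≤ m → hilbFn k n I m = m + 1)] j) := by
  obtain ⟨s, hs, hI⟩ := hquad
  refine ⟨hilbFn_zero hs hI, hilbFn_one hs hI, h2, existsUnique_of_exists_of_unique ?_ ?_⟩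
  · simp only [hilbFn_eq] at h2 ⊢
    have : Infinite k := IsAlgClosed.instInfinite
    obtain ⟨c, hc, hsurj⟩ := exists_coordinates h2
    by_cases H : ∀ l ∈ linForms I, ∀ x ∈ linForms I, ∀ y ∈ linForms I, ∀ z ∈ linForms I,
        vol c (l * x) (l * y) (l * z) = 0
    · obtain ⟨e, he, f, hf, hef⟩ :=
        exists_vol_binary_ne_zero (Ring.two_ne_zero hchar) hc hsurj H
      refine ⟨5, fun m hm => ?_⟩
      obtain ⟨j, rfl⟩ := Nat.exists_eq_add_of_le' hm
      exact finrank_eq_of_binary hs hI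
        (fun v hv => exists_binary_decomposition hc H he hf hef hv) he hf hef (j + 1)
    · push Not at H
      obtain ⟨l, hl, a, ha, b, hb, d, hd, hvol⟩ := H
      rcases finrank_cases_of_vol_ne_zero hs hI h2 hc hl ha hb hd hvol with h | h | h | h | h
      exacts [⟨0, h⟩, ⟨1, h⟩, ⟨2, h⟩, ⟨3, h⟩, ⟨4, h⟩]
  · intro i j hi hj
    generalize hilbFn k n I = F at hi hj
    have key : ∀ i : Fin 6, ![(∀ m, 3 ≤ m → F m = 0), (F 3 = 1 ∧ ∀ m, 4 ≤ m → F m = 0),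
        (∀ m, 3 ≤ m → F m = 1), (∀ m, 3 ≤ m → F m = 2), (∀ m, 3 ≤ m → F m = 3),
        (∀ m, 3 ≤ m → F m = m + 1)] i →
        (F 3, F 4) = ![(0, 0), (1, 0), (1, 1), (2, 2), (3, 3), (4, 5)] i := by
      intro i hi
      fin_cases i
      · exact Prod.ext (hi 3 le_rfl) (hi 4 (by norm_num))
      · exact Prod.ext hi.1 (hi.2 4 le_rfl)
      all_goals exact Prod.ext (hi 3 le_rfl) (hi 4 (by norm_num))
    have := (key i hi).symm.trans (key j hj)
    revert this
    clear hi hj key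
    revert i j
    decide
end

section
/- Let k be a field of characteristic different from 2 and from 3, and let S = k[x,y,z]. The k-algebra automorphism φ of S determined by φ(x) = x − y/9 − z/3, φ(y) = y, φ(z) = −y/3 + z maps the ideal (y², xy + yz + z², xz) onto the ideal (y², xy + z², xz). Consequently φ induces an isomorphism of graded k-algebras k[x,y,z]/(y², xy + yz + z², xz) ≅ k[x,y,z]/(y², xy + z², xz). -/
open MvPolynomial

/-- The degree-one component of `S/I`, i.e. the image in `S/I` of the space of
linear forms of `S = k[x,y,z]`. -/
noncomputable def degOnePart (k : Type*) [Field k]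
    (I : Ideal (MvPolynomial (Fin 3) k)) :
    Submodule k (MvPolynomial (Fin 3) k ⧸ I) :=
  (MvPolynomial.homogeneousSubmodule (Fin 3) k 1).map
    (Ideal.Quotient.mkₐ k I).toLinearMap

/-- The endomorphism `x ↦ x - a²y - az`, `y ↦ y`, `z ↦ -ay + z` of `k[x,y,z]`, with inverse
`x ↦ x + (a² + a²)y + az`, `y ↦ y`, `z ↦ ay + z`, as an automorphism. -/
noncomputable def shearEquiv {k : Type*} [Field k] (a : k) :
    MvPolynomial (Fin 3) k ≃ₐ[k] MvPolynomial (Fin 3) k :=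
  AlgEquiv.ofAlgHom
    (aeval ![X 0 - C (a ^ 2) * X 1 - C a * X 2, X 1, -(C a * X 1) + X 2])
    (aeval ![X 0 + C (a ^ 2 + a ^ 2) * X 1 + C a * X 2, X 1, C a * X 1 + X 2])
    (by
      ext i : 1
      fin_cases i <;> simp [algebraMap_eq] <;> ring)
    (by
      ext i : 1
      fin_cases i <;> simp [algebraMap_eq] <;> ring)

theorem shearEquiv_X_zero {k : Type*} [Field k] (a : k) :
    shearEquiv a (X 0) = X 0 - C a ^ 2 * X 1 - C a * X 2 := by
  simp [shearEquiv]

theorem shearEquiv_X_one {k : Type*} [Field k] (a : k) :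
    shearEquiv a (X 1) = X 1 := by
  simp [shearEquiv]

theorem shearEquiv_X_two {k : Type*} [Field k] (a : k) :
    shearEquiv a (X 2) = -(C a * X 1) + X 2 := by
  simp [shearEquiv]

theorem map_shearEquiv_span {k : Type*} [Field k] {a : k} (ha : 3 * a = 1) :
    Ideal.map (shearEquiv a)
        (Ideal.span {X 1 ^ 2, X 0 * X 1 + X 1 * X 2 + X 2 ^ 2, X 0 * X 2}) =
      Ideal.span {X 1 ^ 2, X 0 * X 1 + X 2 ^ 2, X 0 * X 2} := by
  have hC : (3 : MvPolynomial (Fin 3) k) * C a = 1 := by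
    rw [← C_1, ← ha, C_mul, map_ofNat]
  have hq : shearEquiv a (X 0 * X 1 + X 1 * X 2 + X 2 ^ 2) =
      X 0 * X 1 + X 2 ^ 2 - C a * X 1 ^ 2 := by
    simp only [map_add, map_mul, map_pow, shearEquiv_X_zero, shearEquiv_X_one, shearEquiv_X_two]
    linear_combination (-(X 1 * X 2)) * hC
  have hr : shearEquiv a (X 0 * X 2) =
      X 0 * X 2 - C a * (X 0 * X 1 + X 2 ^ 2) + C a ^ 3 * X 1 ^ 2 := by
    simp only [map_mul, shearEquiv_X_zero, shearEquiv_X_two]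
    ring
  rw [Ideal.map_span, Set.image_insert_eq, Set.image_insert_eq, Set.image_singleton, hq, hr,
    map_pow, shearEquiv_X_one]
  apply le_antisymm <;> rw [Ideal.span_le] <;> rintro p (rfl | rfl | rfl) <;>
    simp only [SetLike.mem_coe, Ideal.mem_span_insert, Ideal.mem_span_singleton']
  · exact ⟨1, 0, ⟨0, 0, ⟨0, by ring⟩, by ring⟩, by ring⟩
  · exact ⟨-C a, _, ⟨1, 0, ⟨0, by ring⟩, rfl⟩, by ring⟩
  · exact ⟨C a ^ 3, _, ⟨-C a, _, ⟨1, rfl⟩, rfl⟩, by ring⟩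
  · exact ⟨1, 0, ⟨0, 0, ⟨0, by ring⟩, by ring⟩, by ring⟩
  · exact ⟨C a, _, ⟨1, 0, ⟨0, by ring⟩, rfl⟩, by ring⟩
  · exact ⟨C a ^ 2 - C a ^ 3, _, ⟨C a, _, ⟨1, rfl⟩, rfl⟩, by ring⟩

theorem map_shearEquiv_homogeneousSubmodule_one {k : Type*} [Field k] (a : k) :
    (homogeneousSubmodule (Fin 3) k 1).map (shearEquiv a).toLinearMap =
      homogeneousSubmodule (Fin 3) k 1 := by
  have hX (i : Fin 3) : (X i : MvPolynomial (Fin 3) k).IsHomogeneous 1 := isHomogeneous_X k i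
  have hCX (c : k) (i : Fin 3) : (C c * X i).IsHomogeneous 1 := (hX i).C_mul c
  apply le_antisymm
  · rintro _ ⟨p, hp, rfl⟩
    change IsHomogeneous (aeval ![X 0 - C (a ^ 2) * X 1 - C a * X 2, X 1, -(C a * X 1) + X 2] p)
      (1 * 1)
    refine IsHomogeneous.aeval hp _ (Fin.forall_fin_succ.mpr ⟨?_, Fin.forall_fin_two.mpr ⟨?_, ?_⟩⟩)
    · exact ((hX 0).sub (hCX (a ^ 2) 1)).sub (hCX a 2)
    · exact hX 1
    · exact (hCX a 1).neg.add (hX 2)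
  · intro p hp
    refine ⟨(shearEquiv a).symm p, ?_, (shearEquiv a).apply_symm_apply p⟩
    change IsHomogeneous (aeval ![X 0 + C (a ^ 2 + a ^ 2) * X 1 + C a * X 2, X 1, C a * X 1 + X 2] p)
      (1 * 1)
    refine IsHomogeneous.aeval hp _ (Fin.forall_fin_succ.mpr ⟨?_, Fin.forall_fin_two.mpr ⟨?_, ?_⟩⟩)
    · exact ((hX 0).add (hCX (a ^ 2 + a ^ 2) 1)).add (hCX a 2)
    · exact hX 1
    · exact (hCX a 1).add (hX 2)

theorem map_quotientEquivAlg_degOnePart {k : Type*} [Field k]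
    {I J : Ideal (MvPolynomial (Fin 3) k)}
    (f : MvPolynomial (Fin 3) k ≃ₐ[k] MvPolynomial (Fin 3) k) (hIJ : J = I.map (f : _ →+* _))
    (hf : (homogeneousSubmodule (Fin 3) k 1).map f.toLinearMap =
      homogeneousSubmodule (Fin 3) k 1) :
    (degOnePart k I).map (Ideal.quotientEquivAlg I J f hIJ).toLinearMap = degOnePart k J := by
  conv_rhs => rw [degOnePart, ← hf, ← Submodule.map_comp]
  rw [degOnePart, ← Submodule.map_comp]
  rfl

theorem stmt1 (k : Type*) [Field k] (h2 : ringChar k ≠ 2) (h3 : ringChar k ≠ 3) :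
    letI x : MvPolynomial (Fin 3) k := X 0
    letI y : MvPolynomial (Fin 3) k := X 1
    letI z : MvPolynomial (Fin 3) k := X 2
    -- φ : x ↦ x − y/9 − z/3, y ↦ y, z ↦ −y/3 + z
    letI φ : MvPolynomial (Fin 3) k →ₐ[k] MvPolynomial (Fin 3) k :=
      MvPolynomial.aeval
        ![x - C (9 : k)⁻¹ * y - C (3 : k)⁻¹ * z, y, - (C (3 : k)⁻¹ * y) + z]
    letI I₁ : Ideal (MvPolynomial (Fin 3) k) :=
      Ideal.span {y ^ 2, x * y + y * z + z ^ 2, x * z}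
    letI I₂ : Ideal (MvPolynomial (Fin 3) k) :=
      Ideal.span {y ^ 2, x * y + z ^ 2, x * z}
    Ideal.map φ I₁ = I₂ ∧
      ∃ e : (MvPolynomial (Fin 3) k ⧸ I₁) ≃ₐ[k] (MvPolynomial (Fin 3) k ⧸ I₂),
        (degOnePart k I₁).map e.toLinearMap = degOnePart k I₂ := by
  have h3' : (3 : k) ≠ 0 := by
    intro h
    have hdvd : ringChar k ∣ 3 := ringChar.dvd (by exact_mod_cast h)
    rcases (Nat.dvd_prime Nat.prime_three).mp hdvd with h1 | h1
    · exact CharP.ringChar_ne_one h1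
    · exact h3 h1
  have h9 : (9 : k)⁻¹ = (3 : k)⁻¹ ^ 2 := by
    rw [inv_pow]
    norm_num
  have hmap := map_shearEquiv_span (mul_inv_cancel₀ h3')
  rw [h9]
  exact ⟨hmap, Ideal.quotientEquivAlg _ _ (shearEquiv (3 : k)⁻¹) hmap.symm,
    map_quotientEquivAlg_degOnePart _ _ (map_shearEquiv_homogeneousSubmodule_one _)⟩
end

section
/- Let k be an algebraically closed field of characteristic 3 and let S = k[x,y,z]. Then there is no graded k-algebra isomorphism between k[x,y,z]/(y², xy + z², xz) and k[x,y,z]/(y², xy + yz + z², xz). -/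
open MvPolynomial

/-- Restriction of a ternary polynomial to the line through the origin spanned by `v`. -/
noncomputable def restrictLine {k : Type*} [Field k] (v : Fin 3 → k) :
    MvPolynomial (Fin 3) k →ₐ[k] Polynomial k :=
  aeval fun i => Polynomial.C (v i) * Polynomial.X

/-- The linear form with coefficient vector `a`. -/
noncomputable def linearForm {k : Type*} [Field k] (a : Fin 3 → k) : MvPolynomial (Fin 3) k :=
  C (a 0) * X 0 + C (a 1) * X 1 + C (a 2) * X 2

theorem exists_linearForm_of_isHomogeneous_one {k : Type*} [Field k]
    {p : MvPolynomial (Fin 3) k} (hp : p.IsHomogeneous 1) : ∃ a, p = linearForm a := by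
  have hp' : p ∈ homogeneousSubmodule (Fin 3) k 1 := hp
  rw [homogeneousSubmodule_one_eq_span_X, Submodule.mem_span_range_iff_exists_fun] at hp'
  obtain ⟨a, rfl⟩ := hp'
  exact ⟨a, by simp [linearForm, Fin.sum_univ_three, smul_eq_C_mul]⟩

theorem restrictLine_X {k : Type*} [Field k] (v : Fin 3 → k) (i : Fin 3) :
    restrictLine v (X i) = Polynomial.C (v i) * Polynomial.X := by
  simp [restrictLine]

theorem restrictLine_C {k : Type*} [Field k] (v : Fin 3 → k) (c : k) :
    restrictLine v (C c) = Polynomial.C c := by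
  simp [restrictLine]

theorem restrictLine_linearForm {k : Type*} [Field k] (v a : Fin 3 → k) :
    restrictLine v (linearForm a) =
      Polynomial.C (a 0 * v 0 + a 1 * v 1 + a 2 * v 2) * Polynomial.X := by
  simp only [linearForm, map_add, map_mul, restrictLine_X, restrictLine_C]
  ring

theorem coeff_zero_restrictLine {k : Type*} [Field k] (v : Fin 3 → k)
    (p : MvPolynomial (Fin 3) k) :
    (restrictLine v p).coeff 0 = constantCoeff p := by
  induction p using MvPolynomial.induction_on with
  | C a => simp
  | add p q hp hq => simp [hp, hq]
  | mul_X p i hp => simp [restrictLine_X, Polynomial.mul_coeff_zero]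

theorem restrictLine_of_mem_span {k : Type*} [Field k] (t : k) {f : MvPolynomial (Fin 3) k}
    (hf : f ∈ Ideal.span {X 1 ^ 2, X 0 * X 1 + C t * (X 1 * X 2) + X 2 ^ 2, X 0 * X 2}) :
    ∃ a b c : k, ∀ v : Fin 3 → k,
      (restrictLine v f).coeff 1 = 0 ∧
      (restrictLine v f).coeff 2 =
        a * v 1 ^ 2 + b * (v 0 * v 1 + t * (v 1 * v 2) + v 2 ^ 2) + c * (v 0 * v 2) := by
  obtain ⟨p, q, r, rfl⟩ := Submodule.mem_span_triple.1 hf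
  refine ⟨constantCoeff p, constantCoeff q, constantCoeff r, fun v => ?_⟩
  have key : restrictLine v (p • X 1 ^ 2 +
      q • (X 0 * X 1 + C t * (X 1 * X 2) + X 2 ^ 2) + r • (X 0 * X 2)) =
      (restrictLine v p * Polynomial.C (v 1 ^ 2) +
        restrictLine v q * Polynomial.C (v 0 * v 1 + t * (v 1 * v 2) + v 2 ^ 2) +
        restrictLine v r * Polynomial.C (v 0 * v 2)) * Polynomial.X ^ 2 := by
    simp only [smul_eq_mul, map_add, map_mul, map_pow, restrictLine_X, restrictLine_C]
    ring
  rw [key]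
  constructor
  · rw [Polynomial.coeff_mul_X_pow', if_neg (by norm_num)]
  · rw [Polynomial.coeff_mul_X_pow', if_pos le_rfl]
    simp only [Nat.sub_self, Polynomial.coeff_add, Polynomial.coeff_mul_C,
      coeff_zero_restrictLine]

theorem eq_zero_of_linearForm_mem {k : Type*} [Field k] {t : k} {a : Fin 3 → k}
    (h : linearForm a ∈
      Ideal.span {X 1 ^ 2, X 0 * X 1 + C t * (X 1 * X 2) + X 2 ^ 2, X 0 * X 2}) : a = 0 := by
  obtain ⟨_, _, _, H⟩ := restrictLine_of_mem_span t h
  simp only [restrictLine_linearForm, Polynomial.coeff_C_mul, Polynomial.coeff_X_one] at H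
  ext i
  have := (H (Pi.single i 1)).1
  fin_cases i <;> simpa using this

/-- A sum of two products of linear forms lying in the ideal satisfies the linear relations
that cut out the degree-two part of the ideal. -/
theorem quadratic_relations {k : Type*} [Field k] {t : k}
    {a b c d : Fin 3 → k}
    (h : linearForm a * linearForm b + linearForm c * linearForm d ∈
      Ideal.span {X 1 ^ 2, X 0 * X 1 + C t * (X 1 * X 2) + X 2 ^ 2, X 0 * X 2}) :
    a 0 * b 0 + c 0 * d 0 = 0 ∧
    a 0 * b 1 + a 1 * b 0 + c 0 * d 1 + c 1 * d 0 = a 2 * b 2 + c 2 * d 2 ∧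
    a 1 * b 2 + a 2 * b 1 + c 1 * d 2 + c 2 * d 1 = t * (a 2 * b 2 + c 2 * d 2) := by
  obtain ⟨p, q, r, H⟩ := restrictLine_of_mem_span t h
  have G (u v w : k) : (a 0 * u + a 1 * v + a 2 * w) * (b 0 * u + b 1 * v + b 2 * w) +
      (c 0 * u + c 1 * v + c 2 * w) * (d 0 * u + d 1 * v + d 2 * w) =
      p * v ^ 2 + q * (u * v + t * (v * w) + w ^ 2) + r * (u * w) := by
    have := (H ![u, v, w]).2
    rw [map_add, map_mul, map_mul] at this
    simp only [restrictLine_linearForm] at this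
    rw [mul_mul_mul_comm, mul_mul_mul_comm (Polynomial.C (c 0 * _ + _ + _)), ← sq, ← add_mul,
      ← map_mul, ← map_mul, ← map_add, Polynomial.coeff_C_mul_X_pow, if_pos rfl] at this
    simpa using this
  have gx := G 1 0 0
  have gy := G 0 1 0
  have gz := G 0 0 1
  have gxy := G 1 1 0
  have gyz := G 0 1 1
  refine ⟨by linear_combination gx, by linear_combination gxy - gx - gy - gz,
    by linear_combination gyz - gy - gz - t * gz⟩

/-- A graded isomorphism between quotients is induced by a linear substitution. -/
theorem exists_linearForm_substitution {k : Type*} [Field k]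
    {I₁ I₂ : Ideal (MvPolynomial (Fin 3) k)}
    (e : (MvPolynomial (Fin 3) k ⧸ I₁) ≃ₐ[k] (MvPolynomial (Fin 3) k ⧸ I₂))
    (he : (degOnePart k I₁).map e.toLinearMap = degOnePart k I₂) :
    ∃ a : Fin 3 → Fin 3 → k, ∀ p, p ∈ I₁ ↔ aeval (fun i => linearForm (a i)) p ∈ I₂ := by
  have lift (i : Fin 3) : ∃ a, e (Ideal.Quotient.mkₐ k I₁ (X i)) =
      Ideal.Quotient.mkₐ k I₂ (linearForm a) := by
    have hi : e (Ideal.Quotient.mkₐ k I₁ (X i)) ∈ degOnePart k I₂ := by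
      rw [← he]
      exact Submodule.mem_map_of_mem (Submodule.mem_map_of_mem (isHomogeneous_X k i))
    obtain ⟨p, hp, hpe⟩ := hi
    obtain ⟨a, rfl⟩ := exists_linearForm_of_isHomogeneous_one hp
    exact ⟨a, hpe.symm⟩
  choose a ha using lift
  have comp_eq : (e : _ →ₐ[k] _).comp (Ideal.Quotient.mkₐ k I₁) =
      (Ideal.Quotient.mkₐ k I₂).comp (aeval fun i => linearForm (a i)) := by
    refine algHom_ext fun i => ?_
    rw [AlgHom.comp_apply, AlgHom.comp_apply, aeval_X]
    exact ha i
  refine ⟨a, fun p => ?_⟩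
  have congr_p := DFunLike.congr_fun comp_eq p
  rw [AlgHom.comp_apply, AlgHom.comp_apply] at congr_p
  rw [← Ideal.Quotient.eq_zero_iff_mem, ← Ideal.Quotient.eq_zero_iff_mem]
  exact (map_eq_zero_iff e e.injective).symm.trans (Eq.congr_left congr_p)

theorem map_degOnePart_ne {k : Type*} [Field k] [CharP k 3]
    {I₁ I₂ : Ideal (MvPolynomial (Fin 3) k)}
    (hI₁ : I₁ = Ideal.span {X 1 ^ 2, X 0 * X 1 + C 0 * (X 1 * X 2) + X 2 ^ 2, X 0 * X 2})
    (hI₂ : I₂ = Ideal.span {X 1 ^ 2, X 0 * X 1 + C 1 * (X 1 * X 2) + X 2 ^ 2, X 0 * X 2})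
    (e : (MvPolynomial (Fin 3) k ⧸ I₁) ≃ₐ[k] (MvPolynomial (Fin 3) k ⧸ I₂)) :
    (degOnePart k I₁).map e.toLinearMap ≠ degOnePart k I₂ := by
  intro he
  have h3 : (3 : k) = 0 := by exact_mod_cast CharP.cast_eq_zero k 3
  obtain ⟨a, mem_iff⟩ := exists_linearForm_substitution e he
  have hyy := (mem_iff (X 1 ^ 2)).1 (by rw [hI₁]; exact Ideal.subset_span (by simp))
  have hxy := (mem_iff (X 0 * X 1 + X 2 ^ 2)).1 (by rw [hI₁]; exact Ideal.subset_span (by simp))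
  have hxz := (mem_iff (X 0 * X 2)).1 (by rw [hI₁]; exact Ideal.subset_span (by simp))
  have pad (p : MvPolynomial (Fin 3) k) : p = p + linearForm 0 * linearForm 0 := by
    simp [linearForm]
  rw [hI₂] at hyy hxy hxz
  simp only [map_add, map_mul, map_pow, aeval_X, sq (linearForm _)] at hyy hxy hxz
  rw [pad (linearForm _ * _)] at hyy hxz
  obtain ⟨y1, y2, y3⟩ := quadratic_relations hyy
  obtain ⟨m1, m2, m3⟩ := quadratic_relations hxy
  obtain ⟨n1, n2, n3⟩ := quadratic_relations hxz
  simp only [Pi.zero_apply, mul_zero, add_zero, one_mul] at y1 y2 y3 n1 n2 n3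
  have a10 : a 1 0 = 0 := mul_self_eq_zero.1 y1
  have a12 : a 1 2 = 0 := mul_self_eq_zero.1 (by rw [← y2, a10]; ring)
  have a20 : a 2 0 = 0 := mul_self_eq_zero.1 (by simpa [a10] using m1)
  simp only [a10, a12, a20, mul_zero, zero_mul, add_zero, zero_add, one_mul] at m2 m3 n2 n3
  have a22 : a 2 2 = 0 := by
    have : a 0 0 * a 2 2 ^ 2 = 0 := by
      linear_combination -a 0 0 * m3 + a 0 2 * m2 + 2 * a 2 2 * n2 + a 0 2 * a 2 2 ^ 2 * h3
    rcases mul_eq_zero.1 this with h | h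
    · simpa [h] using m2.symm
    · simpa using h
  have hlin (b : Fin 3 → k) : linearForm b ∈ I₁ → b = 0 := fun h => by
    rw [hI₁] at h
    exact eq_zero_of_linearForm_mem h
  have h1 : a 1 1 = 0 := by
    have := hlin ![0, - a 2 1, a 1 1] ((mem_iff _).2 (by
      convert I₂.zero_mem
      simp [linearForm, a10, a12, a20, a22]
      ring))
    simpa using congrFun this 2
  have := hlin ![0, 1, 0] ((mem_iff _).2 (by
    convert I₂.zero_mem
    simp [linearForm, a10, a12, h1]))
  simpa using congrFun this 1

theorem stmt2 (k : Type*) [Field k] [IsAlgClosed k] [CharP k 3] :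
    letI x : MvPolynomial (Fin 3) k := X 0
    letI y : MvPolynomial (Fin 3) k := X 1
    letI z : MvPolynomial (Fin 3) k := X 2
    letI I₁ : Ideal (MvPolynomial (Fin 3) k) :=
      Ideal.span {y ^ 2, x * y + z ^ 2, x * z}
    letI I₂ : Ideal (MvPolynomial (Fin 3) k) :=
      Ideal.span {y ^ 2, x * y + y * z + z ^ 2, x * z}
    ¬ ∃ e : (MvPolynomial (Fin 3) k ⧸ I₁) ≃ₐ[k] (MvPolynomial (Fin 3) k ⧸ I₂),
        (degOnePart k I₁).map e.toLinearMap = degOnePart k I₂ := by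
  rintro ⟨e, he⟩
  exact map_degOnePart_ne (by simp) (by simp) e he
end

section
/- Let k be a field of characteristic 2 and let S = k[x,y,z]. Then the ideal I' = (xz, xy + yz, x² + z² + xy) admits no null-square linear form: there is no nonzero linear form ℓ ∈ S₁ with ℓ² ∈ I'. -/
open MvPolynomial

theorem stmt3 (k : Type*) [Field k] [CharP k 2] :
    letI x : MvPolynomial (Fin 3) k := X 0
    letI y : MvPolynomial (Fin 3) k := X 1
    letI z : MvPolynomial (Fin 3) k := X 2
    letI I' : Ideal (MvPolynomial (Fin 3) k) :=
      Ideal.span {x * z, x * y + y * z, x ^ 2 + z ^ 2 + x * y}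
    ∀ ℓ : MvPolynomial (Fin 3) k, ℓ.IsHomogeneous 1 → ℓ ≠ 0 → ℓ ^ 2 ∉ I' := by
  intro ℓ hℓ hne hmem
  rw [← mem_homogeneousSubmodule, homogeneousSubmodule_one_eq_span_X,
    Submodule.mem_span_range_iff_exists_fun] at hℓ
  obtain ⟨a, rfl⟩ := hℓ
  simp only [Fin.sum_univ_three, smul_eq_C_mul] at hne hmem
  obtain ⟨p, q, r, h⟩ := Submodule.mem_span_triple.mp hmem
  have h2 : (2 : MvPolynomial (Fin 3) k) = 0 := CharTwo.two_eq_zero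
  -- Products are left-nested so that `coeff_mul_X'` strips the variables one at a time.
  have hsq : p * X 0 * X 2 + q * X 0 * X 1 + q * X 1 * X 2 + r * X 0 * X 0 + r * X 2 * X 2
      + r * X 0 * X 1 =
      C (a 0 ^ 2) * X 0 * X 0 + C (a 1 ^ 2) * X 1 * X 1 + C (a 2 ^ 2) * X 2 * X 2 := by
    simp only [smul_eq_mul] at h
    simp only [C_pow]
    linear_combination h + (C (a 0) * X 0 * C (a 1) * X 1 + C (a 0) * X 0 * C (a 2) * X 2
      + C (a 1) * X 1 * C (a 2) * X 2) * h2
  have key (i j : Fin 3) :=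
    congrArg (coeff (Finsupp.single i 1 + Finsupp.single j 1)) hsq
  have hxx : coeff 0 r = a 0 ^ 2 := by simpa [coeff_mul_X', -C_pow, -map_pow] using key 0 0
  have hyy : 0 = a 1 ^ 2 := by simpa [coeff_mul_X', -C_pow, -map_pow] using key 1 1
  have hzz : coeff 0 r = a 2 ^ 2 := by simpa [coeff_mul_X', -C_pow, -map_pow] using key 2 2
  have hxy : coeff 0 q + coeff 0 r = 0 := by simpa [coeff_mul_X'] using key 0 1
  have hyz : coeff 0 q = 0 := by simpa [coeff_mul_X'] using key 1 2
  rw [hyz, zero_add] at hxy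
  rw [hxy] at hxx hzz
  apply hne
  simp [pow_eq_zero_iff two_ne_zero |>.mp hxx.symm, pow_eq_zero_iff two_ne_zero |>.mp hyy.symm,
    pow_eq_zero_iff two_ne_zero |>.mp hzz.symm]
end

section
/- Let k be an algebraically closed field of characteristic 2 and let S = k[x,y,z]. Then there is no graded k-algebra isomorphism between k[x,y,z]/(y² + xy, xy + z², xz) and k[x,y,z]/(xz, xy + yz, x² + z² + xy). (Indeed, y + z is a nonzero linear form whose square lies in (y² + xy, xy + z², xz), while the second ideal contains no square of a nonzero linear form.) -/
open MvPolynomial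

/-- The coefficient of `X i * X j` in a multiple of `X a * X b`. -/
theorem coeff_mul_X_mul_X {k : Type*} [Field k] (p : MvPolynomial (Fin 3) k) (i j a b : Fin 3) :
    coeff (Finsupp.single i 1 + Finsupp.single j 1) (p * (X a * X b)) =
      if (i = a ∧ j = b) ∨ (i = b ∧ j = a) then coeff 0 p else 0 := by
  have hX : (X a * X b : MvPolynomial (Fin 3) k) =
      monomial (Finsupp.single a 1 + Finsupp.single b 1) 1 := by
    simp [X, monomial_mul]
  rw [hX, coeff_mul_monomial']
  by_cases h : (i = a ∧ j = b) ∨ (i = b ∧ j = a)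
  · have heq : (Finsupp.single i 1 + Finsupp.single j 1 : Fin 3 →₀ ℕ) =
        Finsupp.single a 1 + Finsupp.single b 1 := by
      rcases h with ⟨rfl, rfl⟩ | ⟨rfl, rfl⟩
      · rfl
      · exact add_comm _ _
    simp [heq, h]
  · have hle : ¬ (Finsupp.single a 1 + Finsupp.single b 1 : Fin 3 →₀ ℕ) ≤
        Finsupp.single i 1 + Finsupp.single j 1 := by
      intro hle
      have hle' := fun t => Finsupp.le_def.1 hle t
      simp only [Finsupp.add_apply, Finsupp.single_apply] at hle'
      have h₀ := hle' a
      have h₁ := hle' b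
      grind
    rw [if_neg hle, if_neg h]

/-- A linear form is a linear combination of the three variables. -/
theorem exists_eq_of_mem_homogeneousSubmodule_one {k : Type*} [Field k]
    {l : MvPolynomial (Fin 3) k} (hl : l ∈ homogeneousSubmodule (Fin 3) k 1) :
    ∃ a b c : k, l = C a * X 0 + C b * X 1 + C c * X 2 := by
  rw [homogeneousSubmodule_one_eq_span_X, Submodule.mem_span_range_iff_exists_fun] at hl
  obtain ⟨f, rfl⟩ := hl
  exact ⟨f 0, f 1, f 2, by simp [Fin.sum_univ_three, smul_eq_C_mul]⟩

/-- In characteristic two, the ideal `(xz, xy + yz, x² + z² + xy)` contains no square of a nonzero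
linear form. -/
theorem eq_zero_of_sq_mem {k : Type*} [Field k] [CharP k 2]
    {l : MvPolynomial (Fin 3) k} (hl : l ∈ homogeneousSubmodule (Fin 3) k 1)
    (hsq : l ^ 2 ∈ Ideal.span ({X 0 * X 2, X 0 * X 1 + X 1 * X 2, X 0 ^ 2 + X 2 ^ 2 + X 0 * X 1} :
      Set (MvPolynomial (Fin 3) k))) : l = 0 := by
  obtain ⟨a, b, c, rfl⟩ := exists_eq_of_mem_homogeneousSubmodule_one hl
  obtain ⟨f, g, h, hfgh⟩ := Submodule.mem_span_triple.1 hsq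
  have key : f * (X 0 * X 2) + g * (X 0 * X 1) + g * (X 1 * X 2) + h * (X 0 * X 0)
      + h * (X 2 * X 2) + h * (X 0 * X 1) =
      C (a ^ 2) * (X 0 * X 0) + C (b ^ 2) * (X 1 * X 1) + C (c ^ 2) * (X 2 * X 2) := by
    simp only [smul_eq_mul, CharTwo.add_sq] at hfgh
    simp only [map_pow]
    linear_combination hfgh
  have hcoeff := fun i j : Fin 3 =>
    congrArg (coeff (Finsupp.single i 1 + Finsupp.single j 1)) key
  simp only [coeff_add, coeff_mul_X_mul_X, coeff_zero_C] at hcoeff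
  have hxx := hcoeff 0 0
  have hyy := hcoeff 1 1
  have hzz := hcoeff 2 2
  have hxy := hcoeff 0 1
  have hyz := hcoeff 1 2
  simp at hxx hyy hzz hxy hyz
  rw [hyz, zero_add] at hxy
  rw [hxy] at hxx hzz
  have ha : a = 0 := by simpa using hxx.symm
  have hb : b = 0 := by simpa using hyy.symm
  have hc : c = 0 := by simpa using hzz.symm
  simp [ha, hb, hc]

/-- The linear form `y + z` does not lie in the ideal `(y² + xy, xy + z², xz)`. -/
theorem X_one_add_X_two_notMem {k : Type*} [Field k] :
    (X 1 + X 2 : MvPolynomial (Fin 3) k) ∉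
      Ideal.span ({X 1 ^ 2 + X 0 * X 1, X 0 * X 1 + X 2 ^ 2, X 0 * X 2} :
        Set (MvPolynomial (Fin 3) k)) := by
  intro hmem
  let φ : MvPolynomial (Fin 3) k →ₐ[k] DualNumber k := aeval ![0, DualNumber.eps, 0]
  have hle : Ideal.span ({X 1 ^ 2 + X 0 * X 1, X 0 * X 1 + X 2 ^ 2, X 0 * X 2} :
      Set (MvPolynomial (Fin 3) k)) ≤ RingHom.ker φ := by
    rw [Ideal.span_le]
    rintro p (rfl | rfl | rfl) <;> simp [φ, RingHom.mem_ker, pow_two]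
  have hφ : φ (X 1 + X 2) = 0 := hle hmem
  have hsnd := congrArg TrivSqZeroExt.snd hφ
  simp [φ] at hsnd

theorem stmt4 (k : Type*) [Field k] [IsAlgClosed k] [CharP k 2] :
    letI x : MvPolynomial (Fin 3) k := X 0
    letI y : MvPolynomial (Fin 3) k := X 1
    letI z : MvPolynomial (Fin 3) k := X 2
    letI I₁ : Ideal (MvPolynomial (Fin 3) k) :=
      Ideal.span {y ^ 2 + x * y, x * y + z ^ 2, x * z}
    letI I₂ : Ideal (MvPolynomial (Fin 3) k) :=
      Ideal.span {x * z, x * y + y * z, x ^ 2 + z ^ 2 + x * y}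
    ¬ ∃ e : (MvPolynomial (Fin 3) k ⧸ I₁) ≃ₐ[k] (MvPolynomial (Fin 3) k ⧸ I₂),
        (degOnePart k I₁).map e.toLinearMap = degOnePart k I₂ := by
  rintro ⟨e, he⟩
  have hlin : (X 1 + X 2 : MvPolynomial (Fin 3) k) ∈ homogeneousSubmodule (Fin 3) k 1 :=
    add_mem (isHomogeneous_X k 1) (isHomogeneous_X k 2)
  have himage := he.le (Submodule.mem_map_of_mem (Submodule.mem_map_of_mem hlin))
  obtain ⟨l, hl, hle⟩ := himage
  simp only [AlgHom.toLinearMap_apply, AlgEquiv.toLinearMap_apply, Ideal.Quotient.mkₐ_eq_mk] at hle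
  have hsq : l = 0 := by
    refine eq_zero_of_sq_mem hl (Ideal.Quotient.eq_zero_iff_mem.1 ?_)
    rw [map_pow, hle, ← map_pow, ← map_pow, EmbeddingLike.map_eq_zero_iff,
      Ideal.Quotient.eq_zero_iff_mem, CharTwo.add_sq]
    have hadd : (X 1 ^ 2 + X 2 ^ 2 : MvPolynomial (Fin 3) k) =
        (X 1 ^ 2 + X 0 * X 1) + (X 0 * X 1 + X 2 ^ 2) := by
      linear_combination -(CharTwo.add_self_eq_zero (X 0 * X 1 : MvPolynomial (Fin 3) k))
    rw [hadd]
    exact add_mem (Ideal.subset_span (by simp)) (Ideal.subset_span (by simp))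
  rw [hsq, map_zero, eq_comm, EmbeddingLike.map_eq_zero_iff,
    Ideal.Quotient.eq_zero_iff_mem] at hle
  exact X_one_add_X_two_notMem hle
end

section
/- Let k be an algebraically closed field of characteristic different from 2 and let S = k[x,y,z]. Then there exists a graded k-algebra isomorphism between k[x,y,z]/(y² + xy, xy + z², xz) and k[x,y,z]/(xz, xy + yz, x² + z² + xy). -/
open MvPolynomial

/-- The linear substitution `x ↦ -y/4`, `y ↦ (z - x)/2`, `z ↦ (x + z)/2`, where `c` is `1/2`. -/
noncomputable def netSubst {k : Type*} [Field k] (c : k) :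
    MvPolynomial (Fin 3) k →ₐ[k] MvPolynomial (Fin 3) k :=
  aeval ![-C c ^ 2 * X 1, C c * (X 2 - X 0), C c * (X 0 + X 2)]

/-- The linear substitution `x ↦ z - y`, `y ↦ -4x`, `z ↦ y + z`. -/
noncomputable def netSubstInv (k : Type*) [Field k] :
    MvPolynomial (Fin 3) k →ₐ[k] MvPolynomial (Fin 3) k :=
  aeval ![X 2 - X 1, -4 * X 0, X 1 + X 2]

lemma two_mul_C {k : Type*} [Field k] {c : k} (hc : 2 * c = 1) :
    2 * (C c : MvPolynomial (Fin 3) k) = 1 := by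
  rw [← C_1, ← hc, C_mul, map_ofNat]

/-- `netSubst c` and `netSubstInv k` are mutually inverse when `2 * c = 1`. -/
noncomputable def netEquiv {k : Type*} [Field k] {c : k} (hc : 2 * c = 1) :
    MvPolynomial (Fin 3) k ≃ₐ[k] MvPolynomial (Fin 3) k :=
  AlgEquiv.ofAlgHom (netSubst c) (netSubstInv k)
    (by
      have h := two_mul_C hc
      ext1 i
      fin_cases i <;> simp [netSubst, netSubstInv, map_ofNat (bind₁ _)]
      · linear_combination X 0 * h
      · linear_combination X 1 * (2 * C c + 1) * h
      · linear_combination X 2 * h)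
    (by
      have h := two_mul_C hc
      ext1 i
      fin_cases i <;> simp [netSubst, netSubstInv, algHom_C]
      · linear_combination X 0 * (2 * C c + 1) * h
      · linear_combination X 1 * h
      · linear_combination X 2 * h)

lemma isHomogeneous_netSubst {k : Type*} [Field k] (c : k) {p : MvPolynomial (Fin 3) k}
    (hp : p.IsHomogeneous 1) : (netSubst c p).IsHomogeneous 1 := by
  refine hp.aeval _ (n := 1) (Fin.forall_fin_succ.2 ⟨?_, Fin.forall_fin_two.2 ⟨?_, ?_⟩⟩)
  · change (-C c ^ 2 * X 1 : MvPolynomial (Fin 3) k).IsHomogeneous 1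
    rw [← C_pow, ← C_neg]
    exact (isHomogeneous_X k _).C_mul _
  · change (C c * (X 2 - X 0) : MvPolynomial (Fin 3) k).IsHomogeneous 1
    exact ((isHomogeneous_X k _).sub (isHomogeneous_X k _)).C_mul c
  · change (C c * (X 0 + X 2) : MvPolynomial (Fin 3) k).IsHomogeneous 1
    exact ((isHomogeneous_X k _).add (isHomogeneous_X k _)).C_mul c

lemma isHomogeneous_netSubstInv {k : Type*} [Field k] {p : MvPolynomial (Fin 3) k}
    (hp : p.IsHomogeneous 1) : (netSubstInv k p).IsHomogeneous 1 := by
  refine hp.aeval _ (n := 1) (Fin.forall_fin_succ.2 ⟨?_, Fin.forall_fin_two.2 ⟨?_, ?_⟩⟩)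
  · exact (isHomogeneous_X k _).sub (isHomogeneous_X k _)
  · change (-4 * X 0 : MvPolynomial (Fin 3) k).IsHomogeneous 1
    rw [← map_ofNat C 4, ← C_neg]
    exact (isHomogeneous_X k _).C_mul _
  · exact (isHomogeneous_X k _).add (isHomogeneous_X k _)

/-- An automorphism of `S` preserving linear forms in both directions induces a map of quotients
preserving the degree-one components. -/
lemma map_degOnePart_quotientEquivAlg {k : Type*} [Field k] {I J : Ideal (MvPolynomial (Fin 3) k)}
    (f : MvPolynomial (Fin 3) k ≃ₐ[k] MvPolynomial (Fin 3) k)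
    (hIJ : J = I.map (f : MvPolynomial (Fin 3) k →+* MvPolynomial (Fin 3) k))
    (hf : ∀ p : MvPolynomial (Fin 3) k, p.IsHomogeneous 1 → (f p).IsHomogeneous 1)
    (hf' : ∀ p : MvPolynomial (Fin 3) k, p.IsHomogeneous 1 → (f.symm p).IsHomogeneous 1) :
    (degOnePart k I).map (Ideal.quotientEquivAlg I J f hIJ).toLinearMap = degOnePart k J := by
  ext q
  constructor
  · rintro ⟨_, ⟨p, hp, rfl⟩, rfl⟩
    exact ⟨f p, hf p hp, rfl⟩
  · rintro ⟨p, hp, rfl⟩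
    refine ⟨_, ⟨f.symm p, hf' p hp, rfl⟩, ?_⟩
    change Ideal.Quotient.mk J (f (f.symm p)) = Ideal.Quotient.mk J p
    rw [f.apply_symm_apply]

theorem stmt5 (k : Type*) [Field k] [IsAlgClosed k] (hchar : ringChar k ≠ 2) :
    letI x : MvPolynomial (Fin 3) k := X 0
    letI y : MvPolynomial (Fin 3) k := X 1
    letI z : MvPolynomial (Fin 3) k := X 2
    letI I₁ : Ideal (MvPolynomial (Fin 3) k) :=
      Ideal.span {y ^ 2 + x * y, x * y + z ^ 2, x * z}
    letI I₂ : Ideal (MvPolynomial (Fin 3) k) :=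
      Ideal.span {x * z, x * y + y * z, x ^ 2 + z ^ 2 + x * y}
    ∃ e : (MvPolynomial (Fin 3) k ⧸ I₁) ≃ₐ[k] (MvPolynomial (Fin 3) k ⧸ I₂),
        (degOnePart k I₁).map e.toLinearMap = degOnePart k I₂ := by
  let x : MvPolynomial (Fin 3) k := X 0
  let y : MvPolynomial (Fin 3) k := X 1
  let z : MvPolynomial (Fin 3) k := X 2
  let I₁ : Ideal (MvPolynomial (Fin 3) k) := Ideal.span {y ^ 2 + x * y, x * y + z ^ 2, x * z}
  let I₂ : Ideal (MvPolynomial (Fin 3) k) :=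
    Ideal.span {x * z, x * y + y * z, x ^ 2 + z ^ 2 + x * y}
  have h2 : (2 : k) ≠ 0 := Ring.two_ne_zero hchar
  have hc : 2 * (2⁻¹ : k) = 1 := mul_inv_cancel₀ h2
  have h := two_mul_C hc
  generalize (2⁻¹ : k) = c at hc h
  have a₁ : x * z ∈ I₂ := Ideal.subset_span (by simp)
  have a₂ : x * y + y * z ∈ I₂ := Ideal.subset_span (by simp)
  have a₃ : x ^ 2 + z ^ 2 + x * y ∈ I₂ := Ideal.subset_span (by simp)
  have b₁ : y ^ 2 + x * y ∈ I₁ := Ideal.subset_span (by simp)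
  have b₂ : x * y + z ^ 2 ∈ I₁ := Ideal.subset_span (by simp)
  have b₃ : x * z ∈ I₁ := Ideal.subset_span (by simp)
  have hle : I₁ ≤ I₂.comap (netSubst c) := by
    refine Ideal.span_le.2 ?_
    rintro _ (rfl | rfl | rfl)
    · have e : netSubst c (y ^ 2 + x * y) = C c ^ 2 * (x ^ 2 + z ^ 2 + x * y)
          - 2 * C c ^ 2 * (x * z) - C c ^ 3 * (x * y + y * z) := by
        simp [netSubst, x, y, z]
        linear_combination C c ^ 2 * X 0 * X 1 * h
      simpa only [SetLike.mem_coe, Ideal.mem_comap, e] using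
        sub_mem (sub_mem (I₂.mul_mem_left _ a₃) (I₂.mul_mem_left _ a₁)) (I₂.mul_mem_left _ a₂)
    · have e : netSubst c (x * y + z ^ 2) = C c ^ 2 * (x ^ 2 + z ^ 2 + x * y)
          + 2 * C c ^ 2 * (x * z) - C c ^ 3 * (x * y + y * z) := by
        simp [netSubst, x, y, z]
        linear_combination C c ^ 2 * X 0 * X 1 * h
      simpa only [SetLike.mem_coe, Ideal.mem_comap, e] using
        sub_mem (add_mem (I₂.mul_mem_left _ a₃) (I₂.mul_mem_left _ a₁)) (I₂.mul_mem_left _ a₂)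
    · have e : netSubst c (x * z) = -C c ^ 3 * (x * y + y * z) := by
        simp [netSubst, x, y, z]
        ring
      simpa only [SetLike.mem_coe, Ideal.mem_comap, e] using I₂.mul_mem_left _ a₂
  have hge : I₂ ≤ I₁.comap (netSubstInv k) := by
    refine Ideal.span_le.2 ?_
    rintro _ (rfl | rfl | rfl)
    · have e : netSubstInv k (x * z) = (x * y + z ^ 2) - (y ^ 2 + x * y) := by
        simp [netSubstInv, x, y, z]
        ring
      simpa only [SetLike.mem_coe, Ideal.mem_comap, e] using sub_mem b₂ b₁
    · have e : netSubstInv k (x * y + y * z) = -8 * (x * z) := by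
        simp [netSubstInv, x, y, z]
        ring
      simpa only [SetLike.mem_coe, Ideal.mem_comap, e] using I₁.mul_mem_left _ b₃
    · have e : netSubstInv k (x ^ 2 + z ^ 2 + x * y) =
          2 * (y ^ 2 + x * y) + 2 * (x * y + z ^ 2) - 4 * (x * z) := by
        simp [netSubstInv, x, y, z]
        ring
      simpa only [SetLike.mem_coe, Ideal.mem_comap, e] using
        sub_mem (add_mem (I₁.mul_mem_left _ b₁) (I₁.mul_mem_left _ b₂)) (I₁.mul_mem_left _ b₃)
  have hIJ : I₂ = I₁.map (netEquiv hc : MvPolynomial (Fin 3) k →+* MvPolynomial (Fin 3) k) := by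
    refine le_antisymm (fun p hp => ?_) (Ideal.map_le_iff_le_comap.2 hle)
    rw [← (netEquiv hc).apply_symm_apply p]
    exact Ideal.mem_map_of_mem _ (hge hp)
  exact ⟨Ideal.quotientEquivAlg I₁ I₂ (netEquiv hc) hIJ,
    map_degOnePart_quotientEquivAlg _ hIJ (fun _ => isHomogeneous_netSubst c)
      (fun _ => isHomogeneous_netSubstInv)⟩
end

section
/- Let d be a positive integer and k a field of characteristic either 0 or greater than d. Let S = k[x₁,…,xₙ] and define the apolarity pairing on the space S_d of homogeneous polynomials of degree d by ⟨g | f⟩ = Σ_α (α₁!·…·αₙ!)·(coefficient of x^α in g)·(coefficient of x^α in f), the sum over all exponent vectors α of total degree d. Let V ⊆ S_d be a k-vector subspace and let c = (c₁,…,cₙ) ∈ kⁿ. Then (c₁x₁ + … + cₙxₙ)^d ∈ V if and only if every g ∈ S_d satisfying ⟨g | f⟩ = 0 for all f ∈ V also satisfies g(c₁,…,cₙ) = 0. -/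
open MvPolynomial

/-- The apolarity pairing `⟨g ∣ f⟩ = ∑_α (α₁! ⋯ αₙ!) (coeff of x^α in g) (coeff of x^α in f)`,
the sum being over the exponent vectors `α` (only those in the support of `f`
contribute). -/
noncomputable def apolarPairing {k : Type*} [Field k] {n : ℕ}
    (g f : MvPolynomial (Fin n) k) : k :=
  ∑ α ∈ f.support, (∏ i, ((α i).factorial : k)) * g.coeff α * f.coeff α

theorem natCast_factorial_ne_zero_of_ringChar {k : Type*} [Field k] {d : ℕ}
    (h : ringChar k = 0 ∨ d < ringChar k) : (d.factorial : k) ≠ 0 := by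
  rw [Ne, ringChar.spec]
  rcases h with h | h
  · rw [h, zero_dvd_iff]
    exact d.factorial_ne_zero
  · have hp : (ringChar k).Prime :=
      (CharP.char_is_prime_or_zero k (ringChar k)).resolve_right (by omega)
    rw [hp.dvd_factorial]
    omega

theorem prod_natCast_factorial_ne_zero {k : Type*} [Field k] {n : ℕ} (α : Fin n →₀ ℕ)
    (h : (α.degree.factorial : k) ≠ 0) : ∏ i, ((α i).factorial : k) ≠ 0 := by
  have hdvd : ((∏ i, (α i).factorial : ℕ) : k) ∣ (α.degree.factorial : k) := by
    rw [Finsupp.degree_eq_sum]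
    exact Nat.cast_dvd_cast (Nat.prod_factorial_dvd_factorial_sum _ _)
  push_cast at hdvd
  exact ne_zero_of_dvd_ne_zero h hdvd

theorem apolarPairing_eq_sum {k : Type*} [Field k] {n : ℕ} (g : MvPolynomial (Fin n) k)
    {f : MvPolynomial (Fin n) k} {s : Finset (Fin n →₀ ℕ)} (hs : f.support ⊆ s) :
    apolarPairing g f = ∑ α ∈ s, (∏ i, ((α i).factorial : k)) * g.coeff α * f.coeff α :=
  Finset.sum_subset hs fun α _ hα ↦ by rw [notMem_support_iff.mp hα, mul_zero]

/-- The exponent vectors of total degree `d`. -/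
noncomputable def exponentsOfDegree (n d : ℕ) : Finset (Fin n →₀ ℕ) :=
  (Finsupp.finite_of_degree_eq (σ := Fin n) d).toFinset

theorem mem_exponentsOfDegree {n d : ℕ} {α : Fin n →₀ ℕ} :
    α ∈ exponentsOfDegree n d ↔ α.degree = d := by
  simp [exponentsOfDegree]

theorem support_subset_exponentsOfDegree {k : Type*} [Field k] {n d : ℕ}
    {f : MvPolynomial (Fin n) k} (hf : f.IsHomogeneous d) :
    f.support ⊆ exponentsOfDegree n d := fun α hα ↦ by
  rw [mem_exponentsOfDegree]
  by_contra h
  exact mem_support_iff.mp hα (hf.coeff_eq_zero h)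

theorem isHomogeneous_linearForm_pow {k : Type*} [Field k] {n : ℕ} (d : ℕ) (c : Fin n → k) :
    ((∑ i, c i • (X i : MvPolynomial (Fin n) k)) ^ d).IsHomogeneous d := by
  have h : (∑ i, c i • (X i : MvPolynomial (Fin n) k)).IsHomogeneous 1 :=
    IsHomogeneous.sum _ _ _ fun i _ ↦ by
      rw [smul_eq_C_mul]
      exact (isHomogeneous_X k i).C_mul _
  simpa using h.pow d

/-- Pairing with the `d`-th power of a linear form is evaluation, up to the factor `d!`. -/
theorem apolarPairing_linearForm_pow {k : Type*} [Field k] {n d : ℕ}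
    {g : MvPolynomial (Fin n) k} (hg : g.IsHomogeneous d) (c : Fin n → k) :
    apolarPairing g ((∑ i, c i • (X i : MvPolynomial (Fin n) k)) ^ d) =
      d.factorial * eval c g := by
  rw [apolarPairing_eq_sum g (support_subset_exponentsOfDegree (isHomogeneous_linearForm_pow d c)),
    eval_eq', Finset.sum_subset (support_subset_exponentsOfDegree hg)
      (fun α _ hα ↦ by rw [notMem_support_iff.mp hα, zero_mul]), Finset.mul_sum]
  refine Finset.sum_congr rfl fun α hα ↦ ?_
  rw [mem_exponentsOfDegree] at hα
  have hmul : (∏ i, ((α i).factorial : k)) * α.multinomial = d.factorial := by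
    rw [Finsupp.multinomial_eq_of_support_subset (Finset.subset_univ _), ← hα,
      Finsupp.degree_eq_sum, ← Nat.multinomial_spec]
    push_cast
    rfl
  rw [coeff_linearCombination_X_pow_of_fintype, if_pos (show α.sum (fun _ m ↦ m) = d from hα),
    Finsupp.prod_fintype _ _ (by simp), ← hmul]
  ring

/-- Every linear functional on the forms of degree `d` is represented by the apolarity pairing. -/
theorem exists_apolarPairing_eq {k : Type*} [Field k] {n d : ℕ} (hd : (d.factorial : k) ≠ 0)
    (φ : MvPolynomial (Fin n) k →ₗ[k] k) :
    ∃ g : MvPolynomial (Fin n) k, g.IsHomogeneous d ∧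
      ∀ f : MvPolynomial (Fin n) k, f.IsHomogeneous d → apolarPairing g f = φ f := by
  classical
  let a (α : Fin n →₀ ℕ) : k := (∏ i, ((α i).factorial : k))⁻¹ * φ (monomial α 1)
  refine ⟨∑ α ∈ exponentsOfDegree n d, monomial α (a α),
    IsHomogeneous.sum _ _ _ fun α hα ↦
      isHomogeneous_monomial _ (mem_exponentsOfDegree.mp hα), fun f hf ↦ ?_⟩
  have hφ : φ f = ∑ α ∈ f.support, f.coeff α * φ (monomial α 1) := by
    conv_lhs => rw [f.as_sum, map_sum]
    refine Finset.sum_congr rfl fun α _ ↦ ?_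
    rw [← smul_eq_mul, ← map_smul, smul_monomial, smul_eq_mul, mul_one]
  rw [hφ, apolarPairing]
  refine Finset.sum_congr rfl fun α hα ↦ ?_
  have hαd := support_subset_exponentsOfDegree hf hα
  have hne := prod_natCast_factorial_ne_zero (k := k) α
    (by rwa [mem_exponentsOfDegree.mp hαd])
  have hcoeff : coeff α (∑ β ∈ exponentsOfDegree n d, monomial β (a β)) = a α := by
    simp [coeff_sum, coeff_monomial, hαd]
  rw [hcoeff, mul_inv_cancel_left₀ hne, mul_comm]

theorem stmt7 (k : Type*) [Field k] (n d : ℕ) (hd : 0 < d)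
    (hchar : ringChar k = 0 ∨ d < ringChar k)
    (V : Submodule k (MvPolynomial (Fin n) k))
    (hV : V ≤ MvPolynomial.homogeneousSubmodule (Fin n) k d)
    (c : Fin n → k) :
    (∑ i, c i • (X i : MvPolynomial (Fin n) k)) ^ d ∈ V ↔
      ∀ g : MvPolynomial (Fin n) k, g.IsHomogeneous d →
        (∀ f ∈ V, apolarPairing g f = 0) → MvPolynomial.eval c g = 0 := by
  have hfac := natCast_factorial_ne_zero_of_ringChar hchar
  constructor
  · intro hmem g hg hgV
    have h := hgV _ hmem
    rw [apolarPairing_linearForm_pow hg] at h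
    exact (mul_eq_zero.mp h).resolve_left hfac
  · intro h
    by_contra hmem
    obtain ⟨φ, hφ, hVφ⟩ := Submodule.exists_le_ker_of_notMem hmem
    obtain ⟨g, hg, hgφ⟩ := exists_apolarPairing_eq hfac φ
    refine hφ ?_
    rw [← hgφ _ (isHomogeneous_linearForm_pow d c), apolarPairing_linearForm_pow hg,
      h g hg fun f hf ↦ (hgφ f (hV hf)).trans (hVφ hf), mul_zero]
end

section
/- Let k be an algebraically closed field of characteristic different from 2, let S = k[x₁,…,xₙ] with n ≥ 3, and let I ⊆ S be an ideal generated by homogeneous polynomials of degree 2 with dim_k (S/I)₂ = 2. Suppose that S/I is not a trivial fiber extension (there is no nonzero linear form ℓ ∈ S₁ with ℓ·S₁ ⊆ I) and that there is no null-square linear form ℓ ∈ S₁ (ℓ nonzero with ℓ² ∈ I) whose image ℓ̄ in S/I satisfies ℓ̄·(S/I)₁ = (S/I)₂. Then there exists a nonzero point c ∈ kⁿ at which every element of I vanishes. -/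
open MvPolynomial

section Pencil

variable {k V W : Type*} [Field k] [AddCommGroup V] [Module k V] [AddCommGroup W] [Module k W]

/-- Over an algebraically closed field, every quadratic equation has a root. -/
lemma exists_quadratic_root [IsAlgClosed k] {a : k} (ha : a ≠ 0) (b c : k) :
    ∃ t : k, a * t ^ 2 + 2 * b * t + c = 0 := by
  obtain ⟨s, hs⟩ := IsAlgClosed.exists_pow_nat_eq (b ^ 2 - a * c) (n := 2) (by norm_num)
  refine ⟨(s - b) / a, ?_⟩
  field_simp
  linear_combination hs

/-- Some nonzero member of a pencil of bilinear forms is degenerate. -/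
lemma exists_degenerate_member [IsAlgClosed k] [FiniteDimensional k V] [Nontrivial V]
    (hW : Module.finrank k W = 2) (B : V →ₗ[k] V →ₗ[k] W) :
    ∃ φ ψ : Module.Dual k W, (∀ w, φ w = 0 → ψ w = 0 → w = 0) ∧
      ∃ e : V, e ≠ 0 ∧ ∀ y, φ (B e y) = 0 := by
  have : FiniteDimensional k W := Module.finite_of_finrank_pos (by omega)
  let b := Module.finBasisOfFinrankEq k W hW
  have hb : ∀ w, b.coord 0 w = 0 → b.coord 1 w = 0 → w = 0 := by
    intro w h0 h1
    apply b.ext_elem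
    intro i
    fin_cases i
    · simpa using h0
    · simpa using h1
  let T : Fin 2 → V →ₗ[k] Module.Dual k V := fun i => B.compr₂ (b.coord i)
  by_cases hinj : Function.Injective (T 1)
  · let E : V ≃ₗ[k] Module.Dual k V :=
      LinearEquiv.ofInjectiveOfFinrankEq (T 1) hinj Subspace.dual_finrank_eq.symm
    obtain ⟨μ, hμ⟩ := Module.End.exists_eigenvalue (E.symm.toLinearMap ∘ₗ T 0 : Module.End k V)
    obtain ⟨e, he⟩ := hμ.exists_hasEigenvector
    refine ⟨b.coord 0 - μ • b.coord 1, b.coord 1, ?_, e, he.2, ?_⟩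
    · intro w h0 h1
      refine hb w ?_ h1
      simpa [h1] using h0
    · intro y
      have h := he.apply_eq_smul
      have h' : T 0 e = μ • T 1 e := by
        have hE := congrArg E h
        rw [LinearMap.comp_apply, LinearEquiv.coe_coe, E.apply_symm_apply, map_smul] at hE
        exact hE
      have := LinearMap.congr_fun h' y
      simp only [T, LinearMap.compr₂_apply, LinearMap.smul_apply] at this
      simp [this]
  · rw [← LinearMap.ker_eq_bot, Submodule.eq_bot_iff] at hinj
    push Not at hinj
    obtain ⟨e, he, hne⟩ := hinj
    refine ⟨b.coord 1, b.coord 0, fun w h1 h0 => hb w h0 h1, e, hne, fun y => ?_⟩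
    simpa [T] using LinearMap.congr_fun (LinearMap.mem_ker.1 he) y

/-- Two quadratic forms in at least three variables have a common nontrivial zero. -/
lemma exists_common_isotropic [IsAlgClosed k] (hV : 3 ≤ Module.finrank k V)
    (hW : Module.finrank k W = 2) (B : V →ₗ[k] V →ₗ[k] W) (hB : ∀ x y, B x y = B y x) :
    ∃ e : V, e ≠ 0 ∧ B e e = 0 := by
  have : FiniteDimensional k V := Module.finite_of_finrank_pos (by omega)
  have : Nontrivial V := Module.nontrivial_of_finrank_pos (R := k) (by omega)
  obtain ⟨φ, ψ, hinj, e, he, hφ⟩ := exists_degenerate_member hW B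
  by_cases hψ : ψ (B e e) = 0
  · exact ⟨e, he, hinj _ (hφ e) hψ⟩
  let H : Submodule k V := LinearMap.ker (ψ ∘ₗ B e)
  have hH : 1 < Module.finrank k H := by
    have h1 := (ψ ∘ₗ B e).finrank_range_add_finrank_ker
    have h3 : Module.finrank k (LinearMap.range (ψ ∘ₗ B e)) ≤ 1 := by
      simpa using (LinearMap.range (ψ ∘ₗ B e)).finrank_le
    change Module.finrank k _ + Module.finrank k H = _ at h1
    omega
  obtain ⟨w, hw, hwH, hq⟩ : ∃ w : V, w ≠ 0 ∧ ψ (B e w) = 0 ∧ φ (B w w) = 0 := by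
    have : Nontrivial H := Module.nontrivial_of_finrank_pos (R := k) (by omega)
    obtain ⟨y, hy⟩ := exists_ne (0 : H)
    by_cases hyq : φ (B y y) = 0
    · exact ⟨y, by simpa using hy, y.2, hyq⟩
    obtain ⟨x, hx⟩ : ∃ x : H, ∀ t : k, t • y ≠ x := by
      by_contra! hcon
      have := finrank_le_one y (fun w => hcon w)
      omega
    obtain ⟨t, ht⟩ := exists_quadratic_root hyq (φ (B x y)) (φ (B x x))
    refine ⟨(x + t • y : H), ?_, (x + t • y).2, ?_⟩
    · intro h0
      rw [Submodule.coe_eq_zero] at h0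
      exact hx (-t) (by rw [neg_smul]; exact (eq_neg_of_add_eq_zero_left h0).symm)
    · simp only [Submodule.coe_add, Submodule.coe_smul, map_add, map_smul, LinearMap.add_apply,
        LinearMap.smul_apply, smul_eq_mul, hB (y : V) x]
      linear_combination ht
  obtain ⟨t, ht⟩ := exists_quadratic_root hψ 0 (ψ (B w w))
  refine ⟨w + t • e, ?_, hinj _ ?_ ?_⟩
  · intro h0
    have hwe : w = -(t • e) := eq_neg_of_add_eq_zero_left h0
    have ht0 : t = 0 := by
      rw [hwe] at hwH
      simpa [hψ] using hwH
    exact hw (by simpa [ht0] using hwe)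
  · simp [hB w e, hφ, hq]
  · simp only [map_add, map_smul, LinearMap.add_apply, LinearMap.smul_apply, smul_eq_mul, hB w e,
      hwH]
    linear_combination ht

/-- A pencil of symmetric bilinear forms without common kernel, such that no common isotropic
vector is mapped onto the pencil, has a member of rank one. -/
theorem exists_rank_one_member [IsAlgClosed k] (h2 : (2 : k) ≠ 0) (hV : 3 ≤ Module.finrank k V)
    (hW : Module.finrank k W = 2) (B : V →ₗ[k] V →ₗ[k] W) (hB : ∀ x y, B x y = B y x)
    (hspan : ∀ φ : Module.Dual k W, (∀ x y, φ (B x y) = 0) → φ = 0)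
    (hker : ∀ e, (∀ y, B e y = 0) → e = 0)
    (hns : ∀ e, B e e = 0 → Function.Surjective (B e) → e = 0) :
    ∃ (φ : Module.Dual k W) (c : Module.Dual k V), c ≠ 0 ∧ ∀ x y, φ (B x y) = c x * c y := by
  have : FiniteDimensional k W := Module.finite_of_finrank_pos (by omega)
  obtain ⟨e, he, hee⟩ := exists_common_isotropic hV hW B hB
  obtain ⟨f₀, hf₀⟩ : ∃ y, B e y ≠ 0 := by
    by_contra! h
    exact he (hker e h)
  have hlt : LinearMap.range (B e) < ⊤ := by
    rw [lt_top_iff_ne_top, Ne, LinearMap.range_eq_top]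
    exact fun h => he (hns e hee h)
  obtain ⟨φ, hφ0, hφ⟩ := Submodule.exists_le_ker_of_lt_top _ hlt
  replace hφ : ∀ y, φ (B e y) = 0 := fun y => hφ ⟨y, rfl⟩
  set w₀ := B e f₀
  have hkerφ : ∀ w, φ w = 0 → ∃ t : k, t • w₀ = w := by
    have h1 : Module.finrank k (LinearMap.ker φ) = 1 := by
      have h1 := φ.finrank_range_add_finrank_ker
      rw [LinearMap.range_eq_top.2 (LinearMap.surjective hφ0), finrank_top,
        Module.finrank_self] at h1
      omega
    intro w hw
    obtain ⟨t, ht⟩ := (finrank_eq_one_iff_of_nonzero' (⟨w₀, hφ f₀⟩ : LinearMap.ker φ)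
      (by simpa [Subtype.ext_iff] using hf₀)).1 h1 ⟨w, hw⟩
    exact ⟨t, congrArg Subtype.val ht⟩
  have key : ∀ v, φ (B v v) = 0 → B e v ≠ 0 → ∀ y, φ (B v y) = 0 := by
    intro v hv hev y
    obtain ⟨s, hs⟩ := hkerφ _ hv
    obtain ⟨l, hl⟩ := hkerφ _ (hφ v)
    have hl0 : l ≠ 0 := by
      rintro rfl
      exact hev (by rw [← hl, zero_smul])
    by_contra hy
    have hve : v + (-s / (2 * l)) • e = 0 := by
      apply hns
      · simp only [map_add, map_smul, LinearMap.add_apply, LinearMap.smul_apply, hB v e, ← hl,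
          ← hs, hee, smul_smul, smul_zero, add_zero, ← add_smul]
        convert zero_smul k w₀ using 2
        field_simp
        ring
      · intro w
        have hr : φ (w - (φ w / φ (B v y)) •
            B (v + (-s / (2 * l)) • e) y) = 0 := by
          simp [hφ, hy]
        obtain ⟨t, ht⟩ := hkerφ _ hr
        refine ⟨(t / l) • e + (φ w / φ (B v y)) • y, ?_⟩
        rw [map_add, map_smul, map_smul]
        refine Eq.trans ?_ (sub_eq_iff_eq_add.1 ht.symm).symm
        congr 1
        simp only [map_add, map_smul, LinearMap.add_apply, LinearMap.smul_apply, hB v e, ← hl, hee,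
          smul_smul, smul_zero, add_zero]
        rw [div_mul_cancel₀ _ hl0]
    apply hy
    rw [add_eq_zero_iff_eq_neg.1 hve]
    simp [hφ]
  obtain ⟨f, hef, hff⟩ : ∃ f, B e f ≠ 0 ∧ φ (B f f) ≠ 0 := by
    by_contra! hcon
    refine hφ0 (hspan φ fun x y => ?_)
    by_cases hx : B e x = 0
    · have h1 : B e (x + f₀) ≠ 0 := by simpa [hx] using hf₀
      have hxy := key _ (hcon _ h1) h1 y
      simpa [key _ (hcon _ hf₀) hf₀ y] using hxy
    · exact key x (hcon x hx) hx y
  have hdisc : ∀ y, φ (B f y) ^ 2 = φ (B f f) * φ (B y y) := by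
    intro y
    set a := φ (B f f) with ha
    obtain ⟨s, hs⟩ := IsAlgClosed.exists_pow_nat_eq (φ (B f y) ^ 2 - a * φ (B y y)) (n := 2)
      (by norm_num)
    have hroot : ∀ s : k, s ^ 2 = φ (B f y) ^ 2 - a * φ (B y y) →
        B e (y + ((s - φ (B f y)) / a) • f) ≠ 0 → s = 0 := by
      intro s hs hne
      have h0 := key (y + ((s - φ (B f y)) / a) • f) ?_ hne f
      · simp only [map_add, map_smul, LinearMap.add_apply, LinearMap.smul_apply, smul_eq_mul,
          hB y f, ← ha] at h0
        field_simp at h0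
        linear_combination h0
      · simp only [map_add, map_smul, LinearMap.add_apply, LinearMap.smul_apply, smul_eq_mul,
          hB y f, ← ha]
        field_simp
        linear_combination hs
    have hs0 : s = 0 := by
      by_contra hne
      have h1 : B e (y + ((s - φ (B f y)) / a) • f) = 0 := by
        by_contra h
        exact hne (hroot s hs h)
      have h2' : B e (y + ((-s - φ (B f y)) / a) • f) = 0 := by
        by_contra h
        exact hne (neg_eq_zero.1 (hroot (-s) (by rw [neg_sq, hs]) h))
      have h3 : (2 * s / a) • B e f = 0 := by
        rw [← sub_eq_zero.2 (h1.trans h2'.symm), ← map_sub, ← map_smul]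
        congr 1
        rw [add_sub_add_left_eq_sub, ← sub_smul]
        congr 1
        ring
      rcases smul_eq_zero.1 h3 with h | h
      · simp [h2, hne, hff] at h
      · exact hef h
    rw [hs0] at hs
    linear_combination -hs
  obtain ⟨s, hs⟩ := IsAlgClosed.exists_pow_nat_eq (φ (B f f)) (n := 2) (by norm_num)
  have hs0 : s ≠ 0 := by
    rintro rfl
    exact hff (by rw [← hs]; norm_num)
  refine ⟨φ, s⁻¹ • (φ ∘ₗ B f), ?_, ?_⟩
  · intro h
    have := LinearMap.congr_fun h f
    simp [hs0, hff] at this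
  · intro x y
    have hx := hdisc x
    have hy := hdisc y
    have hxy := hdisc (x + y)
    simp only [map_add, LinearMap.add_apply, hB y x] at hxy
    simp only [LinearMap.smul_apply, LinearMap.comp_apply, smul_eq_mul]
    rw [← hs] at hx hy hxy
    field_simp
    apply mul_left_cancel₀ h2
    linear_combination hx + hy - hxy

end Pencil

section QuadraticQuotient

variable {k : Type*} [Field k] {n : ℕ}

lemma finrank_homogeneousSubmodule_one :
    Module.finrank k (homogeneousSubmodule (Fin n) k 1) = n := by
  rw [homogeneousSubmodule_one_eq_span_X, finrank_span_eq_card (linearIndependent_X (Fin n) k),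
    Fintype.card_fin]

/-- Multiplication `(S/I)₁ × (S/I)₁ → (S/I)₂`, pulled back to linear forms of `S`. -/
noncomputable def linearFormMul (I : Ideal (MvPolynomial (Fin n) k)) :
    homogeneousSubmodule (Fin n) k 1 →ₗ[k] homogeneousSubmodule (Fin n) k 1 →ₗ[k]
      (homogeneousSubmodule (Fin n) k 2).map (Ideal.Quotient.mkₐ k I).toLinearMap :=
  LinearMap.mk₂ k
    (fun x y => ⟨Ideal.Quotient.mkₐ k I (x * y : MvPolynomial (Fin n) k),
      Submodule.mem_map_of_mem (f := (Ideal.Quotient.mkₐ k I).toLinearMap)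
        (IsHomogeneous.mul x.2 y.2)⟩)
    (fun x x' y => by ext; simp [add_mul])
    (fun c x y => by ext; simp)
    (fun x y y' => by ext; simp [mul_add])
    (fun c x y => by ext; simp)

lemma coe_linearFormMul (I : Ideal (MvPolynomial (Fin n) k))
    (x y : homogeneousSubmodule (Fin n) k 1) :
    (linearFormMul I x y : MvPolynomial (Fin n) k ⧸ I) =
      Ideal.Quotient.mk I (x * y : MvPolynomial (Fin n) k) := rfl

lemma linearFormMul_eq_zero_iff (I : Ideal (MvPolynomial (Fin n) k))
    (x y : homogeneousSubmodule (Fin n) k 1) :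
    linearFormMul I x y = 0 ↔ (x * y : MvPolynomial (Fin n) k) ∈ I := by
  rw [← Ideal.Quotient.eq_zero_iff_mem, ← coe_linearFormMul, ZeroMemClass.coe_eq_zero]

/-- Quadratic forms satisfy any linear condition satisfied by products of linear forms. -/
lemma homogeneousSubmodule_two_induction {p : MvPolynomial (Fin n) k → Prop}
    (hmul : ∀ x y : homogeneousSubmodule (Fin n) k 1, p (x * y))
    (hadd : ∀ f g, p f → p g → p (f + g)) {f : MvPolynomial (Fin n) k} (hf : f.IsHomogeneous 2) :
    p f := by
  have h : f ∈ homogeneousSubmodule (Fin n) k 1 * homogeneousSubmodule (Fin n) k 1 := by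
    rw [← pow_two, homogeneousSubmodule_one_pow]
    exact hf
  exact Submodule.mul_induction_on h (fun x hx y hy => hmul ⟨x, hx⟩ ⟨y, hy⟩) hadd

end QuadraticQuotient

theorem stmt8 (k : Type*) [Field k] [IsAlgClosed k] (hchar : ringChar k ≠ 2)
    (n : ℕ) (hn : 3 ≤ n) (I : Ideal (MvPolynomial (Fin n) k))
    (hquad : ∃ Q : Set (MvPolynomial (Fin n) k),
      (∀ q ∈ Q, q.IsHomogeneous 2) ∧ I = Ideal.span Q)
    (hdim : hilbFn k n I 2 = 2)
    -- `S/I` is not a trivial fiber extension: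
    (hTFE : ¬ ∃ ℓ : MvPolynomial (Fin n) k, ℓ.IsHomogeneous 1 ∧ ℓ ≠ 0 ∧
      ∀ g : MvPolynomial (Fin n) k, g.IsHomogeneous 1 → ℓ * g ∈ I)
    -- there is no null-square linear form `ℓ` with `ℓ̄ ⬝ (S/I)₁ = (S/I)₂`:
    (hns : ¬ ∃ ℓ : MvPolynomial (Fin n) k, ℓ.IsHomogeneous 1 ∧ ℓ ≠ 0 ∧
      ℓ ^ 2 ∈ I ∧
      ∀ q : MvPolynomial (Fin n) k, q.IsHomogeneous 2 →
        ∃ g : MvPolynomial (Fin n) k, g.IsHomogeneous 1 ∧ q - ℓ * g ∈ I) :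
    ∃ c : Fin n → k, c ≠ 0 ∧ ∀ f ∈ I, MvPolynomial.eval c f = 0 := by
  have h2 : (2 : k) ≠ 0 := Ring.two_ne_zero hchar
  let π : MvPolynomial (Fin n) k →ₗ[k] MvPolynomial (Fin n) k ⧸ I :=
    (Ideal.Quotient.mkₐ k I).toLinearMap
  let W := (homogeneousSubmodule (Fin n) k 2).map π
  let π₂ : homogeneousSubmodule (Fin n) k 2 →ₗ[k] W := π.submoduleMap _
  have hπ₂ : ∀ x y : homogeneousSubmodule (Fin n) k 1,
      linearFormMul I x y = π₂ ⟨x * y, IsHomogeneous.mul x.2 y.2⟩ := fun _ _ => rfl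
  obtain ⟨φ, c, hc, hφ⟩ := exists_rank_one_member h2
    (by rw [finrank_homogeneousSubmodule_one]; exact hn) hdim (linearFormMul I)
    (fun x y => Subtype.ext <| by rw [coe_linearFormMul, coe_linearFormMul, mul_comm])
    (fun φ hφ => by
      ext ⟨w, f, hf, rfl⟩
      suffices ∃ hf : f.IsHomogeneous 2, φ (π₂ ⟨f, hf⟩) = 0 from this.2
      refine homogeneousSubmodule_two_induction
        (p := fun f => ∃ hf : f.IsHomogeneous 2, φ (π₂ ⟨f, hf⟩) = 0)
        (fun x y => ⟨IsHomogeneous.mul x.2 y.2, hφ x y⟩) ?_ hf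
      rintro f g ⟨hf, hf0⟩ ⟨hg, hg0⟩
      refine ⟨hf.add hg, ?_⟩
      have := congrArg₂ (· + ·) hf0 hg0
      rw [add_zero, ← map_add, ← map_add] at this
      exact this)
    (fun e he => by
      by_contra hne
      exact hTFE ⟨e, e.2, by simpa using hne,
        fun g hg => (linearFormMul_eq_zero_iff I e ⟨g, hg⟩).1 (he ⟨g, hg⟩)⟩)
    (fun e he hsurj => by
      by_contra hne
      refine hns ⟨e, e.2, by simpa using hne, ?_, fun q hq => ?_⟩
      · rw [pow_two]
        exact (linearFormMul_eq_zero_iff I e e).1 he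
      · obtain ⟨g, hg⟩ := hsurj (π₂ ⟨q, hq⟩)
        exact ⟨g, g.2, Ideal.Quotient.eq.1 (congrArg Subtype.val hg).symm⟩)
  let X' : Fin n → homogeneousSubmodule (Fin n) k 1 := fun i => ⟨X i, isHomogeneous_X k i⟩
  have heval : ∀ x : homogeneousSubmodule (Fin n) k 1,
      eval (fun i => c (X' i)) (x : MvPolynomial (Fin n) k) = c x := by
    rintro ⟨x, hx⟩
    have hx' : x ∈ Submodule.span k (Set.range X) := by
      rwa [← homogeneousSubmodule_one_eq_span_X]
    suffices ∃ hx : x ∈ homogeneousSubmodule (Fin n) k 1,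
        eval (fun i => c (X' i)) x = c ⟨x, hx⟩ from this.2
    clear hx
    induction hx' using Submodule.span_induction with
    | mem x h =>
      obtain ⟨i, rfl⟩ := h
      exact ⟨isHomogeneous_X k i, by simp [X']⟩
    | zero => exact ⟨zero_mem _, by rw [map_zero]; exact (map_zero c).symm⟩
    | add x y _ _ ihx ihy =>
      obtain ⟨hx, hx'⟩ := ihx
      obtain ⟨hy, hy'⟩ := ihy
      exact ⟨add_mem hx hy, by rw [map_add, hx', hy', ← map_add]; rfl⟩
    | smul a x _ ihx =>
      obtain ⟨hx, hx'⟩ := ihx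
      exact ⟨Submodule.smul_mem _ a hx, by rw [smul_eval, hx', ← smul_eq_mul, ← map_smul]; rfl⟩
  have hquadeval : ∀ f : MvPolynomial (Fin n) k, f.IsHomogeneous 2 →
      ∃ hf : f.IsHomogeneous 2, eval (fun i => c (X' i)) f = φ (π₂ ⟨f, hf⟩) := by
    intro f hf
    refine homogeneousSubmodule_two_induction
      (p := fun f => ∃ hf : f.IsHomogeneous 2, eval (fun i => c (X' i)) f = φ (π₂ ⟨f, hf⟩))
      (fun x y => ⟨IsHomogeneous.mul x.2 y.2, ?_⟩) ?_ hf
    · rw [← hπ₂, hφ, map_mul, heval, heval]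
    · rintro f g ⟨hf, hf0⟩ ⟨hg, hg0⟩
      refine ⟨hf.add hg, ?_⟩
      rw [map_add, hf0, hg0, ← map_add, ← map_add]
      rfl
  refine ⟨fun i => c (X' i), ?_, ?_⟩
  · intro h0
    apply hc
    ext x
    rw [← heval x, h0, LinearMap.zero_apply]
    rw [eval_zero, constantCoeff_eq]
    exact IsHomogeneous.coeff_eq_zero x.2 (by simp)
  · obtain ⟨Q, hQ, hIQ⟩ := hquad
    have hle : I ≤ RingHom.ker (eval fun i => c (X' i)) := by
      rw [hIQ, Ideal.span_le]
      intro q hq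
      obtain ⟨hq2, h⟩ := hquadeval q (hQ q hq)
      have hqI : q ∈ I := hIQ ▸ Ideal.subset_span hq
      have : π₂ ⟨q, hq2⟩ = 0 := Subtype.ext (Ideal.Quotient.eq_zero_iff_mem.2 hqI)
      rw [SetLike.mem_coe, RingHom.mem_ker, h, this, map_zero]
    exact fun f hf => hle hf
end

section
/- Let k be an algebraically closed field of characteristic different from 2, let S = k[x,y,z,t], and let a, b, c, d, e, f, g ∈ k. Let I be the ideal (y², zt, xy, xz − e·yt, t² + 2a·yz + 2b·yt, z² + 2c·yz + 2d·yt, xt − f·yt − g·yz). Then there exist two k-linearly independent linear forms ℓ₁, ℓ₂ ∈ S₁ with ℓ₁² ∈ I and ℓ₂² ∈ I. -/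
open MvPolynomial

/-- A zero of the binary cubic `d γ³ - c γ² δ + b γ δ² - a δ³`, with the parameter `β` that cancels
the mixed terms of the square of `β y + γ z + δ t`. -/
theorem exists_ne_zero_mul_eq {k : Type*} [Field k] [IsAlgClosed k] (a b c d : k) :
    ∃ β γ δ : k, (γ ≠ 0 ∨ δ ≠ 0) ∧ β * γ = c * γ ^ 2 + a * δ ^ 2 ∧
      β * δ = d * γ ^ 2 + b * δ ^ 2 := by
  by_cases hd : d = 0
  · exact ⟨c, 1, 0, Or.inl one_ne_zero, by ring, by rw [hd]; ring⟩
  · obtain ⟨r, hr⟩ := IsAlgClosed.exists_root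
      (Polynomial.C d * Polynomial.X ^ 3 + Polynomial.C (-c) * Polynomial.X ^ 2 +
        Polynomial.C b * Polynomial.X + Polynomial.C (-a))
      (by rw [Polynomial.degree_cubic hd]; decide)
    simp only [Polynomial.IsRoot.def, Polynomial.eval_add, Polynomial.eval_mul,
      Polynomial.eval_pow, Polynomial.eval_C, Polynomial.eval_X] at hr
    exact ⟨d * r ^ 2 + b, r, 1, Or.inr one_ne_zero, by linear_combination hr, by ring⟩

theorem linearIndependent_X_one_pair {k : Type*} [Field k] {β γ δ : k} (h : γ ≠ 0 ∨ δ ≠ 0) :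
    LinearIndependent k
      ![(X 1 : MvPolynomial (Fin 4) k), C β * X 1 + C γ * X 2 + C δ * X 3] := by
  rw [LinearIndependent.pair_iff]
  intro s u hsu
  have key : ∀ v : Fin 4 → k, s * v 1 + u * (β * v 1 + γ * v 2 + δ * v 3) = 0 := fun v => by
    simpa [smul_eval, mul_add] using congrArg (eval v) hsu
  have hu : u = 0 := by
    rcases h with h | h
    · simpa [h] using key ![0, 0, 1, 0]
    · simpa [h] using key ![0, 0, 0, 1]
  exact ⟨by simpa [hu] using key ![0, 1, 0, 0], hu⟩

theorem stmt10 (k : Type*) [Field k] [IsAlgClosed k] (hchar : ringChar k ≠ 2)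
    (a b c d e f g : k) :
    letI x : MvPolynomial (Fin 4) k := X 0
    letI y : MvPolynomial (Fin 4) k := X 1
    letI z : MvPolynomial (Fin 4) k := X 2
    letI t : MvPolynomial (Fin 4) k := X 3
    letI I : Ideal (MvPolynomial (Fin 4) k) :=
      Ideal.span {y ^ 2, z * t, x * y,
        x * z - C e * (y * t),
        t ^ 2 + 2 • (C a * (y * z)) + 2 • (C b * (y * t)),
        z ^ 2 + 2 • (C c * (y * z)) + 2 • (C d * (y * t)),
        x * t - C f * (y * t) - C g * (y * z)}
    ∃ ℓ₁ ℓ₂ : MvPolynomial (Fin 4) k,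
      ℓ₁.IsHomogeneous 1 ∧ ℓ₂.IsHomogeneous 1 ∧
      LinearIndependent k ![ℓ₁, ℓ₂] ∧ ℓ₁ ^ 2 ∈ I ∧ ℓ₂ ^ 2 ∈ I := by
  obtain ⟨β, γ, δ, hne, hz, ht⟩ := exists_ne_zero_mul_eq a b c d
  refine ⟨X 1, C β * X 1 + C γ * X 2 + C δ * X 3, isHomogeneous_X _ _, ?_,
    linearIndependent_X_one_pair hne, Ideal.subset_span (by simp), ?_⟩
  · exact ((isHomogeneous_C_mul_X _ _).add (isHomogeneous_C_mul_X _ _)).add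
      (isHomogeneous_C_mul_X _ _)
  · have hz' := congrArg (C (σ := Fin 4)) hz
    have ht' := congrArg (C (σ := Fin 4)) ht
    simp only [C_mul, C_add, C_pow] at hz' ht'
    have hsq : (C β * X 1 + C γ * X 2 + C δ * X 3 : MvPolynomial (Fin 4) k) ^ 2 =
        C β ^ 2 * X 1 ^ 2 + 2 * C γ * C δ * (X 2 * X 3) +
        C δ ^ 2 * (X 3 ^ 2 + 2 • (C a * (X 1 * X 2)) + 2 • (C b * (X 1 * X 3))) +
        C γ ^ 2 * (X 2 ^ 2 + 2 • (C c * (X 1 * X 2)) + 2 • (C d * (X 1 * X 3))) := by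
      simp only [nsmul_eq_mul, Nat.cast_ofNat]
      linear_combination 2 * X 1 * X 2 * hz' + 2 * X 1 * X 3 * ht'
    rw [hsq]
    refine add_mem (add_mem (add_mem ?_ ?_) ?_) ?_ <;>
      exact Ideal.mul_mem_left _ _ (Ideal.subset_span (by simp))
end

section
/- Let k be a field and S = k[x₁,…,xₙ]. Call an ideal I ⊆ S unital binomial if it can be generated by a set of elements each of which is either a monomial or a difference of two monomials. If I is a unital binomial ideal and m is a monomial of S, then the colon ideal I : (m) = { f ∈ S : f·m ∈ I } is again a unital binomial ideal. -/
open MvPolynomial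

/-- An ideal of `k[x₁,…,xₙ]` is *unital binomial* if it can be generated by a set
of elements each of which is either a monomial or a difference of two monomials. -/
def IsUnitalBinomial {k : Type*} [Field k] {n : ℕ}
    (I : Ideal (MvPolynomial (Fin n) k)) : Prop :=
  ∃ G : Set (MvPolynomial (Fin n) k), I = Ideal.span G ∧
    ∀ g ∈ G, (∃ s : Fin n →₀ ℕ, g = MvPolynomial.monomial s 1) ∨
      (∃ s t : Fin n →₀ ℕ,
        g = MvPolynomial.monomial s 1 - MvPolynomial.monomial t 1)

/-- A linear map on polynomials vanishes on `Ideal.span G` as soon as it vanishes on all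
monomial multiples of the elements of `G`. -/
lemma MvPolynomial.map_eq_zero_of_mem_span {σ R M : Type*} [CommRing R] [AddCommGroup M]
    [Module R M] (θ : MvPolynomial σ R →ₗ[R] M) (G : Set (MvPolynomial σ R))
    (hθ : ∀ g ∈ G, ∀ w : σ →₀ ℕ, θ (monomial w 1 * g) = 0)
    {f : MvPolynomial σ R} (hf : f ∈ Ideal.span G) : θ f = 0 := by
  suffices h : ∀ a : MvPolynomial σ R, θ (a * f) = 0 by simpa using h 1
  induction hf using Submodule.span_induction with
  | mem g hg =>
    intro a
    induction a using MvPolynomial.induction_on' with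
    | monomial w c =>
      rw [show monomial w c = c • monomial w (1 : R) by simp [smul_monomial],
        smul_mul_assoc, map_smul, hθ g hg, smul_zero]
    | add p q hp hq => rw [add_mul, map_add, hp, hq, add_zero]
  | zero => simp
  | add x y _ _ hx hy => intro a; rw [mul_add, map_add, hx, hy, add_zero]
  | smul b x _ hx => intro a; rw [smul_eq_mul, ← mul_assoc, hx]

/-- If `I` is generated by monomials and differences of monomials, then a linear map which
kills the monomials in `I` and identifies monomials congruent modulo `I` vanishes on `I`. -/
lemma IsUnitalBinomial.map_eq_zero {k M : Type*} [Field k] {n : ℕ} [AddCommGroup M] [Module k M]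
    {I : Ideal (MvPolynomial (Fin n) k)} (hI : IsUnitalBinomial I)
    (θ : MvPolynomial (Fin n) k →ₗ[k] M)
    (hmon : ∀ u : Fin n →₀ ℕ, monomial u 1 ∈ I → θ (monomial u 1) = 0)
    (hdiff : ∀ u v : Fin n →₀ ℕ, monomial u 1 - monomial v 1 ∈ I →
      θ (monomial u 1) = θ (monomial v 1))
    {f : MvPolynomial (Fin n) k} (hf : f ∈ I) : θ f = 0 := by
  obtain ⟨G, rfl, hG⟩ := hI
  refine map_eq_zero_of_mem_span θ G (fun g hg w => ?_) hf
  have hmem := Ideal.mul_mem_left _ (monomial w (1 : k)) (Ideal.subset_span hg)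
  obtain ⟨u, rfl⟩ | ⟨u, v, rfl⟩ := hG g hg
  · rw [monomial_mul, one_mul] at hmem ⊢
    exact hmon _ hmem
  · rw [mul_sub, monomial_mul, monomial_mul, one_mul] at hmem ⊢
    rw [map_sub, hdiff _ _ hmem, sub_self]

open Classical in
theorem IsUnitalBinomial.mem_of_mul_monomial_mem {k : Type*} [Field k] {n : ℕ}
    {I J : Ideal (MvPolynomial (Fin n) k)} (hI : IsUnitalBinomial I) (s : Fin n →₀ ℕ)
    (hmon : ∀ u : Fin n →₀ ℕ, monomial (u + s) 1 ∈ I → monomial u 1 ∈ J)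
    (hdiff : ∀ u v : Fin n →₀ ℕ, monomial (u + s) 1 - monomial (v + s) 1 ∈ I →
      monomial u 1 - monomial v 1 ∈ J)
    {f : MvPolynomial (Fin n) k} (hf : f * monomial s 1 ∈ I) : f ∈ J := by
  let P (w u : Fin n →₀ ℕ) : Prop := monomial (u + s) (1 : k) - monomial w 1 ∈ I
  let F (w : Fin n →₀ ℕ) : MvPolynomial (Fin n) k ⧸ J :=
    if h : ∃ u, P w u then Ideal.Quotient.mk J (monomial h.choose 1) else 0
  have hF {w u} (h : P w u) : F w = Ideal.Quotient.mk J (monomial u 1) := by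
    have hex : ∃ u, P w u := ⟨u, h⟩
    simp only [F, dif_pos hex]
    refine Ideal.Quotient.eq.2 (hdiff _ _ ?_)
    simpa using I.sub_mem hex.choose_spec h
  let θ := (basisMonomials (Fin n) k).constr k F
  have hθ (w : Fin n →₀ ℕ) : θ (monomial w 1) = F w := by
    simpa using (basisMonomials (Fin n) k).constr_basis k F w
  have hkill : θ (f * monomial s 1) = 0 := by
    refine hI.map_eq_zero θ (fun w hw => ?_) (fun w w' hw => ?_) hf
    · rw [hθ]
      by_cases hex : ∃ u, P w u
      · obtain ⟨u, hu⟩ := hex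
        rw [hF hu]
        exact Ideal.Quotient.eq_zero_iff_mem.2 (hmon u (by simpa using I.add_mem hu hw))
      · exact dif_neg hex
    · rw [hθ, hθ]
      by_cases hex : ∃ u, P w u
      · obtain ⟨u, hu⟩ := hex
        have hu' : P w' u := by simpa [P] using I.add_mem hu hw
        rw [hF hu, hF hu']
      · have hex' : ¬ ∃ u, P w' u := fun ⟨u, hu⟩ =>
          hex ⟨u, by simpa [P] using I.sub_mem hu hw⟩
        simp only [F, dif_neg hex, dif_neg hex']
  have hlift : θ ∘ₗ LinearMap.mulRight k (monomial s 1) = (Ideal.Quotient.mkₐ k J).toLinearMap := by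
    refine (basisMonomials (Fin n) k).ext fun u => ?_
    have hu : P (u + s) u := by simp [P]
    simp [monomial_mul, hθ, hF hu]
  rw [← Ideal.Quotient.eq_zero_iff_mem, ← hkill]
  exact (LinearMap.congr_fun hlift f).symm

theorem stmt11 (k : Type*) [Field k] (n : ℕ)
    (I : Ideal (MvPolynomial (Fin n) k)) (hI : IsUnitalBinomial I)
    (s : Fin n →₀ ℕ) :
    ∃ G : Set (MvPolynomial (Fin n) k),
      (∀ g ∈ G, (∃ u : Fin n →₀ ℕ, g = MvPolynomial.monomial u 1) ∨
        (∃ u v : Fin n →₀ ℕ,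
          g = MvPolynomial.monomial u 1 - MvPolynomial.monomial v 1)) ∧
      ∀ f : MvPolynomial (Fin n) k,
        f ∈ Ideal.span G ↔ f * MvPolynomial.monomial s 1 ∈ I := by
  refine ⟨{g | ((∃ u : Fin n →₀ ℕ, g = monomial u 1) ∨
    (∃ u v : Fin n →₀ ℕ, g = monomial u 1 - monomial v 1)) ∧ g * monomial s 1 ∈ I},
    fun g hg => hg.1, fun f => ⟨fun hf => ?_, fun hf => ?_⟩⟩
  · refine Submodule.mem_colon_singleton.1 (Ideal.span_le.2 (fun g hg => ?_) hf)
    exact Submodule.mem_colon_singleton.2 hg.2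
  · refine hI.mem_of_mul_monomial_mem s (fun u hu => ?_) (fun u v huv => ?_) hf
    · exact Ideal.subset_span ⟨.inl ⟨u, rfl⟩, by simpa [monomial_mul] using hu⟩
    · exact Ideal.subset_span ⟨.inr ⟨u, v, rfl⟩, by simpa [sub_mul, monomial_mul] using huv⟩
end

section
/- Let k be a field of characteristic different from 2, let S = k[x, y₁, y₂, t], and let I = (t², y₂t, xy₁, xy₂, y₁² − xt, y₁y₂, y₂² − y₁t). Then every nonzero linear form ℓ ∈ S₁ with ℓ² ∈ I is a scalar multiple of t; that is, S/I has exactly one null-square linear form up to scalar. -/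
open MvPolynomial

/-- A linear form is the linear combination of the variables given by its coefficients. -/
lemma MvPolynomial.IsHomogeneous.exists_eq_sum_C_mul_X {σ R : Type*} [Fintype σ] [CommSemiring R]
    {p : MvPolynomial σ R} (hp : p.IsHomogeneous 1) :
    ∃ c : σ → R, p = ∑ i, C (c i) * X i := by
  have h : p ∈ Submodule.span R (Set.range (X : σ → MvPolynomial σ R)) := by
    rw [← homogeneousSubmodule_one_eq_span_X]
    exact hp
  obtain ⟨c, rfl⟩ := (Submodule.mem_span_range_iff_exists_fun R).1 h
  exact ⟨c, by simp only [smul_eq_C_mul]⟩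

theorem stmt12 (k : Type*) [Field k] (hchar : ringChar k ≠ 2) :
    letI x : MvPolynomial (Fin 4) k := X 0
    letI y₁ : MvPolynomial (Fin 4) k := X 1
    letI y₂ : MvPolynomial (Fin 4) k := X 2
    letI t : MvPolynomial (Fin 4) k := X 3
    letI I : Ideal (MvPolynomial (Fin 4) k) :=
      Ideal.span {t ^ 2, y₂ * t, x * y₁, x * y₂,
        y₁ ^ 2 - x * t, y₁ * y₂, y₂ ^ 2 - y₁ * t}
    ∀ ℓ : MvPolynomial (Fin 4) k, ℓ.IsHomogeneous 1 → ℓ ≠ 0 → ℓ ^ 2 ∈ I →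
      ∃ a : k, ℓ = C a * t := by
  intro ℓ hℓ _ hI
  have h2 : (2 : k) ≠ 0 := Ring.two_ne_zero hchar
  obtain ⟨c, rfl⟩ := hℓ.exists_eq_sum_C_mul_X
  simp only [Ideal.mem_span_insert, Ideal.mem_span_singleton'] at hI
  obtain ⟨p₁, _, ⟨p₂, _, ⟨p₃, _, ⟨p₄, _, ⟨p₅, _, ⟨p₆, _, ⟨p₇, rfl⟩, rfl⟩, rfl⟩, rfl⟩,
    rfl⟩, rfl⟩, h⟩ := hI
  -- The second partial derivatives at the origin read off the coefficients of degree two.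
  have key (i j : Fin 4) := congrArg (fun f => constantCoeff (pderiv i (pderiv j f))) h
  have h00 := key 0 0
  have h03 := key 0 3
  have h11 := key 1 1
  have h13 := key 1 3
  have h22 := key 2 2
  simp [Fin.sum_univ_four, pow_two, pderiv_X] at h00 h03 h11 h13 h22
  have hc0 : c 0 = 0 := by grind
  have hc1 : c 1 = 0 := by grind
  have hc2 : c 2 = 0 := by grind
  exact ⟨c 3, by simp [Fin.sum_univ_four, hc0, hc1, hc2]⟩
end

section
/- Let k be a field of characteristic different from 2, let S = k[x, y, t₁, t₂], and let I = (xy − t₁², xt₁, xt₂ − y², yt₁, yt₂, t₁t₂, t₂²). Then every nonzero linear form ℓ ∈ S₁ with ℓ² ∈ I is a scalar multiple of t₂; that is, S/I has exactly one null-square linear form up to scalar. -/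
open MvPolynomial

/-- If all elements of `s` vanish to order two at the origin and are killed there by the
operator `2 ∂ᵢ ∂ⱼ + ∂ₗ²`, then the same operator kills the whole ideal `s` spans. -/
lemma MvPolynomial.two_mul_pderiv_pderiv_add_eq_zero_of_mem_span {σ k : Type*} [CommRing k]
    (i j l : σ) {s : Set (MvPolynomial σ k)}
    (h₀ : ∀ p ∈ s, constantCoeff p = 0) (h₁ : ∀ p ∈ s, ∀ m, constantCoeff (pderiv m p) = 0)
    (h₂ : ∀ p ∈ s, 2 * constantCoeff (pderiv i (pderiv j p)) +
      constantCoeff (pderiv l (pderiv l p)) = 0)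
    {p : MvPolynomial σ k} (hp : p ∈ Ideal.span s) :
    2 * constantCoeff (pderiv i (pderiv j p)) + constantCoeff (pderiv l (pderiv l p)) = 0 := by
  suffices constantCoeff p = 0 ∧ (∀ m, constantCoeff (pderiv m p) = 0) ∧
      2 * constantCoeff (pderiv i (pderiv j p)) + constantCoeff (pderiv l (pderiv l p)) = 0 from
    this.2.2
  induction hp using Submodule.span_induction with
  | mem p hp => exact ⟨h₀ p hp, h₁ p hp, h₂ p hp⟩
  | zero => simp
  | add p q _ _ hp hq =>
    refine ⟨by simp [hp.1, hq.1], fun m ↦ by simp [hp.2.1, hq.2.1], ?_⟩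
    simp only [map_add]
    linear_combination hp.2.2 + hq.2.2
  | smul r p _ hp =>
    obtain ⟨hp₀, hp₁, hp₂⟩ := hp
    refine ⟨by simp [hp₀], fun m ↦ by simp [hp₀, hp₁], ?_⟩
    simp only [smul_eq_mul, Derivation.leibniz, map_add, map_mul, hp₀, hp₁]
    linear_combination constantCoeff r * hp₂

lemma MvPolynomial.IsHomogeneous.eq_sum_C_mul_X {σ k : Type*} [Fintype σ] [CommRing k]
    {p : MvPolynomial σ k} (hp : p.IsHomogeneous 1) :
    ∃ a : σ → k, p = ∑ i, C (a i) * X i := by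
  have hc (i : σ) : pderiv i p = C (coeff 0 (pderiv i p)) :=
    totalDegree_eq_zero_iff_eq_C.mp (Nat.le_zero.mp (hp.pderiv (i := i)).totalDegree_le)
  refine ⟨fun i ↦ coeff 0 (pderiv i p), ?_⟩
  simp_rw [← hc]
  simpa [mul_comm] using hp.sum_X_mul_pderiv.symm

theorem stmt14 (k : Type*) [Field k] (hchar : ringChar k ≠ 2) :
    letI x : MvPolynomial (Fin 4) k := X 0
    letI y : MvPolynomial (Fin 4) k := X 1
    letI t₁ : MvPolynomial (Fin 4) k := X 2
    letI t₂ : MvPolynomial (Fin 4) k := X 3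
    letI I : Ideal (MvPolynomial (Fin 4) k) :=
      Ideal.span {x * y - t₁ ^ 2, x * t₁, x * t₂ - y ^ 2,
        y * t₁, y * t₂, t₁ * t₂, t₂ ^ 2}
    ∀ ℓ : MvPolynomial (Fin 4) k, ℓ.IsHomogeneous 1 → ℓ ≠ 0 → ℓ ^ 2 ∈ I →
      ∃ a : k, ℓ = C a * t₂ := by
  intro ℓ hℓ _ hmem
  have h2 : (2 : k) ≠ 0 := Ring.two_ne_zero hchar
  obtain ⟨a, rfl⟩ := hℓ.eq_sum_C_mul_X
  have ha₀ : a 0 = 0 := by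
    have h := (Ideal.span_le (I := RingHom.ker (eval (Pi.single (0 : Fin 4) (1 : k))))).mpr
      (by rintro p (rfl | rfl | rfl | rfl | rfl | rfl | rfl) <;> simp [RingHom.mem_ker]) hmem
    simpa [RingHom.mem_ker, Fin.sum_univ_four] using h
  have ha₂ : a 2 = 0 := by
    have h := two_mul_pderiv_pderiv_add_eq_zero_of_mem_span 0 1 2
      (by rintro p (rfl | rfl | rfl | rfl | rfl | rfl | rfl) <;> simp)
      (by rintro p (rfl | rfl | rfl | rfl | rfl | rfl | rfl) m <;> simp)
      (by rintro p (rfl | rfl | rfl | rfl | rfl | rfl | rfl) <;>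
          simp [pderiv_X, map_ofNat constantCoeff]) hmem
    simpa [pderiv_X, Fin.sum_univ_four, map_ofNat constantCoeff, ha₀, h2] using h
  have ha₁ : a 1 = 0 := by
    have h := two_mul_pderiv_pderiv_add_eq_zero_of_mem_span 0 3 1
      (by rintro p (rfl | rfl | rfl | rfl | rfl | rfl | rfl) <;> simp)
      (by rintro p (rfl | rfl | rfl | rfl | rfl | rfl | rfl) m <;> simp)
      (by rintro p (rfl | rfl | rfl | rfl | rfl | rfl | rfl) <;>
          simp [pderiv_X, map_ofNat constantCoeff]) hmem
    simpa [pderiv_X, Fin.sum_univ_four, map_ofNat constantCoeff, ha₀, h2] using h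
  exact ⟨a 3, by simp [Fin.sum_univ_four, ha₀, ha₁, ha₂]⟩
end

section
/- Let k be an algebraically closed field of characteristic different from 2, let S = k[x₁,…,xₙ] with n ≥ 4, and let I ⊆ S be an ideal generated by homogeneous polynomials of degree 2 with dim_k (S/I)₂ = 3. Suppose S/I is not a trivial fiber extension, i.e., there is no nonzero linear form ℓ ∈ S₁ with ℓ·S₁ ⊆ I, and suppose the elements of I have at least one common nonzero zero in kⁿ. Then there exist nonzero points c₁, c₂ ∈ kⁿ such that every common zero of I in kⁿ is a scalar multiple of c₁ or of c₂; in other words, the projective zero set of I consists of one or two points. -/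
open MvPolynomial

/-- The linear form on `kⁿ` given by `f`, as a homogeneous polynomial. -/
noncomputable def linearFormPoly {k : Type*} [Field k] {n : ℕ}
    (f : (Fin n → k) →ₗ[k] k) : MvPolynomial (Fin n) k :=
  ∑ i, C (f (Pi.single i 1)) * X i

theorem linearFormPoly_isHomogeneous {k : Type*} [Field k] {n : ℕ}
    (f : (Fin n → k) →ₗ[k] k) : (linearFormPoly f).IsHomogeneous 1 :=
  IsHomogeneous.sum _ _ _ fun i _ => by
    simpa using (isHomogeneous_C (Fin n) (f (Pi.single i 1))).mul (isHomogeneous_X k i)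

theorem eval_linearFormPoly {k : Type*} [Field k] {n : ℕ}
    (f : (Fin n → k) →ₗ[k] k) (c : Fin n → k) : eval c (linearFormPoly f) = f c := by
  conv_rhs => rw [LinearMap.pi_apply_eq_sum_univ f c]
  simp only [linearFormPoly, map_sum, map_mul, eval_C, eval_X, smul_eq_mul]
  refine Finset.sum_congr rfl fun i _ => ?_
  rw [mul_comm]
  congr 2
  ext j
  simp [Pi.single_apply, eq_comm]

/-- A point of a triple of pairwise non-proportional points is separated from the other two
by a quadric. -/
theorem exists_quadric_separating {k : Type*} [Field k] {n : ℕ} (c : Fin 3 → Fin n → k)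
    (hc : ∀ i j, i ≠ j → c i ∉ Submodule.span k {c j}) (i : Fin 3) :
    ∃ q : MvPolynomial (Fin n) k, q.IsHomogeneous 2 ∧ eval (c i) q ≠ 0 ∧
      ∀ j, j ≠ i → eval (c j) q = 0 := by
  have h : ∀ j, ∃ f : (Fin n → k) →ₗ[k] k, i ≠ j → f (c i) ≠ 0 ∧ f (c j) = 0 := by
    intro j
    by_cases hij : i = j
    · exact ⟨0, fun h => absurd hij h⟩
    · obtain ⟨f, hf, hle⟩ := Submodule.exists_le_ker_of_notMem (hc i j hij)
      exact ⟨f, fun _ => ⟨hf, hle (Submodule.mem_span_singleton_self _)⟩⟩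
  choose f hf using h
  refine ⟨∏ j ∈ Finset.univ.erase i, linearFormPoly (f j), ?_, ?_, ?_⟩
  · simpa using IsHomogeneous.prod (Finset.univ.erase i) (fun j => linearFormPoly (f j))
      (fun _ => 1) fun j _ => linearFormPoly_isHomogeneous _
  · rw [map_prod, Finset.prod_ne_zero_iff]
    intro j hj
    rw [eval_linearFormPoly]
    exact (hf j (Finset.ne_of_mem_erase hj).symm).1
  · intro j hj
    rw [map_prod]
    refine Finset.prod_eq_zero (Finset.mem_erase.2 ⟨hj, Finset.mem_univ j⟩) ?_
    rw [eval_linearFormPoly]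
    exact (hf j hj.symm).2

/-- If `dim (S/I)₂ = 3` and `I` vanishes at three pairwise non-proportional points, then a quadric
vanishing at these points lies in `I`. -/
theorem mem_of_eval_eq_zero_of_hilbFn_eq_three {k : Type*} [Field k] {n : ℕ}
    {I : Ideal (MvPolynomial (Fin n) k)} (hdim : hilbFn k n I 2 = 3) (c : Fin 3 → Fin n → k)
    (hc : ∀ i j, i ≠ j → c i ∉ Submodule.span k {c j})
    (hI : ∀ i, ∀ f ∈ I, eval (c i) f = 0) {q : MvPolynomial (Fin n) k}
    (hq : q.IsHomogeneous 2) (hqc : ∀ i, eval (c i) q = 0) : q ∈ I := by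
  let V := (homogeneousSubmodule (Fin n) k 2).map (Ideal.Quotient.mkₐ k I).toLinearMap
  have hV : Module.finrank k V = 3 := hdim
  have : Module.Finite k V := Module.finite_of_finrank_pos (by omega)
  let L : (MvPolynomial (Fin n) k ⧸ I) →ₗ[k] Fin 3 → k := LinearMap.pi fun i =>
    (Ideal.Quotient.liftₐ I (aeval (c i)) fun f hf => by
      simpa [aeval_eq_eval] using hI i f hf).toLinearMap
  have hL : ∀ f i, L (Ideal.Quotient.mkₐ k I f) i = eval (c i) f := by
    intro f i
    simp [L]
  have hmem : ∀ f : MvPolynomial (Fin n) k, f.IsHomogeneous 2 →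
      Ideal.Quotient.mkₐ k I f ∈ V := fun f hf =>
    Submodule.mem_map.2 ⟨f, (mem_homogeneousSubmodule _ _).2 hf, rfl⟩
  have hsurj : Function.Surjective (L.domRestrict V) := by
    choose p hp hp_ne hp_zero using exists_quadric_separating c hc
    intro y
    refine ⟨∑ i, (y i / eval (c i) (p i)) • ⟨_, hmem (p i) (hp i)⟩, ?_⟩
    ext j
    rw [map_sum, Finset.sum_apply, Finset.sum_eq_single j]
    · rw [map_smul, Pi.smul_apply, LinearMap.domRestrict_apply, hL, smul_eq_mul,
        div_mul_cancel₀ _ (hp_ne j)]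
    · intro i _ hij
      rw [map_smul, Pi.smul_apply, LinearMap.domRestrict_apply, hL, hp_zero i j hij.symm,
        smul_zero]
    · simp
  have hinj : Function.Injective (L.domRestrict V) :=
    (LinearMap.injective_iff_surjective_of_finrank_eq_finrank (by simp [hV])).2 hsurj
  have hzero : (⟨_, hmem q hq⟩ : V) = 0 := hinj <| by
    rw [map_zero]
    ext i
    rw [LinearMap.domRestrict_apply, hL, hqc, Pi.zero_apply]
  exact Ideal.Quotient.eq_zero_iff_mem.1 (congrArg Subtype.val hzero)

/-- Any three points of `kⁿ`, `n ≥ 4`, lie in a common hyperplane through the origin. -/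
theorem exists_linearMap_ne_zero_forall_eq_zero {k : Type*} [Field k] {n : ℕ} (hn : 4 ≤ n)
    (c : Fin 3 → Fin n → k) : ∃ f : (Fin n → k) →ₗ[k] k, f ≠ 0 ∧ ∀ i, f (c i) = 0 := by
  have hlt : Submodule.span k (Set.range c) < ⊤ := by
    refine lt_top_iff_ne_top.2 fun h => ?_
    have h1 := finrank_range_le_card (R := k) c
    rw [Set.finrank, h, finrank_top] at h1
    simp at h1
    omega
  obtain ⟨f, hf, hle⟩ := Submodule.exists_le_ker_of_lt_top _ hlt
  exact ⟨f, hf, fun i => hle (Submodule.subset_span ⟨i, rfl⟩)⟩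

theorem stmt15 (k : Type*) [Field k] [IsAlgClosed k] (hchar : ringChar k ≠ 2)
    (n : ℕ) (hn : 4 ≤ n) (I : Ideal (MvPolynomial (Fin n) k))
    (hquad : ∃ Q : Set (MvPolynomial (Fin n) k),
      (∀ q ∈ Q, q.IsHomogeneous 2) ∧ I = Ideal.span Q)
    (hdim : hilbFn k n I 2 = 3)
    -- `S/I` is not a trivial fiber extension:
    (hTFE : ¬ ∃ ℓ : MvPolynomial (Fin n) k, ℓ.IsHomogeneous 1 ∧ ℓ ≠ 0 ∧
      ∀ g : MvPolynomial (Fin n) k, g.IsHomogeneous 1 → ℓ * g ∈ I)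
    -- `I` has at least one common nonzero zero:
    (hzero : ∃ c : Fin n → k, c ≠ 0 ∧ ∀ f ∈ I, MvPolynomial.eval c f = 0) :
    ∃ c₁ c₂ : Fin n → k, c₁ ≠ 0 ∧ c₂ ≠ 0 ∧
      ∀ c : Fin n → k, (∀ f ∈ I, MvPolynomial.eval c f = 0) →
        (∃ lam : k, c = lam • c₁) ∨ (∃ lam : k, c = lam • c₂) := by
  obtain ⟨c₁, h₁, hI₁⟩ := hzero
  by_contra! H
  have exists_zero : ∀ c : Fin n → k, c ≠ 0 → ∃ d : Fin n → k, (∀ f ∈ I, eval d f = 0) ∧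
      (∀ lam : k, d ≠ lam • c₁) ∧ ∀ lam : k, d ≠ lam • c := fun c hc => H c₁ c h₁ hc
  have notMem_span : ∀ c d : Fin n → k, (∀ lam : k, d ≠ lam • c) →
      d ∉ Submodule.span k {c} := by
    intro c d h hd
    obtain ⟨a, ha⟩ := Submodule.mem_span_singleton.1 hd
    exact h a ha.symm
  have notMem_span_symm : ∀ c d : Fin n → k, c ≠ 0 → (∀ lam : k, d ≠ lam • c) →
      c ∉ Submodule.span k {d} := by
    intro c d hc h hd
    obtain ⟨a, rfl⟩ := Submodule.mem_span_singleton.1 hd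
    have ha : a ≠ 0 := fun ha => hc (by rw [ha, zero_smul])
    exact h a⁻¹ (by rw [smul_smul, inv_mul_cancel₀ ha, one_smul])
  obtain ⟨c₂, hI₂, h₂₁, -⟩ := exists_zero c₁ h₁
  have h₂ : c₂ ≠ 0 := fun h => h₂₁ 0 (by rw [h, zero_smul])
  obtain ⟨c₃, hI₃, h₃₁, h₃₂⟩ := exists_zero c₂ h₂
  have hc : ∀ i j, i ≠ j → (![c₁, c₂, c₃] i) ∉ Submodule.span k {![c₁, c₂, c₃] j} := by
    intro i j hij
    fin_cases i <;> fin_cases j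
    · exact absurd rfl hij
    · exact notMem_span_symm _ _ h₁ h₂₁
    · exact notMem_span_symm _ _ h₁ h₃₁
    · exact notMem_span _ _ h₂₁
    · exact absurd rfl hij
    · exact notMem_span_symm _ _ h₂ h₃₂
    · exact notMem_span _ _ h₃₁
    · exact notMem_span _ _ h₃₂
    · exact absurd rfl hij
  have hI : ∀ i, ∀ f ∈ I, eval (![c₁, c₂, c₃] i) f = 0 := by
    intro i
    fin_cases i
    exacts [hI₁, hI₂, hI₃]
  obtain ⟨f, hf, hfc⟩ := exists_linearMap_ne_zero_forall_eq_zero hn ![c₁, c₂, c₃]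
  refine hTFE ⟨linearFormPoly f, linearFormPoly_isHomogeneous f, fun h => hf ?_, fun g hg =>
    mem_of_eval_eq_zero_of_hilbFn_eq_three hdim _ hc hI
      ((linearFormPoly_isHomogeneous f).mul hg) fun i => ?_⟩
  · ext1 c
    ext
    simpa [h] using (eval_linearFormPoly f (Pi.single c 1)).symm
  · rw [map_mul, eval_linearFormPoly, hfc, zero_mul]
end

section
/- Let k be a field, let S = k[x, y, t₁, t₂], and let I = (xy, xt₁, xt₂ − y² − t₁², yt₁, yt₂, t₁t₂, t₂²). Then the colon ideals satisfy I : (x) = I + (y, t₁) and I : (y) = I + (x, t₁, t₂). Equivalently, in R = S/I the annihilator of the image of x is the ideal generated by the images of y and t₁, and the annihilator of the image of y is the ideal generated by the images of x, t₁ and t₂. -/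
open MvPolynomial

/-- The ideal `(xy, xt₁, xt₂ - y² - t₁², yt₁, yt₂, t₁t₂, t₂²)` of `k[x, y, t₁, t₂]`. -/
noncomputable abbrev quadricIdeal (k : Type*) [Field k] : Ideal (MvPolynomial (Fin 4) k) :=
  Ideal.span {X 0 * X 1, X 0 * X 2, X 0 * X 3 - X 1 ^ 2 - X 2 ^ 2,
    X 1 * X 2, X 1 * X 3, X 2 * X 3, X 3 ^ 2}

namespace quadricIdeal

variable {k : Type*} [Field k]

lemma coeff_add_coeff_eq_zero {f : MvPolynomial (Fin 4) k} (hf : f ∈ quadricIdeal k) :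
    coeff (Finsupp.single 0 1 + Finsupp.single 3 1) f + coeff (Finsupp.single 1 2) f = 0 := by
  have hX (i j : Fin 4) : (X i * X j : MvPolynomial (Fin 4) k) =
      monomial (Finsupp.single i 1 + Finsupp.single j 1) 1 := by
    simp [X, monomial_mul]
  have hX2 (i : Fin 4) : (X i ^ 2 : MvPolynomial (Fin 4) k) =
      monomial (Finsupp.single i 2) 1 := by
    simp [X, monomial_pow]
  simp only [quadricIdeal, Ideal.mem_span_insert, Ideal.mem_span_singleton'] at hf
  obtain ⟨a₁, _, ⟨a₂, _, ⟨a₃, _, ⟨a₄, _, ⟨a₅, _, ⟨a₆, _, ⟨a₇, rfl⟩, rfl⟩, rfl⟩, rfl⟩, rfl⟩, rfl⟩,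
    rfl⟩ := hf
  simp only [hX, hX2, mul_sub, coeff_add, coeff_sub, coeff_mul_monomial']
  simp [Finsupp.le_def, Fin.forall_fin_succ, Finsupp.single_apply]

lemma aeval_X_eq_zero {f : MvPolynomial (Fin 4) k} (hf : f ∈ quadricIdeal k) :
    aeval ![(Polynomial.X : Polynomial k), 0, 0, 0] f = 0 := by
  suffices h : quadricIdeal k ≤
      RingHom.ker (aeval ![(Polynomial.X : Polynomial k), 0, 0, 0]) from h hf
  rw [Ideal.span_le]
  rintro _ (rfl | rfl | rfl | rfl | rfl | rfl | rfl) <;> simp [RingHom.mem_ker]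

lemma aeval_eps_eq_zero {f : MvPolynomial (Fin 4) k} (hf : f ∈ quadricIdeal k) :
    aeval ![0, (DualNumber.eps : DualNumber k), 0, 0] f = 0 := by
  suffices h : quadricIdeal k ≤
      RingHom.ker (aeval ![0, (DualNumber.eps : DualNumber k), 0, 0]) from h hf
  rw [Ideal.span_le]
  rintro _ (rfl | rfl | rfl | rfl | rfl | rfl | rfl) <;> simp [RingHom.mem_ker, pow_two]

lemma exists_sub_mem_of_X_one_X_two (J : Ideal (MvPolynomial (Fin 4) k))
    (h₁ : X 1 ∈ J) (h₂ : X 2 ∈ J) (h₀₃ : X 0 * X 3 ∈ J) (h₃₃ : X 3 ^ 2 ∈ J)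
    (f : MvPolynomial (Fin 4) k) :
    ∃ (p : Polynomial k) (e : k), f - (Polynomial.aeval (X 0) p + C e * X 3) ∈ J := by
  induction f using MvPolynomial.induction_on with
  | C a => exact ⟨Polynomial.C a, 0, by simp [MvPolynomial.algebraMap_eq]⟩
  | add f g hf hg =>
    obtain ⟨p, e, hf⟩ := hf
    obtain ⟨q, d, hg⟩ := hg
    refine ⟨p + q, e + d, ?_⟩
    convert J.add_mem hf hg using 1
    simp only [map_add]
    ring
  | mul_X f i hf =>
    obtain ⟨p, e, hf⟩ := hf
    fin_cases i
    · refine ⟨p * Polynomial.X, 0, ?_⟩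
      convert J.add_mem (J.mul_mem_left (X 0) hf) (J.mul_mem_left (C e) h₀₃) using 1
      simp
      ring
    · exact ⟨0, 0, by simpa using J.mul_mem_left f h₁⟩
    · exact ⟨0, 0, by simpa using J.mul_mem_left f h₂⟩
    · refine ⟨0, p.coeff 0, ?_⟩
      have hp := congrArg (Polynomial.aeval (X 0 : MvPolynomial (Fin 4) k)) p.divX_mul_X_add
      simp only [map_add, map_mul, Polynomial.aeval_X, Polynomial.aeval_C,
        MvPolynomial.algebraMap_eq] at hp
      convert J.add_mem (J.add_mem (J.mul_mem_left (X 3) hf) (J.mul_mem_left (C e) h₃₃))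
        (J.mul_mem_left (Polynomial.aeval (X 0) p.divX) h₀₃) using 1
      simp only [map_zero, Fin.reduceFinMk]
      linear_combination -X 3 * hp

lemma exists_sub_mem_of_X_zero_X_two_X_three (J : Ideal (MvPolynomial (Fin 4) k))
    (h₀ : X 0 ∈ J) (h₂ : X 2 ∈ J) (h₃ : X 3 ∈ J) (h₁₁ : X 1 ^ 2 ∈ J)
    (f : MvPolynomial (Fin 4) k) :
    ∃ a c : k, f - (C a + C c * X 1) ∈ J := by
  induction f using MvPolynomial.induction_on with
  | C a => exact ⟨a, 0, by simp⟩
  | add f g hf hg =>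
    obtain ⟨a, c, hf⟩ := hf
    obtain ⟨b, d, hg⟩ := hg
    refine ⟨a + b, c + d, ?_⟩
    convert J.add_mem hf hg using 1
    simp only [map_add]
    ring
  | mul_X f i hf =>
    obtain ⟨a, c, hf⟩ := hf
    fin_cases i
    · exact ⟨0, 0, by simpa using J.mul_mem_left f h₀⟩
    · refine ⟨0, a, ?_⟩
      convert J.add_mem (J.mul_mem_left (X 1) hf) (J.mul_mem_left (C c) h₁₁) using 1
      simp
      ring
    · exact ⟨0, 0, by simpa using J.mul_mem_left f h₂⟩
    · exact ⟨0, 0, by simpa using J.mul_mem_left f h₃⟩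

lemma mul_mem_of_mem_sup_span {R : Type*} [CommRing R] {I : Ideal R} {s : Set R} {z f : R}
    (hs : ∀ a ∈ s, a * z ∈ I) (hf : f ∈ I ⊔ Ideal.span s) : f * z ∈ I := by
  obtain ⟨i, hi, j, hj, rfl⟩ := Submodule.mem_sup.1 hf
  rw [add_mul]
  refine I.add_mem (I.mul_mem_right z hi) ?_
  clear hf
  induction hj using Submodule.span_induction with
  | mem a ha => exact hs a ha
  | zero => simp
  | add a b _ _ ha hb => simpa [add_mul] using I.add_mem ha hb
  | smul r a _ ha => simpa [mul_assoc] using I.mul_mem_left r ha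

lemma mul_X_zero_mem_iff (f : MvPolynomial (Fin 4) k) :
    f * X 0 ∈ quadricIdeal k ↔ f ∈ quadricIdeal k ⊔ Ideal.span {X 1, X 2} := by
  have hJ {g : MvPolynomial (Fin 4) k} (hg : g ∈ quadricIdeal k ⊔ Ideal.span {X 1, X 2}) :
      g * X 0 ∈ quadricIdeal k := by
    refine mul_mem_of_mem_sup_span ?_ hg
    rintro _ (rfl | rfl) <;> rw [mul_comm] <;> exact Ideal.subset_span (by simp)
  refine ⟨fun hf ↦ ?_, hJ⟩
  have hI {g : MvPolynomial (Fin 4) k} (hg : g ∈ quadricIdeal k) :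
      g ∈ quadricIdeal k ⊔ Ideal.span {X 1, X 2} := Ideal.mem_sup_left hg
  have h₁ : (X 1 : MvPolynomial (Fin 4) k) ∈ quadricIdeal k ⊔ Ideal.span {X 1, X 2} :=
    Ideal.mem_sup_right (Ideal.subset_span (by simp))
  have h₂ : (X 2 : MvPolynomial (Fin 4) k) ∈ quadricIdeal k ⊔ Ideal.span {X 1, X 2} :=
    Ideal.mem_sup_right (Ideal.subset_span (by simp))
  have h₀₃ : (X 0 * X 3 : MvPolynomial (Fin 4) k) ∈
      quadricIdeal k ⊔ Ideal.span {X 1, X 2} := by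
    have h : (X 0 * X 3 - X 1 ^ 2 - X 2 ^ 2 : MvPolynomial (Fin 4) k) ∈ quadricIdeal k :=
      Ideal.subset_span (by simp)
    convert Ideal.add_mem _ (Ideal.add_mem _ (hI h) (Ideal.mul_mem_left _ (X 1) h₁))
      (Ideal.mul_mem_left _ (X 2) h₂) using 1
    ring
  obtain ⟨p, e, hpe⟩ := exists_sub_mem_of_X_one_X_two _ h₁ h₂ h₀₃
    (hI (Ideal.subset_span (by simp))) f
  have hr : (Polynomial.aeval (X 0) p + C e * X 3) * X 0 ∈ quadricIdeal k := by
    convert Ideal.sub_mem _ hf (hJ hpe) using 1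
    ring
  have hp : p = 0 := by
    have h := aeval_X_eq_zero hr
    simpa [← Polynomial.aeval_algHom_apply] using h
  subst hp
  have he : e = 0 := by
    have h := coeff_add_coeff_eq_zero hr
    have hm : ((Polynomial.aeval (X 0) (0 : Polynomial k) + C e * X 3) * X 0 :
        MvPolynomial (Fin 4) k) = monomial (Finsupp.single 0 1 + Finsupp.single 3 1) e := by
      simp [X, C_mul_monomial, monomial_mul, add_comm]
    rw [hm, coeff_monomial, coeff_monomial, if_pos rfl, if_neg, add_zero] at h
    · exact h
    · intro h'
      simpa using DFunLike.congr_fun h' 0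
  simpa [he] using hpe

lemma mul_X_one_mem_iff (f : MvPolynomial (Fin 4) k) :
    f * X 1 ∈ quadricIdeal k ↔ f ∈ quadricIdeal k ⊔ Ideal.span {X 0, X 2, X 3} := by
  have hJ {g : MvPolynomial (Fin 4) k} (hg : g ∈ quadricIdeal k ⊔ Ideal.span {X 0, X 2, X 3}) :
      g * X 1 ∈ quadricIdeal k := by
    refine mul_mem_of_mem_sup_span ?_ hg
    rintro _ (rfl | rfl | rfl)
    · exact Ideal.subset_span (by simp)
    all_goals rw [mul_comm]; exact Ideal.subset_span (by simp)
  refine ⟨fun hf ↦ ?_, hJ⟩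
  have hX {i : Fin 4} (hi : (X i : MvPolynomial (Fin 4) k) ∈ ({X 0, X 2, X 3} : Set _)) :
      (X i : MvPolynomial (Fin 4) k) ∈ quadricIdeal k ⊔ Ideal.span {X 0, X 2, X 3} :=
    Ideal.mem_sup_right (Ideal.subset_span hi)
  have h₀ := hX (i := 0) (by simp)
  have h₂ := hX (i := 2) (by simp)
  have h₃ := hX (i := 3) (by simp)
  have h₁₁ : (X 1 ^ 2 : MvPolynomial (Fin 4) k) ∈
      quadricIdeal k ⊔ Ideal.span {X 0, X 2, X 3} := by
    have h : (X 0 * X 3 - X 1 ^ 2 - X 2 ^ 2 : MvPolynomial (Fin 4) k) ∈ quadricIdeal k :=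
      Ideal.subset_span (by simp)
    convert Ideal.sub_mem _ (Ideal.sub_mem _ (Ideal.mul_mem_left _ (X 3) h₀)
      (Ideal.mul_mem_left _ (X 2) h₂)) (Ideal.mem_sup_left h) using 1
    ring
  obtain ⟨a, c, hac⟩ := exists_sub_mem_of_X_zero_X_two_X_three _ h₀ h₂ h₃ h₁₁ f
  have hr : (C a + C c * X 1) * X 1 ∈ quadricIdeal k := by
    convert Ideal.sub_mem _ hf (hJ hac) using 1
    ring
  have ha : a = 0 := by
    have h := congrArg TrivSqZeroExt.snd (aeval_eps_eq_zero hr)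
    simpa [TrivSqZeroExt.algebraMap_eq_inl] using h
  subst ha
  have hc : c = 0 := by
    have h := coeff_add_coeff_eq_zero hr
    have hm : ((C 0 + C c * X 1) * X 1 : MvPolynomial (Fin 4) k) =
        monomial (Finsupp.single 1 2) c := by
      simp [X, C_mul_monomial, monomial_mul, ← Finsupp.single_add]
    rw [hm, coeff_monomial, coeff_monomial, if_pos rfl, if_neg, zero_add] at h
    · exact h
    · intro h'
      simpa using DFunLike.congr_fun h' 0
  simpa [hc] using hac

end quadricIdeal

theorem stmt16 (k : Type*) [Field k] :
    letI x : MvPolynomial (Fin 4) k := X 0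
    letI y : MvPolynomial (Fin 4) k := X 1
    letI t₁ : MvPolynomial (Fin 4) k := X 2
    letI t₂ : MvPolynomial (Fin 4) k := X 3
    letI I : Ideal (MvPolynomial (Fin 4) k) :=
      Ideal.span {x * y, x * t₁, x * t₂ - y ^ 2 - t₁ ^ 2,
        y * t₁, y * t₂, t₁ * t₂, t₂ ^ 2}
    (∀ f : MvPolynomial (Fin 4) k, f * x ∈ I ↔ f ∈ I ⊔ Ideal.span {y, t₁}) ∧
    (∀ f : MvPolynomial (Fin 4) k, f * y ∈ I ↔ f ∈ I ⊔ Ideal.span {x, t₁, t₂}) :=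
  ⟨quadricIdeal.mul_X_zero_mem_iff, quadricIdeal.mul_X_one_mem_iff⟩
end
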